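/- Let k be an algebraically closed field of characteristic 0 and let F ∈ k[x_0,x_1,x_2,x_3] be an irreducible homogeneous polynomial of degree d ≥ 4 defining the integral surface X = {F = 0} ⊂ P^3, and suppose that only finitely many 2-dimensional k-linear subspaces of k^4 are contained in {x ∈ k^4 : F(x) = 0} (only finitely many lines lie on X). Let W be the set of planes Π ⊂ P^3 (3-dimensional k-linear subspaces Π of k^4) such that the restriction of F to Π is divisible by a nonzero cubic form on Π. Then W, viewed as a subset of the dual projective space P^{3∨}, is contained in a Zariski-closed subset of dimension at most 1; i.e. there exists a homogeneous ideal J ⊂ k[a_0,a_1,a_2,a_3] with Krull dimension of k[a_0,a_1,a_2,a_3]/J at most 2, such that every polynomial in J vanishes at the coefficient vector (a_0,a_1,a_2,a_3) of every nonzero linear form a_0x_0+⋯+a_3x_3 whose kernel belongs to W. -/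

import Mathlib

open MvPolynomial

/-- The composite `G ∘ ψ` of a polynomial `G` in `m` variables with a linear map
`ψ : k^n → k^m`, as a polynomial in `n` variables. -/
noncomputable def restrictPoly {k : Type*} [CommSemiring k] {m n : ℕ}
    (G : MvPolynomial (Fin m) k) (ψ : (Fin n → k) →ₗ[k] (Fin m → k)) :
    MvPolynomial (Fin n) k :=
  aeval (fun i => ∑ j, C (ψ (Pi.single j 1) i) * X j) G

section Helpers

section Der
variable {k K ι : Type*} [Field k] [CharZero k] [Field K] [Algebra k K]

open scoped IntermediateField.algebraAdjoinAdjoin in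
theorem fe_adjoin {x : ι → K} (hx : IsTranscendenceBasis k x) :
    Algebra.FormallyEtale (Algebra.adjoin k (Set.range x)) K := by
  have h2 := hx.isAlgebraic_field
  have : CharZero (IntermediateField.adjoin k (Set.range x)) := charZero_of_injective_algebraMap (algebraMap k _).injective
  have : Algebra.IsSeparable (IntermediateField.adjoin k (Set.range x)) K := inferInstance
  have h3 : Algebra.FormallyEtale (IntermediateField.adjoin k (Set.range x)) K :=
    Algebra.FormallyEtale.of_isSeparable _ K
  have : Algebra.FormallyEtale (Algebra.adjoin k (Set.range x))
      (IntermediateField.adjoin k (Set.range x)) :=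
    .of_isLocalization (nonZeroDivisors _)
  exact .comp _ (IntermediateField.adjoin k (Set.range x)) _

theorem der_exists {x : ι → K} (hx : IsTranscendenceBasis k x) (v : ι → K) :
    ∃ D : Derivation k K K, ∀ i, D (x i) = v i := by
  let _ : Algebra (MvPolynomial ι k) K := (aeval x : MvPolynomial ι k →ₐ[k] K).toAlgebra
  have hst : IsScalarTower k (MvPolynomial ι k) K :=
    IsScalarTower.of_algebraMap_eq' (aeval x : MvPolynomial ι k →ₐ[k] K).comp_algebraMap.symm
  let _ : Algebra (MvPolynomial ι k) (Algebra.adjoin k (Set.range x)) :=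
    (hx.1.aevalEquiv : MvPolynomial ι k →ₐ[k] _).toAlgebra
  have : IsScalarTower (MvPolynomial ι k) (Algebra.adjoin k (Set.range x)) K := by
    refine IsScalarTower.of_algebraMap_eq fun p => ?_
    exact (hx.1.algebraMap_aevalEquiv p).symm
  have := fe_adjoin hx
  have : Algebra.FormallyEtale (MvPolynomial ι k) (Algebra.adjoin k (Set.range x)) := by
    refine Algebra.FormallyEtale.of_equiv (R := MvPolynomial ι k) (A := MvPolynomial ι k)
      (AlgEquiv.ofBijective (Algebra.ofId _ _) hx.1.aevalEquiv.bijective)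
  have : Algebra.FormallyEtale (MvPolynomial ι k) K :=
    .comp _ (Algebra.adjoin k (Set.range x)) _
  let e := KaehlerDifferential.tensorKaehlerEquivOfFormallyEtale k (MvPolynomial ι k) K
  let d0 : Derivation k (MvPolynomial ι k) K := mkDerivation k v
  let l : TensorProduct (MvPolynomial ι k) K (Ω[MvPolynomial ι k⁄k]) →ₗ[K] K :=
    LinearMap.liftBaseChange K d0.liftKaehlerDifferential
  refine ⟨(l.comp e.symm.toLinearMap).compDer (KaehlerDifferential.D k K), fun i => ?_⟩
  have h1 : x i = algebraMap (MvPolynomial ι k) K (X i) := by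
    change _ = aeval x (X i); simp
  change l (e.symm (KaehlerDifferential.D k K (x i))) = _
  rw [h1, KaehlerDifferential.tensorKaehlerEquivOfFormallyEtale_symm_D_algebraMap]
  simp [l, d0]

theorem der_unique {x : ι → K} (hx : IsTranscendenceBasis k x) (D : Derivation k K K)
    (h : ∀ i, D (x i) = 0) : D = 0 := by
  have h0 : ∀ y ∈ Algebra.adjoin k (Set.range x), D y = 0 := by
    intro y hy
    induction hy using Algebra.adjoin_induction with
    | mem y hy => obtain ⟨i, rfl⟩ := hy; exact h i
    | algebraMap r => simp
    | add a b _ _ ha hb => simp [ha, hb]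
    | mul a b _ _ ha hb => simp [ha, hb]
  have := fe_adjoin hx
  let D' : Derivation (Algebra.adjoin k (Set.range x)) K K :=
    { toFun := D
      map_add' := map_add D
      map_smul' := by
        intro m y
        simp [Algebra.smul_def, Derivation.leibniz, h0 _ m.2]
      map_one_eq_zero' := by simp
      leibniz' := fun a b => D.leibniz a b }
  have h1 : D' = 0 := by
    have := D'.liftKaehlerDifferential_comp
    rw [← this, Subsingleton.elim D'.liftKaehlerDifferential 0]
    ext; rfl
  ext y
  exact congrArg (fun d => d y) h1

theorem der_ker [IsAlgClosed k] (y : K) (h : ∀ D : Derivation k K K, D y = 0) :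
    ∃ u : k, algebraMap k K u = y := by
  by_contra hc
  have hy : Transcendental k y := by
    intro hy
    have h1 := IsAlgClosed.degree_eq_one_of_irreducible k (minpoly.irreducible hy.isIntegral)
    exact hc (minpoly.mem_range_of_degree_eq_one k y h1)
  obtain ⟨s, hs, hb⟩ := exists_isTranscendenceBasis_superset (R := k) (s := ({y} : Set K))
    (by
      exact algebraicIndependent_unique_type_iff.2 (by simpa using hy))
  obtain ⟨D, hD⟩ := der_exists hb 1
  have := hD ⟨y, hs rfl⟩
  simp [h] at this

end Der

section Tool
variable {k K σ : Type*} [Field k] [Field K] [Algebra k K]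

noncomputable def cDf (D : Derivation k K K) (p : MvPolynomial σ K) : MvPolynomial σ K :=
  ∑ m ∈ p.support, monomial m (D (coeff m p))

theorem coeff_cDf (D : Derivation k K K) (p : MvPolynomial σ K) (m) :
    coeff m (cDf D p) = D (coeff m p) := by
  classical
  rw [cDf, coeff_sum]
  simp [coeff_monomial]
  intro h; simp [h]

/-- coefficientwise derivation -/
noncomputable def cD (D : Derivation k K K) :
    Derivation k (MvPolynomial σ K) (MvPolynomial σ K) where
  toFun p := cDf D p
  map_add' p q := by ext m; simp [coeff_cDf]
  map_smul' r p := by ext m; simp [coeff_cDf]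
  map_one_eq_zero' := by
    classical
    ext m
    change coeff m (cDf D 1) = _
    rw [coeff_cDf, coeff_one]; split_ifs <;> simp
  leibniz' p q := by
    classical
    ext m
    change coeff m (cDf D (p*q)) = coeff m (p * cDf D q + q * cDf D p)
    rw [mul_comm q, coeff_cDf, coeff_add, coeff_mul, coeff_mul, coeff_mul, map_sum, ← Finset.sum_add_distrib]
    refine Finset.sum_congr rfl fun x _ => ?_
    rw [coeff_cDf, coeff_cDf, Derivation.leibniz]; simp [mul_comm]

theorem coeff_cD (D : Derivation k K K) (p : MvPolynomial σ K) (m) :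
    coeff m (cD D p) = D (coeff m p) := coeff_cDf D p m

@[simp] theorem cD_C (D : Derivation k K K) (x : K) : cD D (C x : MvPolynomial σ K) = C (D x) := by
  classical
  ext m; rw [coeff_cD, coeff_C, coeff_C]; split_ifs <;> simp

@[simp] theorem cD_X (D : Derivation k K K) (i : σ) : cD D (X i : MvPolynomial σ K) = 0 := by
  classical
  ext m; rw [coeff_cD, coeff_X]; split_ifs <;> simp

theorem cD_hom (D : Derivation k K K) {p : MvPolynomial σ K} {n} (h : p.IsHomogeneous n) :
    (cD D p).IsHomogeneous n := by
  intro m hm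
  apply h
  intro h0
  rw [coeff_cD, h0, map_zero] at hm
  exact hm rfl

theorem cD_add (D E : Derivation k K K) (p : MvPolynomial σ K) : cD (D + E) p = cD D p + cD E p := by
  ext m; simp [coeff_cD]

theorem cD_smul (x : K) (D : Derivation k K K) (p : MvPolynomial σ K) :
    cD (x • D) p = C x * cD D p := by
  ext m; simp [coeff_cD]

/-- chain rule at a point -/
theorem D_eval [Fintype σ] (D : Derivation k K K) (q : σ → K) (p : MvPolynomial σ K) :
    D (eval q p) = eval q (cD D p) + ∑ i, D (q i) * eval q (pderiv i p) := by
  classical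
  induction p using MvPolynomial.induction_on with
  | C a => simp
  | add p q hp hq => simp only [map_add, hp, hq, mul_add, Finset.sum_add_distrib]; ring
  | mul_X p i hp =>
    simp only [map_mul, eval_X, Derivation.leibniz, smul_eq_mul, hp, cD_X, map_add, mul_zero, zero_add,
      pderiv_X, mul_add, Finset.sum_add_distrib, Finset.mul_sum]
    rw [Finset.sum_eq_single (a := i) (f := fun x => D (q x) * (eval q p * _))]
    · simp
      have : ∀ x, q i * (D (q x) * eval q (pderiv x p)) = D (q x) * (q i * eval q (pderiv x p)) := fun x => by ring
      simp only [this]; ring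
    · intro j _ hj; simp [hj.symm]
    · simp

/-- chain rule: constant-coefficient polynomial, arbitrary derivation -/
theorem der_aeval {R : Type*} [CommRing R] [Algebra k R] [Fintype σ] (D : Derivation k R R) (q : σ → R)
    (p : MvPolynomial σ k) :
    D (aeval q p) = ∑ i, D (q i) * aeval q (pderiv i p) := by
  classical
  induction p using MvPolynomial.induction_on with
  | C a => simp
  | add p q hp hq => simp only [map_add, hp, hq, mul_add, Finset.sum_add_distrib]
  | mul_X p i hp =>
    simp only [map_mul, aeval_X, Derivation.leibniz, smul_eq_mul, hp, map_add,
      pderiv_X, mul_add, Finset.sum_add_distrib, Finset.mul_sum]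
    rw [Finset.sum_eq_single (a := i) (f := fun x => D (q x) * (aeval q p * _))]
    · simp
      have : ∀ x, q i * (D (q x) * aeval q (pderiv x p)) = D (q x) * (q i * aeval q (pderiv x p)) := fun x => by ring
      simp only [this]; ring
    · intro j _ hj; simp [hj.symm]
    · simp

/-- Darboux -/
theorem darboux {R : Type*} [CommRing R] [IsDomain R] [UniqueFactorizationMonoid R]
    (hu : ∀ n : ℕ, IsUnit ((n : R) + 1))
    (θ : R → R) (hadd : ∀ x y, θ (x * y) = x * θ y + y * θ x)
    {A B : R} (hA : Irreducible A) (h0 : A * B ≠ 0) (h : θ (A * B) = 0) :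
    ∃ m, θ A = m * A ∧ θ B = - (m * B) := by
  have hp := hA.prime
  have hB : B ≠ 0 := right_ne_zero_of_mul h0
  have hA0 : A ≠ 0 := hA.ne_zero
  have hpow : ∀ j : ℕ, θ (A ^ (j+1)) = (j+1) * A ^ j * θ A := by
    intro j
    induction j with
    | zero => simp
    | succ j ih => rw [pow_succ, hadd, ih]; push_cast; ring
  obtain ⟨c, hBc, hc⟩ :=
    (FiniteMultiplicity.of_not_isUnit hA.not_isUnit hB).exists_eq_pow_mul_and_not_dvd
  set j := multiplicity A B
  have h1 : θ (A ^ (j + 1) * c) = 0 := by rw [← h]; congr 1; rw [hBc]; ring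
  rw [hadd, hpow] at h1
  have h2 : A ^ j * (A * θ c + (j + 1) * (c * θ A)) = 0 := by rw [← h1]; ring
  have h3 := (mul_eq_zero.1 h2).resolve_left (pow_ne_zero _ hA0)
  have h4 : A ∣ (j + 1) * (c * θ A) := ⟨-θ c, by linear_combination h3⟩
  have h5 : A ∣ θ A := by
    rcases hp.2.2 _ _ h4 with h | h
    · exact absurd (isUnit_of_dvd_unit h (hu j)) hA.not_isUnit
    · exact (hp.2.2 _ _ h).resolve_left hc
  obtain ⟨m, hm⟩ := h5
  refine ⟨m, by rw [hm]; ring, ?_⟩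
  rw [hadd, hm] at h
  have : A * (θ B + m * B) = 0 := by rw [← h]; ring
  linear_combination (mul_eq_zero.1 this).resolve_left hA0

/-- elimination -/
theorem elim_lemma {R : Type*} [CommRing R] [IsDomain R] [UniqueFactorizationMonoid R]
    {A B : Polynomial R} (hA : Irreducible A) (h : ¬ A ∣ B) :
    ∃ U V : Polynomial R, ∃ r : R, r ≠ 0 ∧ U * A + V * B = Polynomial.C r := by
  by_cases hdeg : A.natDegree = 0
  · obtain ⟨a, rfl⟩ := Polynomial.natDegree_eq_zero.1 hdeg
    exact ⟨1, 0, a, fun h0 => hA.ne_zero (by simp [h0]), by simp⟩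
  let I := Ideal.span {A}
  have hI : I.IsPrime := (Ideal.span_singleton_prime hA.ne_zero).2 hA.prime
  have hinj : Function.Injective (algebraMap R (Polynomial R ⧸ I)) := by
    rw [injective_iff_map_eq_zero]
    intro r hr
    have : A ∣ Polynomial.C r := by
      rw [← Ideal.mem_span_singleton]; exact Ideal.Quotient.eq_zero_iff_mem.1 hr
    by_contra hr0
    have h3 := Polynomial.natDegree_le_of_dvd this (by simpa using hr0)
    simp at h3; exact hdeg h3
  have halg : IsAlgebraic R (Ideal.Quotient.mk I B) := by
    have hX : IsAlgebraic R (Ideal.Quotient.mk I Polynomial.X) := by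
      refine ⟨A, hA.ne_zero, ?_⟩
      have : (Polynomial.aeval (Ideal.Quotient.mk I Polynomial.X)) A = Ideal.Quotient.mkₐ R I (Polynomial.aeval Polynomial.X A) := by
        rw [← Polynomial.aeval_algHom_apply]; rfl
      rw [this, Polynomial.aeval_X_left_apply]
      exact Ideal.Quotient.eq_zero_iff_mem.2 (Ideal.mem_span_singleton_self A)
    have : (Polynomial.aeval (Ideal.Quotient.mk I Polynomial.X)) B = Ideal.Quotient.mk I B := by
      have : (Polynomial.aeval (Ideal.Quotient.mk I Polynomial.X)) B = Ideal.Quotient.mkₐ R I (Polynomial.aeval Polynomial.X B) := by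
        rw [← Polynomial.aeval_algHom_apply]; rfl
      rw [this, Polynomial.aeval_X_left_apply]; rfl
    rw [← this, Polynomial.aeval_eq_sum_range]
    refine Finset.sum_induction _ (IsAlgebraic R) (fun _ _ => IsAlgebraic.add) isAlgebraic_zero fun i _ => ?_
    rw [Algebra.smul_def]
    exact (isAlgebraic_algebraMap _).mul (hX.pow i)
  have hne : Ideal.Quotient.mk I B ≠ 0 := fun h0 => h (by
    rw [← Ideal.mem_span_singleton]; exact Ideal.Quotient.eq_zero_iff_mem.1 h0)
  obtain ⟨r, hr, y, hy⟩ := halg.exists_nonzero_dvd (mem_nonZeroDivisors_of_ne_zero hne)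
  obtain ⟨V, rfl⟩ := Ideal.Quotient.mk_surjective y
  have h6 : Polynomial.C r - V * B ∈ I := by
    rw [← Ideal.Quotient.eq_zero_iff_mem, map_sub, map_mul, sub_eq_zero, mul_comm]
    exact hy
  obtain ⟨U, hU⟩ := Ideal.mem_span_singleton'.1 h6
  exact ⟨U, V, r, hr, by rw [hU]; ring⟩

theorem exists_grad [CharZero k] {n : ℕ} {x : Fin n → K} (h : ¬ AlgebraicIndependent k x) :
    ∃ H : MvPolynomial (Fin n) k, aeval x H = 0 ∧ ∃ i, aeval x (pderiv i H) ≠ 0 := by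
  classical
  rw [algebraicIndependent_iff] at h
  push Not at h
  obtain ⟨H0, hH0⟩ := h
  let P : ℕ → Prop := fun e => ∃ H : MvPolynomial (Fin n) k, aeval x H = 0 ∧ H ≠ 0 ∧ H.totalDegree = e
  have hP : ∃ e, P e := ⟨_, H0, hH0.1, hH0.2, rfl⟩
  obtain ⟨H, h1, h2, h3⟩ := Nat.find_spec hP
  refine ⟨H, h1, ?_⟩
  by_contra hc
  push Not at hc
  have hz : ∀ i, pderiv i H = 0 := by
    intro i
    by_contra h0
    have hlt : (pderiv i H).totalDegree < H.totalDegree := by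
      have hs : ∀ m ∈ (pderiv i H).support, m.degree < H.totalDegree := by
        intro m hm
        rw [mem_support_iff, coeff_pderiv] at hm
        have h5 := le_totalDegree (mem_support_iff.2 (left_ne_zero_of_mul hm))
        change (m + Finsupp.single i 1).degree ≤ _ at h5
        rw [map_add, Finsupp.degree_single] at h5
        omega
      obtain ⟨m, hm⟩ := (support_nonempty).2 h0
      exact (Finset.sup_lt_iff (lt_of_le_of_lt (Nat.zero_le _) (hs m hm))).2 hs
    exact Nat.find_min hP (h3 ▸ hlt) ⟨_, hc i, h0, rfl⟩
  have hC : H = C (coeff 0 H) := by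
    ext m
    rw [coeff_C]
    split_ifs with hm
    · rw [hm]
    · obtain ⟨i, hi⟩ := Finsupp.ne_iff.1 (Ne.symm hm)
      have := congrArg (coeff (m - Finsupp.single i 1)) (hz i)
      rw [coeff_pderiv, coeff_zero, Finsupp.sub_add_single_one_cancel hi] at this
      rcases mul_eq_zero.1 this with h | h
      · exact h
      · exfalso; revert h; norm_cast
  rw [hC] at h1 h2
  simp at h1 h2
  exact h2 h1
end Tool

section Hom
variable {K σ : Type*} [Field K]

/-- `p ↦ p(tx)` -/
noncomputable def scl : MvPolynomial σ K →ₐ[K] Polynomial (MvPolynomial σ K) :=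
  aeval fun i => Polynomial.C (X i) * Polynomial.X

theorem scl_hom {p : MvPolynomial σ K} {n} (h : p.IsHomogeneous n) :
    scl p = Polynomial.C p * Polynomial.X ^ n := by
  classical
  have h1 : ∀ m ∈ p.support, scl (monomial m (coeff m p)) = Polynomial.C (monomial m (coeff m p)) * Polynomial.X ^ n := by
    intro m hm
    have hn : m.degree = n := by
      rw [Finsupp.degree_eq_weight_one]; exact h (mem_support_iff.1 hm)
    rw [scl, aeval_monomial]
    simp only [mul_pow, Finsupp.prod_mul]
    have e2 : (m.prod fun _ e => (Polynomial.X : Polynomial (MvPolynomial σ K)) ^ e) = Polynomial.X ^ n := by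
      rw [← hn, Finsupp.prod, Finset.prod_pow_eq_pow_sum, Finsupp.degree_apply]
    rw [e2, monomial_eq, map_mul, Finsupp.prod, Finsupp.prod, map_prod, ← mul_assoc]
    simp only [map_pow]
    rfl
  conv_lhs => rw [p.as_sum, map_sum, Finset.sum_congr rfl h1]
  conv_rhs => rw [p.as_sum, map_sum, Finset.sum_mul]

theorem scl_coeff (p : MvPolynomial σ K) (i : ℕ) :
    (scl p).coeff i = homogeneousComponent i p := by
  conv_lhs => rw [← sum_homogeneousComponent p, map_sum]
  rw [Polynomial.finsetSum_coeff]
  rw [Finset.sum_congr rfl (fun j _ => by rw [scl_hom (homogeneousComponent_isHomogeneous j p), Polynomial.coeff_C_mul_X_pow])]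
  simp
  intro h
  rw [homogeneousComponent_eq_zero _ _ (by omega)]

theorem hom_factor {P Q : MvPolynomial σ K} {n : ℕ} (h : (P * Q).IsHomogeneous n) (h0 : P * Q ≠ 0) :
    ∃ i j, P.IsHomogeneous i ∧ Q.IsHomogeneous j ∧ i + j = n := by
  have hinj : ∀ p : MvPolynomial σ K, scl p = 0 → p = 0 := by
    intro p hp
    rw [← sum_homogeneousComponent p]
    exact Finset.sum_eq_zero fun i _ => by rw [← scl_coeff, hp, Polynomial.coeff_zero]
  have hP : scl P ≠ 0 := fun hh => h0 (by rw [hinj _ hh, zero_mul])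
  have hQ : scl Q ≠ 0 := fun hh => h0 (by rw [hinj _ hh, mul_zero])
  have e := scl_hom h
  rw [map_mul] at e
  have d1 := congrArg Polynomial.natDegree e
  have d2 := congrArg Polynomial.natTrailingDegree e
  rw [Polynomial.natDegree_mul hP hQ, Polynomial.natDegree_C_mul_X_pow _ _ h0] at d1
  rw [Polynomial.natTrailingDegree_mul hP hQ, Polynomial.C_mul_X_pow_eq_monomial, Polynomial.natTrailingDegree_monomial h0] at d2
  have l1 := Polynomial.natTrailingDegree_le_natDegree (scl P)
  have l2 := Polynomial.natTrailingDegree_le_natDegree (scl Q)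
  have key : ∀ p : MvPolynomial σ K, (scl p).natTrailingDegree = (scl p).natDegree → p.IsHomogeneous (scl p).natDegree := by
    intro p hp
    have : p = homogeneousComponent (scl p).natDegree p := by
      conv_lhs => rw [← sum_homogeneousComponent p]
      have hz : ∀ j, j ≠ (scl p).natDegree → homogeneousComponent j p = 0 := by
        intro j hj
        rw [← scl_coeff]
        rcases lt_or_gt_of_ne hj with h | h
        · exact Polynomial.coeff_eq_zero_of_lt_natTrailingDegree (hp ▸ h)
        · exact Polynomial.coeff_eq_zero_of_natDegree_lt h
      rw [Finset.sum_eq_single (scl p).natDegree]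
      · intro j _ hj; exact hz j hj
      · intro hj
        rw [homogeneousComponent_eq_zero _ _ (by simp at hj; omega)]
    rw [this]
    have h2 := homogeneousComponent_isHomogeneous (scl p).natDegree p
    rwa [← this] at h2 ⊢
  exact ⟨_, _, key P (by omega), key Q (by omega), d1⟩

/-- homogeneous of degree one is a linear combination -/
theorem hom_one_irr {A : MvPolynomial σ K} (hA : A.IsHomogeneous 3) (h0 : A ≠ 0)
    (hnl : ∀ h : MvPolynomial σ K, h.IsHomogeneous 1 → h ≠ 0 → ¬ h ∣ A) : Irreducible A := by
  refine ⟨?_, ?_⟩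
  · intro hu
    obtain ⟨B, hB⟩ := hu.exists_right_inv
    obtain ⟨i, j, hi, hj, hij⟩ := hom_factor (P := A) (Q := B) (n := 0) (by rw [hB]; exact isHomogeneous_one _ _) (by rw [hB]; exact one_ne_zero)
    have := hA.inj_right hi h0
    omega
  · intro P Q hPQ
    obtain ⟨i, j, hi, hj, hij⟩ := hom_factor (P := P) (Q := Q) (n := 3) (hPQ ▸ hA) (hPQ ▸ h0)
    have hP0 : P ≠ 0 := fun h => h0 (by rw [hPQ, h, zero_mul])
    have hQ0 : Q ≠ 0 := fun h => h0 (by rw [hPQ, h, mul_zero])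
    have hc : ∀ P : MvPolynomial σ K, P ≠ 0 → P.IsHomogeneous 0 → IsUnit P := by
      intro P h h1
      have h2 := totalDegree_eq_zero_iff_eq_C.1 (h1.totalDegree h)
      rw [h2] at h ⊢
      exact (IsUnit.mk0 _ (by simpa using h)).map C
    have h4 : i = 0 ∨ i = 1 ∨ j = 1 ∨ j = 0 := by omega
    rcases h4 with rfl | rfl | rfl | rfl
    · exact Or.inl (hc P hP0 hi)
    · exact absurd ⟨Q, hPQ⟩ (hnl P hi hP0)
    · exact absurd ⟨P, by rw [hPQ, mul_comm]⟩ (hnl Q hj hQ0)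
    · exact Or.inr (hc Q hQ0 hj)
end Hom

section Basic
variable {k K : Type*} [Field k] [Field K] [Algebra k K]

/-- `f` vanishes on no line of the plane -/
def NL (f : MvPolynomial (Fin 3) K) : Prop :=
  ∀ u v : Fin 3 → K, (∀ s t : K, s • u + t • v = 0 → s = 0 ∧ t = 0) →
    ∃ s t : K, eval (s • u + t • v) f ≠ 0

theorem NL.left {A B : MvPolynomial (Fin 3) K} (h : NL (A * B)) : NL A := by
  intro u v huv
  obtain ⟨s, t, hst⟩ := h u v huv
  exact ⟨s, t, fun h0 => hst (by rw [map_mul, h0, zero_mul])⟩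

theorem NL.right {A B : MvPolynomial (Fin 3) K} (h : NL (A * B)) : NL B :=
  NL.left (A := B) (B := A) (by rwa [mul_comm])

theorem lin_form {h : MvPolynomial (Fin 3) K} (hh : h.IsHomogeneous 1) :
    h = ∑ i, C (coeff (Finsupp.single i 1) h) * X i := by
  classical
  ext m
  by_cases hm : m.degree = 1
  · obtain ⟨i, rfl⟩ : ∃ i, m = Finsupp.single i 1 := by
      have h0 : m ≠ 0 := by rintro rfl; simp at hm
      obtain ⟨i, hi⟩ := Finsupp.ne_iff.1 h0
      refine ⟨i, ?_⟩
      have h1 := Finsupp.sub_add_single_one_cancel hi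
      rw [← h1, map_add, Finsupp.degree_single] at hm
      have h2 : (m - Finsupp.single i 1).degree = 0 := by omega
      rw [Finsupp.degree_eq_zero_iff] at h2
      rw [← h1, h2, zero_add]
    rw [coeff_sum, Finset.sum_eq_single i]
    · rw [coeff_C_mul, coeff_X, if_pos rfl, mul_one]
    · intro j _ hj
      rw [coeff_C_mul, coeff_X, if_neg, mul_zero]
      intro h; exact hj ((Finsupp.single_left_inj one_ne_zero).1 h)
    · simp
  · rw [hh.coeff_eq_zero hm, coeff_sum, Finset.sum_eq_zero]
    intro j _
    rw [coeff_C_mul, coeff_X, if_neg, mul_zero]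
    rintro rfl; simp at hm

theorem ker_lin (ℓ : Fin 3 → K) : ∃ u v : Fin 3 → K, (∀ s t : K, s • u + t • v = 0 → s = 0 ∧ t = 0) ∧
    ∑ i, ℓ i * u i = 0 ∧ ∑ i, ℓ i * v i = 0 := by
  by_cases h0 : ℓ 0 = 0
  · by_cases h1 : ℓ 1 = 0
    · refine ⟨![1,0,0], ![0,1,0], ?_, ?_, ?_⟩
      · intro s t h
        have a := congrFun h 0; have b := congrFun h 1
        simp at a b; exact ⟨a, b⟩
      all_goals simp [Fin.sum_univ_three, h0, h1]
    · refine ⟨![1,0,0], ![0,-ℓ 2,ℓ 1], ?_, ?_, ?_⟩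
      · intro s t h
        have a := congrFun h 0; have b := congrFun h 2
        simp [h1] at a b; exact ⟨a, b⟩
      · simp [Fin.sum_univ_three, h0]
      · simp [Fin.sum_univ_three, h0]; ring
  · refine ⟨![-ℓ 1,ℓ 0,0], ![-ℓ 2,0,ℓ 0], ?_, ?_, ?_⟩
    · intro s t h
      have a := congrFun h 1; have b := congrFun h 2
      simp [h0] at a b; exact ⟨a, b⟩
    · simp [Fin.sum_univ_three]; ring
    · simp [Fin.sum_univ_three]; ring

theorem NL.lin {A : MvPolynomial (Fin 3) K} (hA : NL A) (h : MvPolynomial (Fin 3) K)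
    (h1 : h.IsHomogeneous 1) : ¬ h ∣ A := by
  rintro ⟨Q, rfl⟩
  obtain ⟨u, v, huv, hu, hv⟩ := ker_lin (fun i => coeff (Finsupp.single i 1) h)
  obtain ⟨s, t, hst⟩ := hA u v huv
  apply hst
  rw [map_mul, lin_form h1]
  have : eval (s • u + t • v) (∑ i, C (coeff (Finsupp.single i 1) h) * X i) = 0 := by
    simp only [map_sum, map_mul, eval_C, eval_X, Pi.add_apply, Pi.smul_apply, smul_eq_mul]
    calc _ = s * ∑ i, coeff (Finsupp.single i 1) h * u i + t * ∑ i, coeff (Finsupp.single i 1) h * v i := by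
          simp only [Fin.sum_univ_three]; ring
      _ = 0 := by rw [hu, hv]; ring
  rw [this, zero_mul]

theorem NL.ne_zero {A : MvPolynomial (Fin 3) K} (hA : NL A) : A ≠ 0 := by
  rintro rfl
  exact hA.lin 0 (isHomogeneous_zero _ _ _) (dvd_zero _)

theorem NL.irr {A : MvPolynomial (Fin 3) K} (hA : NL A) (h3 : A.IsHomogeneous 3) : Irreducible A :=
  hom_one_irr h3 hA.ne_zero fun h h1 _ => hA.lin h h1

theorem eval_smul_hom {σ : Type*} {A : MvPolynomial σ K} {e : ℕ} (hA : A.IsHomogeneous e) (t : K) (x : σ → K) :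
    eval (t • x) A = t ^ e * eval x A := by
  have h := congrArg (Polynomial.eval t) (congrArg (Polynomial.map (eval x)) (scl_hom hA))
  rw [Polynomial.map_mul, Polynomial.map_C, Polynomial.map_pow, Polynomial.map_X] at h
  simp only [Polynomial.eval_mul, Polynomial.eval_C, Polynomial.eval_pow, Polynomial.eval_X] at h
  rw [mul_comm, ← h]
  have : ∀ A : MvPolynomial σ K, eval (t • x) A = Polynomial.eval t (Polynomial.map (eval x) (scl A)) := by
    intro A
    induction A using MvPolynomial.induction_on with
    | C a => simp [scl, Polynomial.algebraMap_apply]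
    | add p q hp hq => simp [hp, hq]
    | mul_X p i hp => simp only [map_mul, Polynomial.map_mul, Polynomial.eval_mul, hp]; simp [scl]; left; ring
  exact this A

/-- polynomial `t ↦ A(u+tv)` -/
noncomputable def lineP {σ : Type*} (u v : σ → K) : MvPolynomial σ K →ₐ[K] Polynomial K :=
  aeval fun i => Polynomial.C (u i) + Polynomial.C (v i) * Polynomial.X

theorem lineP_eval {σ : Type*} (u v : σ → K) (A : MvPolynomial σ K) (t : K) :
    Polynomial.eval t (lineP u v A) = eval (u + t • v) A := by
  induction A using MvPolynomial.induction_on with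
  | C a => simp [lineP]
  | add p q hp hq => simp [hp, hq]
  | mul_X p i hp => simp only [map_mul, Polynomial.eval_mul, hp]; simp [lineP]; left; ring

/-- binary forms over alg. closed fields have roots -/
theorem bin_root {σ : Type*} [IsAlgClosed K] {A : MvPolynomial σ K} {e : ℕ} (hA : A.IsHomogeneous e) (he : e ≠ 0)
    (u v : σ → K) : (∃ s : K, eval (u + s • v) A = 0) ∨ eval v A = 0 := by
  have hinf : Infinite K := IsAlgClosed.instInfinite
  by_cases h : (lineP u v A).degree = 0
  · right
    obtain ⟨c, hc⟩ := Polynomial.natDegree_eq_zero.1 (Polynomial.natDegree_eq_of_degree_eq_some h)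
    have h1 : lineP v u A = Polynomial.C c * Polynomial.X ^ e := by
      have h2 : Polynomial.X * lineP v u A = Polynomial.X * (Polynomial.C c * Polynomial.X ^ e) := by
        apply Polynomial.funext
        intro t
        by_cases ht : t = 0
        · simp [ht]
        · rw [Polynomial.eval_mul, Polynomial.eval_mul, lineP_eval]
          have : v + t • u = t • (u + t⁻¹ • v) := by
            rw [smul_add, smul_smul, mul_inv_cancel₀ ht, one_smul, add_comm]
          rw [this, eval_smul_hom hA, ← lineP_eval, ← hc]
          simp only [Polynomial.eval_C, Polynomial.eval_mul, Polynomial.eval_X, Polynomial.eval_pow]; ring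
      exact mul_left_cancel₀ Polynomial.X_ne_zero h2
    have := lineP_eval v u A 0
    rw [h1] at this
    simpa [he, eq_comm] using this
  · left
    obtain ⟨s, hs⟩ := IsAlgClosed.exists_root _ h
    exact ⟨s, by rw [← lineP_eval]; exact hs⟩

theorem NL.not_cyl [IsAlgClosed K] {A : MvPolynomial (Fin 3) K} (hA : NL A) {e : ℕ} (he : e ≠ 0)
    (hh : A.IsHomogeneous e) (p : Fin 3 → K) (hp : p ≠ 0) (hinv : ∀ x (t : K), eval (x + t • p) A = eval x A) : False := by
  obtain ⟨i, hi⟩ := Function.ne_iff.1 hp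
  obtain ⟨u, v, huv⟩ : ∃ u v : Fin 3 → K, ∀ q s t : K, q • p + s • u + t • v = 0 → q = 0 ∧ s = 0 ∧ t = 0 := by
    fin_cases i
    · refine ⟨![0,1,0], ![0,0,1], fun q s t h => ?_⟩
      have a := congrFun h 0; have b := congrFun h 1; have c := congrFun h 2
      simp only [Pi.add_apply, Pi.smul_apply, smul_eq_mul] at a b c; simp at a b c
      have hi' : p 0 ≠ 0 := hi
      simp [hi'] at a; subst a; rw [zero_mul, zero_add] at b c; exact ⟨rfl, b, c⟩
    · refine ⟨![1,0,0], ![0,0,1], fun q s t h => ?_⟩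
      have a := congrFun h 0; have b := congrFun h 1; have c := congrFun h 2
      simp only [Pi.add_apply, Pi.smul_apply, smul_eq_mul] at a b c; simp at a b c
      have hi' : p 1 ≠ 0 := hi
      simp [hi'] at b; subst b; rw [zero_mul, zero_add] at a c; exact ⟨rfl, a, c⟩
    · refine ⟨![1,0,0], ![0,1,0], fun q s t h => ?_⟩
      have a := congrFun h 0; have b := congrFun h 1; have c := congrFun h 2
      simp only [Pi.add_apply, Pi.smul_apply, smul_eq_mul] at a b c; simp at a b c
      have hi' : p 2 ≠ 0 := hi
      simp [hi'] at c; subst c; rw [zero_mul, zero_add] at a b; exact ⟨rfl, a, b⟩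
  obtain ⟨q, hq, hpq⟩ : ∃ q : Fin 3 → K, eval q A = 0 ∧ ∀ s t : K, s • q + t • p = 0 → s = 0 ∧ t = 0 := by
    rcases bin_root hh he u v with ⟨s, hs⟩ | h
    · refine ⟨_, hs, fun a b h => ?_⟩
      have := huv b a (a * s) (by rw [← h, smul_add, smul_smul]; abel)
      exact ⟨this.2.1, this.1⟩
    · refine ⟨_, h, fun a b h => ?_⟩
      have := huv b 0 a (by rw [← h, zero_smul]; abel)
      exact ⟨this.2.2, this.1⟩
  obtain ⟨s, t, hst⟩ := hA q p hpq
  rw [hinv, eval_smul_hom hh, hq, mul_zero] at hst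
  exact hst rfl

/-- restriction of a quaternary form to the plane `x3 = c x0 + a x1 + b x2` -/
noncomputable def rst (c a b : K) : MvPolynomial (Fin 4) k →ₐ[k] MvPolynomial (Fin 3) K :=
  aeval ![X 0, X 1, X 2, C c * X 0 + C a * X 1 + C b * X 2]

theorem rst_eval (c a b : K) (F : MvPolynomial (Fin 4) k) (x : Fin 3 → K) :
    eval x (rst c a b F) = aeval ![x 0, x 1, x 2, c * x 0 + a * x 1 + b * x 2] F := by
  induction F using MvPolynomial.induction_on with
  | C r => simp [rst, MvPolynomial.algebraMap_apply]
  | add p q hp hq => simp [hp, hq]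
  | mul_X p i hp => simp only [map_mul, hp]; congr 1; fin_cases i <;> simp [rst]

theorem rst_cD (c a b : K) (D : Derivation k K K) (F : MvPolynomial (Fin 4) k) :
    cD D (rst c a b F) = (C (D c) * X 0 + C (D a) * X 1 + C (D b) * X 2) * rst c a b (pderiv 3 F) := by
  rw [rst, der_aeval]
  simp [Fin.sum_univ_four, mul_comm]

theorem rst_hom (c a b : K) {F : MvPolynomial (Fin 4) k} {d} (h : F.IsHomogeneous d) :
    (rst c a b F).IsHomogeneous d := by
  have := MvPolynomial.IsHomogeneous.aeval (n := 1) (S := K) (τ := Fin 3) h ![X 0, X 1, X 2, C c * X 0 + C a * X 1 + C b * X 2] ?_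
  · rwa [one_mul] at this
  · intro i
    have hX : ∀ j : Fin 3, (X j : MvPolynomial (Fin 3) K).IsHomogeneous 1 := fun j => isHomogeneous_X _ _
    have hc : ∀ (r : K) j, (C r * X j : MvPolynomial (Fin 3) K).IsHomogeneous 1 := fun r j => isHomogeneous_C_mul_X r j
    fin_cases i
    · exact hX 0
    · exact hX 1
    · exact hX 2
    · exact ((hc _ _).add (hc _ _)).add (hc _ _)

/-- derivations are combinations -/
theorem der_two {a b : K} [CharZero k] (hx : IsTranscendenceBasis k ![a, b]) : ∃ D₁ D₂ : Derivation k K K,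
    D₁ a = 1 ∧ D₁ b = 0 ∧ D₂ a = 0 ∧ D₂ b = 1 ∧ ∀ D : Derivation k K K, D = D a • D₁ + D b • D₂ := by
  obtain ⟨D1, h1⟩ := der_exists hx ![1, 0]
  obtain ⟨D2, h2⟩ := der_exists hx ![0, 1]
  have e1 := h1 0; have e2 := h1 1; have e3 := h2 0; have e4 := h2 1
  simp at e1 e2 e3 e4
  refine ⟨D1, D2, e1, e2, e3, e4, fun D => ?_⟩
  rw [← sub_eq_zero]
  apply der_unique hx
  intro i
  fin_cases i <;> simp [e1, e2, e3, e4]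
end Basic

section Gamma
variable {k K : Type*} [Field k] [Field K] [Algebra k K]

structure IsTri (T : (Fin 3 → K) → (Fin 3 → K) → (Fin 3 → K) → K) : Prop where
  s1 : ∀ x y z, T x y z = T y x z
  s2 : ∀ x y z, T x y z = T x z y
  add : ∀ x x' y z, T (x + x') y z = T x y z + T x' y z
  smul : ∀ (r : K) x y z, T (r • x) y z = r * T x y z

namespace IsTri
variable {T : (Fin 3 → K) → (Fin 3 → K) → (Fin 3 → K) → K} (h : IsTri T)
include h
theorem add2 (x y y' z) : T x (y + y') z = T x y z + T x y' z := by
  rw [h.s1, h.add, h.s1 y, h.s1 y']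
theorem smul2 (r : K) (x y z) : T x (r • y) z = r * T x y z := by rw [h.s1, h.smul, h.s1 y]
theorem add3 (x y z z') : T x y (z + z') = T x y z + T x y z' := by
  rw [h.s2, h.add2, h.s2 x z, h.s2 x z']
theorem smul3 (r : K) (x y z) : T x y (r • z) = r * T x y z := by rw [h.s2, h.smul2, h.s2 x z]
theorem exp2 (p y : Fin 3 → K) (t : K) : T (p + t • y) (p + t • y) (p + t • y) =
    T p p p + 3 * t * T p p y + 3 * t ^ 2 * T p y y + t ^ 3 * T y y y := by
  simp only [h.add, h.add2, h.add3, h.smul, h.smul2, h.smul3]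
  rw [h.s1 y p p, h.s2 p y p, h.s2 y y p, h.s1 y p y]
  ring
theorem exp3 (p q y : Fin 3 → K) (t s : K) : T (p + t • q + s • y) (p + t • q + s • y) (p + t • q + s • y) =
    T p p p + 3 * t * T p p q + 3 * s * T p p y + 3 * t ^ 2 * T p q q + 6 * t * s * T p q y + 3 * s ^ 2 * T p y y
     + t ^ 3 * T q q q + 3 * t ^ 2 * s * T q q y + 3 * t * s ^ 2 * T q y y + s ^ 3 * T y y y := by
  rw [h.exp2 (p + t • q) y s, h.exp2 p q t]
  simp only [h.add, h.add2, h.smul, h.smul2]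
  rw [h.s1 q p y]
  ring
end IsTri

noncomputable def triT (A : MvPolynomial (Fin 3) K) (x y z : Fin 3 → K) : K :=
  ∑ i, ∑ j, ∑ l, coeff 0 (pderiv i (pderiv j (pderiv l A))) * (x i * y j * z l)

theorem pd_comm {σ : Type*} (i j : σ) (A : MvPolynomial σ K) : pderiv i (pderiv j A) = pderiv j (pderiv i A) := by
  classical
  ext m
  simp only [coeff_pderiv]
  by_cases h : i = j
  · rw [h]
  · rw [add_right_comm]
    simp [Finsupp.single_apply, h, Ne.symm h]
    ring

theorem cD_pd {σ : Type*} (D : Derivation k K K) (i : σ) (A : MvPolynomial σ K) : cD D (pderiv i A) = pderiv i (cD D A) := by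
  ext m
  simp only [coeff_cD, coeff_pderiv]
  rw [Derivation.leibniz]
  simp [mul_comm]

theorem triT_tri (A : MvPolynomial (Fin 3) K) : IsTri (triT A) where
  s1 x y z := by
    rw [triT, triT, Finset.sum_comm]
    refine Finset.sum_congr rfl fun i _ => Finset.sum_congr rfl fun j _ => Finset.sum_congr rfl fun l _ => ?_
    rw [pd_comm]; ring
  s2 x y z := by
    rw [triT, triT]
    refine Finset.sum_congr rfl fun i _ => ?_
    rw [Finset.sum_comm]
    refine Finset.sum_congr rfl fun j _ => Finset.sum_congr rfl fun l _ => ?_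
    rw [pd_comm j l]; ring
  add x x' y z := by
    simp only [triT, ← Finset.sum_add_distrib]
    refine Finset.sum_congr rfl fun i _ => Finset.sum_congr rfl fun j _ => Finset.sum_congr rfl fun l _ => ?_
    simp only [Pi.add_apply]; ring
  smul r x y z := by
    simp only [triT, Finset.mul_sum]
    refine Finset.sum_congr rfl fun i _ => Finset.sum_congr rfl fun j _ => Finset.sum_congr rfl fun l _ => ?_
    simp only [Pi.smul_apply, smul_eq_mul]; ring

theorem triT_D (D : Derivation k K K) (A : MvPolynomial (Fin 3) K) (x y z : Fin 3 → K) :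
    D (triT A x y z) = triT (cD D A) x y z + triT A (fun i => D (x i)) y z + triT A x (fun i => D (y i)) z
      + triT A x y (fun i => D (z i)) := by
  simp only [triT, map_sum, ← Finset.sum_add_distrib]
  refine Finset.sum_congr rfl fun i _ => Finset.sum_congr rfl fun j _ => Finset.sum_congr rfl fun l _ => ?_
  rw [← cD_pd, ← cD_pd, ← cD_pd, coeff_cD]
  simp only [Derivation.leibniz, smul_eq_mul]; ring

theorem euler_eval {A : MvPolynomial (Fin 3) K} {n : ℕ} (h : A.IsHomogeneous n) (x : Fin 3 → K) :
    ∑ i, x i * eval x (pderiv i A) = n * eval x A := by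
  have := congrArg (eval x) h.sum_X_mul_pderiv
  simpa using this

theorem hom_zero_eval {A : MvPolynomial (Fin 3) K} (h : A.IsHomogeneous 0) (x : Fin 3 → K) : eval x A = coeff 0 A := by
  by_cases h0 : A = 0
  · simp [h0]
  have h2 := totalDegree_eq_zero_iff_eq_C.1 (h.totalDegree h0)
  conv_lhs => rw [h2, eval_C]

theorem triT_grad {A : MvPolynomial (Fin 3) K} (h : A.IsHomogeneous 3) (x z : Fin 3 → K) :
    triT A x x z = 2 * ∑ l, z l * eval x (pderiv l A) := by
  have h1 : ∀ l, (pderiv l A).IsHomogeneous 2 := fun l => h.pderiv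
  have h2 : ∀ j l, (pderiv j (pderiv l A)).IsHomogeneous 1 := fun j l => (h1 l).pderiv
  have h3 : ∀ i j l, (pderiv i (pderiv j (pderiv l A))).IsHomogeneous 0 := fun i j l => (h2 j l).pderiv
  have e1 := fun l => euler_eval (h1 l) x
  have e2 := fun j l => euler_eval (h2 j l) x
  simp only [hom_zero_eval (h3 _ _ _)] at e2
  simp only [Nat.cast_one, one_mul] at e2
  simp only [Fin.sum_univ_three, triT, Nat.cast_ofNat] at *
  linear_combination z 0 * (e1 0) + z 1 * e1 1 + z 2 * e1 2 + x 0 * z 0 * e2 0 0 + x 0 * z 1 * e2 0 1 + x 0 * z 2 * e2 0 2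
    + x 1 * z 0 * e2 1 0 + x 1 * z 1 * e2 1 1 + x 1 * z 2 * e2 1 2
    + x 2 * z 0 * e2 2 0 + x 2 * z 1 * e2 2 1 + x 2 * z 2 * e2 2 2

theorem triT_self {A : MvPolynomial (Fin 3) K} (h : A.IsHomogeneous 3) (x : Fin 3 → K) :
    triT A x x x = 6 * eval x A := by
  rw [triT_grad h, euler_eval h]; push_cast; ring

theorem gamma [CharZero K] [IsAlgClosed K] (D₁ D₂ : Derivation k K K) {A m : MvPolynomial (Fin 3) K} (hA : NL A)
    (h3 : A.IsHomogeneous 3) (p p' : Fin 3 → K) (κ : K) (hp0 : p 0 = 1) (hp1 : p' 0 = 0) (hp2 : p' ≠ 0)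
    (hD1 : ∀ i, D₁ (p i) = 0) (hD2 : ∀ i, D₂ (p i) = p' i) (hD3 : ∀ i, D₁ (p' i) = κ * p' i)
    (ℓ₁ ℓ₂ : (Fin 3 → K) →ₗ[K] K) (hl : ℓ₁ ≠ 0) (hl1 : ℓ₁ p = 0) (hl2 : ℓ₂ p = 0) (hl3 : ℓ₁ p' = 0)
    (hm : m.IsHomogeneous 1)
    (dar : ∀ x, ℓ₂ x * eval x (cD D₁ A) - ℓ₁ x * eval x (cD D₂ A) = eval x m * eval x A)
    (grad : ∀ i, eval p (pderiv i A) = 0) : False := by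
  set T := triT A with hT
  set T1 := triT (cD D₁ A) with hT1
  set T2 := triT (cD D₂ A) with hT2
  have t : IsTri T := triT_tri _
  have t1 : IsTri T1 := triT_tri _
  have t2 : IsTri T2 := triT_tri _
  have dar' : ∀ x, ℓ₂ x * T1 x x x - ℓ₁ x * T2 x x x = eval x m * T x x x := by
    intro x
    rw [hT, hT1, hT2, triT_self h3, triT_self (cD_hom _ h3), triT_self (cD_hom _ h3)]
    linear_combination 6 * dar x
  obtain ⟨M, hM⟩ : ∃ M : (Fin 3 → K) →ₗ[K] K, ∀ x, eval x m = M x := by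
    refine ⟨∑ i, coeff (Finsupp.single i 1) m • LinearMap.proj i, fun x => ?_⟩
    conv_lhs => rw [lin_form hm]
    simp
  simp only [hM] at dar'
  have z1 : ∀ y, T p p y = 0 := by
    intro y
    rw [hT, triT_grad h3]; simp [grad]
  have Dp1 : (fun i => D₁ (p i)) = 0 := by ext i; simp [hD1]
  have Dp2 : (fun i => D₂ (p i)) = p' := by ext i; simp [hD2]
  have Dp3 : (fun i => D₁ (p' i)) = κ • p' := by ext i; simp [hD3]
  have tz : ∀ y z, T 0 y z = 0 := fun y z => by simpa using t.smul 0 0 y z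
  have tz2 : ∀ y z, T y 0 z = 0 := fun y z => by simpa using t.smul2 0 y 0 z
  have z2 : ∀ y, T1 p p y = 0 := by
    intro y
    have := triT_D D₁ A p p y
    rw [← hT, ← hT1, z1, Dp1, map_zero, z1, tz, tz2] at this
    linear_combination -this
  have z3 : ∀ y, T2 p p y = - 2 * T p' p y := by
    intro y
    have := triT_D D₂ A p p y
    rw [← hT, ← hT2, z1, Dp2, map_zero, z1, t.s1 p p'] at this
    linear_combination -this
  have q1 : ∀ y, 2 * ℓ₁ y * T p' p y = M p * T p y y := by
    intro y
    have e : ∀ r : K, _ := fun r => dar' (p + r • y)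
    simp only [t.exp2, t1.exp2, t2.exp2, z1, z2, z3, map_add, map_smul, hl1, hl2, smul_eq_mul] at e
    rw [t.s2 p' p p, t.s1 p' p p, t.s2 p p' p, z1] at e
    have e1 := e 1; have e2 := e (-1); have e3 := e 2; have e4 := e (-2)
    have : (24 : K) * (2 * ℓ₁ y * T p' p y - M p * T p y y) = 0 := by
      linear_combination (16 * e1 + 16 * e2 - e3 - e4)/ 3
    have := (mul_eq_zero.1 this).resolve_left (by norm_num)
    linear_combination this
  by_cases hmu : M p = 0
  · rw [hmu] at q1
    obtain ⟨y0, hy0⟩ : ∃ y, ℓ₁ y ≠ 0 := by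
      by_contra h; push Not at h; exact hl (LinearMap.ext h)
    have h1 : ∀ y, ℓ₁ y ≠ 0 → T p' p y = 0 := by
      intro y hy
      have := q1 y
      rw [zero_mul] at this
      exact (mul_eq_zero.1 this).resolve_left (mul_ne_zero two_ne_zero hy)
    have h2 : ∀ y, T p' p y = 0 := by
      intro y
      by_cases hy : ℓ₁ y = 0
      · have := h1 (y + y0) (by rw [map_add, hy, zero_add]; exact hy0)
        rw [t.add3, h1 y0 hy0, add_zero] at this
        exact this
      · exact h1 y hy
    have h3' : ∀ y, T p p' y = 0 := fun y => by rw [t.s1]; exact h2 y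
    have h4 : ∀ y, T1 p p' y = 0 := by
      intro y
      have := triT_D D₁ A p p' y
      rw [← hT, ← hT1, h3', Dp1, map_zero, h3', tz, Dp3, t.smul2, h3'] at this
      linear_combination -this
    have h5 : T2 p p' p' = - T p' p' p' := by
      have := triT_D D₂ A p p' p'
      rw [← hT, ← hT2, h3', Dp2, map_zero, h3', t.s2 p _ p', h3'] at this
      linear_combination -this
    have h6 : T p' p' p' = 0 := by
      have e : ∀ r s : K, _ := fun r s => dar' (p + r • p' + s • y0)
      simp only [t.exp3, t1.exp3, t2.exp3, z1, z2, z3, map_add, map_smul, hl1, hl2, hl3, hmu, smul_eq_mul, h2, h3', h4, h5] at e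
      have e1 := e 1 1; have e2 := e 1 (-1); have e3 := e (-1) 1; have e4 := e (-1) (-1)
      have e5 := e 2 1; have e6 := e 2 (-1); have e7 := e (-2) 1; have e8 := e (-2) (-1)
      have : (36 : K) * ℓ₁ y0 * T p' p' p' = 0 := by
        linear_combination (e5 - e6 + e7 - e8) - (e1 - e2 + e3 - e4)
      exact (mul_eq_zero.1 this).resolve_left (mul_ne_zero (by norm_num) hy0)
    obtain ⟨s, r, hsr⟩ := hA p p' (by
      intro s r h
      have h0 := congrFun h 0
      simp [hp0, hp1] at h0
      subst h0
      simp [hp2] at h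
      exact ⟨rfl, h⟩)
    apply hsr
    have e := t.exp2 (s • p) p' r
    have : (6 : K) * eval (s • p + r • p') A = 0 := by
      rw [← triT_self h3, ← hT, e]
      simp only [t.smul, t.smul2, t.smul3, z1, h3', h6]
      ring
    exact (mul_eq_zero.1 this).resolve_left (by norm_num)
  · have q2 : ∀ y z, ℓ₁ y * T p' p z + ℓ₁ z * T p' p y = M p * T p y z := by
      intro y z
      have e1 := q1 y; have e2 := q1 z; have e3 := q1 (y + z)
      simp only [t.add3, t.add2, map_add, t.s2 p z y] at e3
      have : (2:K) * (ℓ₁ y * T p' p z + ℓ₁ z * T p' p y - M p * T p y z) = 0 := by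
        linear_combination e3 - e1 - e2
      linear_combination (mul_eq_zero.1 this).resolve_left two_ne_zero
    have h1 : T p' p p' = 0 := by
      have := q1 p'
      rw [hl3, mul_zero, zero_mul, eq_comm] at this
      rw [t.s1]; exact (mul_eq_zero.1 this).resolve_left hmu
    have h2 : ∀ z, T p' p z = 0 := by
      intro z
      have := q2 p' z
      rw [hl3, h1, zero_mul, mul_zero, zero_add, eq_comm] at this
      rw [t.s1]; exact (mul_eq_zero.1 this).resolve_left hmu
    have h4 : ∀ y z, T p y z = 0 := by
      intro y z
      have := q2 y z
      rw [h2, h2, mul_zero, mul_zero, zero_add, eq_comm] at this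
      exact (mul_eq_zero.1 this).resolve_left hmu
    refine hA.not_cyl (e := 3) (by norm_num) h3 p (fun h => by rw [h] at hp0; simp at hp0) fun x r => ?_
    have e := t.exp2 x p r
    rw [t.s2 x x p, t.s1 x p x, t.s1 x p p, h4, h4, h4] at e
    simp only [hT, triT_self h3] at e
    have : (6 : K) * (eval (x + r • p) A - eval x A) = 0 := by rw [mul_sub, e]; ring
    exact sub_eq_zero.1 ((mul_eq_zero.1 this).resolve_left (by norm_num))
end Gamma

section Desc
variable {k K : Type*} [Field k] [Field K] [Algebra k K]

theorem nss [IsAlgClosed k] {ι : Type*} [Finite ι] (S : Set (MvPolynomial ι k)) (u : ι → K)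
    (h : ∀ s ∈ S, aeval u s = 0) : ∃ v : ι → k, ∀ s ∈ S, eval v s = 0 := by
  have h1 : ∀ s ∈ Ideal.span S, aeval u s = 0 := by
    intro s hs
    have : Ideal.span S ≤ RingHom.ker (aeval u : MvPolynomial ι k →ₐ[k] K) := Ideal.span_le.2 fun s hs => h s hs
    exact this hs
  by_contra hc
  push Not at hc
  have h2 : zeroLocus k (Ideal.span S) = ∅ := by
    rw [Set.eq_empty_iff_forall_notMem]
    intro v hv
    obtain ⟨s, hs, hs'⟩ := hc v
    apply hs'
    have := hv s (Ideal.subset_span hs)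
    rwa [aeval_eq_eval] at this
  have h3 := vanishingIdeal_zeroLocus_eq_radical (K := k) (Ideal.span S)
  rw [h2, vanishingIdeal_empty] at h3
  have h4 : (1 : MvPolynomial ι k) ∈ Ideal.span S := by
    rw [← Ideal.eq_top_iff_one, ← Ideal.radical_eq_top, ← h3]
  have := h1 1 h4
  simp at this

/-- polynomial with prescribed coefficients on `S` -/
noncomputable def genP {σ R : Type*} [CommSemiring R] (S : Finset (σ →₀ ℕ)) (u : S → R) : MvPolynomial σ R :=
  ∑ m : S, monomial m.1 (u m)

theorem genP_map {σ R R' : Type*} [CommSemiring R] [CommSemiring R'] (φ : R →+* R') (S : Finset (σ →₀ ℕ)) (u : S → R) :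
    map φ (genP S u) = genP S (fun m => φ (u m)) := by
  simp [genP]

theorem genP_self {σ R : Type*} [CommSemiring R] (p : MvPolynomial σ R) (S : Finset (σ →₀ ℕ)) (hS : p.support ⊆ S) :
    genP S (fun m => coeff m.1 p) = p := by
  classical
  rw [genP, Finset.sum_coe_sort S (fun m => monomial m (coeff m p))]
  conv_rhs => rw [p.as_sum]
  symm
  apply Finset.sum_subset hS
  intro m _ hm
  rw [notMem_support_iff.1 hm, map_zero]

theorem genP_hom {σ R : Type*} [CommSemiring R] (S : Finset (σ →₀ ℕ)) (u : S → R) (e : ℕ) (hS : ∀ m ∈ S, m.degree = e) :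
    (genP S u).IsHomogeneous e :=
  IsHomogeneous.sum _ _ _ fun m _ => isHomogeneous_monomial _ (hS m.1 m.2)

theorem hom_deg {σ R : Type*} [CommSemiring R] {p : MvPolynomial σ R} {e : ℕ} (h : p.IsHomogeneous e) :
    ∀ m ∈ p.support, m.degree = e := by
  intro m hm
  rw [Finsupp.degree_eq_weight_one]; exact h (mem_support_iff.1 hm)

noncomputable def desP {σ : Type*} (S S' : Finset (σ →₀ ℕ)) (F : MvPolynomial σ k) :
    MvPolynomial σ (MvPolynomial (S ⊕ S') k) :=
  map C F - genP S (fun m => X (Sum.inl m)) * genP S' (fun m => X (Sum.inr m))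

theorem desP_map {σ R : Type*} [CommRing R] [Algebra k R] (S S' : Finset (σ →₀ ℕ)) (F : MvPolynomial σ k)
    (u : S ⊕ S' → R) : map ((aeval u : MvPolynomial (S ⊕ S') k →ₐ[k] R) : MvPolynomial (S ⊕ S') k →+* R) (desP S S' F) =
      map (algebraMap k R) F - genP S (fun m => u (Sum.inl m)) * genP S' (fun m => u (Sum.inr m)) := by
  have e : ((aeval u : MvPolynomial (S ⊕ S') k →ₐ[k] R) : MvPolynomial (S ⊕ S') k →+* R).comp C = algebraMap k R := by
    ext x; simp
  rw [desP, map_sub, map_mul, genP_map, genP_map, map_map, e]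
  simp

theorem descent [IsAlgClosed k] {σ : Type*} {F : MvPolynomial σ k} {G H : MvPolynomial σ K} {e e' : ℕ}
    (hG : G.IsHomogeneous e) (hH : H.IsHomogeneous e') (h : map (algebraMap k K) F = G * H) :
    ∃ G₀ H₀ : MvPolynomial σ k, G₀.IsHomogeneous e ∧ H₀.IsHomogeneous e' ∧ F = G₀ * H₀ := by
  obtain ⟨v, hv⟩ := nss (K := K) (Set.range fun M => coeff M (desP G.support H.support F))
    (Sum.elim (fun m => coeff m.1 G) (fun m => coeff m.1 H)) (by
      rintro _ ⟨M, rfl⟩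
      have := congrArg (coeff M) (desP_map (R := K) G.support H.support F (Sum.elim (fun m => coeff m.1 G) (fun m => coeff m.1 H)))
      rw [coeff_map] at this
      refine this.trans ?_
      simp only [Sum.elim_inl, Sum.elim_inr]
      rw [genP_self G _ subset_rfl, genP_self H _ subset_rfl, h, sub_self, coeff_zero])
  refine ⟨genP G.support fun m => v (Sum.inl m), genP H.support fun m => v (Sum.inr m), genP_hom _ _ _ (hom_deg hG),
    genP_hom _ _ _ (hom_deg hH), ?_⟩
  have := desP_map (R := k) G.support H.support F v
  rw [← sub_eq_zero]
  simp only [Algebra.algebraMap_self, map_id] at this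
  have e2 : map (algebraMap k k) F = F := map_id F
  refine this.symm.trans ?_
  ext M
  rw [coeff_map, coeff_zero]
  exact hv _ ⟨M, rfl⟩

theorem unit_hom_zero {σ : Type*} {P : MvPolynomial σ K} (h : P ≠ 0) (h1 : P.IsHomogeneous 0) : IsUnit P := by
  have h2 := totalDegree_eq_zero_iff_eq_C.1 (h1.totalDegree h)
  rw [h2] at h ⊢
  exact (IsUnit.mk0 _ (by simpa using h)).map C

theorem not_unit_hom {σ : Type*} {P : MvPolynomial σ K} {e : ℕ} (h1 : P.IsHomogeneous e) (he : e ≠ 0) : ¬ IsUnit P := by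
  intro hu
  obtain ⟨B, hB⟩ := hu.exists_right_inv
  have h0 : P ≠ 0 := hu.ne_zero
  obtain ⟨i, j, hi, hj, hij⟩ := hom_factor (P := P) (Q := B) (n := 0) (by rw [hB]; exact isHomogeneous_one _ _) (by rw [hB]; exact one_ne_zero)
  have := h1.inj_right hi h0
  omega

theorem irr_base [IsAlgClosed k] {σ : Type*} {F : MvPolynomial σ k} {d : ℕ} (hd : d ≠ 0) (hF : F.IsHomogeneous d) (hirr : Irreducible F) :
    Irreducible (map (algebraMap k K) F) := by
  have h0 : map (algebraMap k K) F ≠ 0 := by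
    rw [Ne, map_eq_zero_iff _ (map_injective _ (algebraMap k K).injective)]; exact hirr.ne_zero
  have hF' : (map (algebraMap k K) F).IsHomogeneous d := hF.map _
  refine ⟨not_unit_hom hF' hd, fun {G H} hGH => ?_⟩
  obtain ⟨i, j, hi, hj, hij⟩ := hom_factor (hGH ▸ hF') (hGH ▸ h0)
  obtain ⟨G0, H0, g0, g1, g2⟩ := descent hi hj hGH
  by_cases hi0 : i = 0
  · subst hi0; left; exact unit_hom_zero (left_ne_zero_of_mul (hGH ▸ h0)) hi
  by_cases hj0 : j = 0
  · subst hj0; right; exact unit_hom_zero (right_ne_zero_of_mul (hGH ▸ h0)) hj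
  exfalso
  rcases hirr.2 g2 with h | h
  · exact not_unit_hom g0 hi0 h
  · exact not_unit_hom g1 hj0 h
end Desc

section Beta
variable {k K : Type*} [Field k] [Field K] [Algebra k K]

theorem aeval_smul_hom {σ : Type*} {F : MvPolynomial σ k} {d : ℕ} (h : F.IsHomogeneous d) (t : K) (x : σ → K) :
    aeval (t • x) F = t ^ d * aeval x F := by
  have := eval_smul_hom (h.map (algebraMap k K)) t x
  rwa [eval_map, eval_map, ← aeval_def, ← aeval_def] at this

theorem pd3_ne [IsAlgClosed k] [CharZero K] {c a b : K} {F : MvPolynomial (Fin 4) k} {d n : ℕ} (hd : d ≠ 0) (hn : n ≠ 0)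
    (hF : F.IsHomogeneous d) (hirr : Irreducible F) {A B : MvPolynomial (Fin 3) K}
    (hA : A.IsHomogeneous 3) (hB : B.IsHomogeneous n) (hAB : rst c a b F = A * B) : pderiv 3 F ≠ 0 := by
  intro h
  have h1 : ∀ x y : Fin 4 → K, (∀ i, i ≠ 3 → x i = y i) → aeval x F = aeval y F := by
    intro x y hxy
    set q : Fin 4 → Polynomial K := fun i => Polynomial.C (x i) + Polynomial.C (y i - x i) * Polynomial.X
    have e1 : ∀ t, Polynomial.eval t (aeval q F) = aeval (x + t • (y - x)) F := by
      intro t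
      have := lineP_eval x (y - x) (map (algebraMap k K) F) t
      rw [lineP, aeval_map_algebraMap, eval_map, ← aeval_def] at this
      exact this
    have e2 : Polynomial.derivative (aeval q F) = 0 := by
      have := der_aeval (Polynomial.derivative'.restrictScalars k : Derivation k (Polynomial K) (Polynomial K)) q F
      refine this.trans (Finset.sum_eq_zero fun i _ => ?_)
      by_cases hi : i = 3
      · subst hi; rw [h, map_zero, mul_zero]
      · have : q i = Polynomial.C (x i) := by simp [q, hxy i hi]
        rw [this]
        simp [Polynomial.derivative']
    have e3 := Polynomial.derivative_eq_zero.1 e2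
    obtain ⟨r, hr⟩ := Polynomial.natDegree_eq_zero.1 e3
    have e4 := e1 0; have e5 := e1 1
    rw [← hr] at e4 e5
    simp at e4 e5
    rw [← e4, ← e5]
  have h2 : map (algebraMap k K) F = rename Fin.castSucc A * rename Fin.castSucc B := by
    rw [← map_mul, ← hAB]
    have : Infinite K := inferInstance
    apply MvPolynomial.funext
    intro x
    rw [eval_rename, rst_eval, eval_map, ← aeval_def]
    apply h1
    intro i hi
    fin_cases i <;> first | rfl | exact absurd rfl hi
  rcases (irr_base (K := K) hd hF hirr).2 h2 with h | h
  · exact not_unit_hom hA.rename_isHomogeneous (by norm_num) h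
  · exact not_unit_hom hB.rename_isHomogeneous hn h

theorem elim_dep [CharZero k] {F G : MvPolynomial (Fin 4) k} {d e : ℕ} (hF : F.IsHomogeneous d) (hG : G.IsHomogeneous e)
    (hirr : Irreducible F) (hFG : ¬ F ∣ G) (P : Fin 4 → K) (hP0 : P 0 = 1) (h1 : aeval P F = 0) (h2 : aeval P G = 0) :
    ¬ AlgebraicIndependent k ![P 1, P 2] := by
  let E : MvPolynomial (Fin 4) k ≃ₐ[k] Polynomial (MvPolynomial (Fin 3) k) :=
    (renameEquiv k (Equiv.swap (0 : Fin 4) 3)).trans (finSuccEquiv k 3)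
  have hE : Irreducible (E F) := (MulEquiv.irreducible_iff E).2 hirr
  have hE2 : ¬ E F ∣ E G := fun h => hFG ((map_dvd_iff E).1 h)
  obtain ⟨U, V, r, hr, hUV⟩ := elim_lemma hE hE2
  have hC : ∀ r : MvPolynomial (Fin 3) k, Polynomial.C r = E (rename ![1, 2, 0] r) := by
    intro r
    induction r using MvPolynomial.induction_on with
    | C a => rw [rename_C]; exact (E.commutes a).symm
    | add p q hp hq => rw [map_add, map_add, map_add, hp, hq]
    | mul_X p i hp =>
      rw [map_mul, map_mul, map_mul, hp, rename_X]
      congr 1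
      change _ = finSuccEquiv k 3 (rename _ _)
      rw [rename_X]
      fin_cases i
      · exact (finSuccEquiv_X_succ (j := 0)).symm
      · exact (finSuccEquiv_X_succ (j := 1)).symm
      · exact (finSuccEquiv_X_succ (j := 2)).symm
  have hev : ∀ x : Fin 4 → K, aeval x F = 0 → aeval x G = 0 → aeval ![x 1, x 2, x 0] r = 0 := by
    intro x hx hy
    have e1 : E.symm U * F + E.symm V * G = E.symm (Polynomial.C r) := by
      rw [← hUV]; simp
    have e2 : E.symm (Polynomial.C r) = rename ![1, 2, 0] r := by
      rw [AlgEquiv.symm_apply_eq]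
      exact hC r
    have := congrArg (aeval x) e1
    rw [map_add, map_mul, map_mul, hx, hy, e2, aeval_rename] at this
    have e3 : x ∘ ![1, 2, 0] = ![x 1, x 2, x 0] := by ext i; fin_cases i <;> rfl
    rw [e3] at this
    rw [← this]; simp
  obtain ⟨j, hj⟩ : ∃ j, homogeneousComponent j r ≠ 0 := by
    by_contra hc; push Not at hc
    exact hr (by rw [← sum_homogeneousComponent r]; exact Finset.sum_eq_zero fun i _ => hc i)
  set R := homogeneousComponent j r with hR
  have hRh : R.IsHomogeneous j := homogeneousComponent_isHomogeneous j r
  have hinf : Infinite K := Infinite.of_injective _ (algebraMap k K).injective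
  have hRz : aeval ![P 1, P 2, P 0] R = 0 := by
    have hz : Polynomial.map (aeval ![P 1, P 2, P 0] : MvPolynomial (Fin 3) k →ₐ[k] K).toRingHom (scl r) = 0 := by
      apply Polynomial.funext
      intro t
      have := hev (t • P) (by rw [aeval_smul_hom hF, h1, mul_zero]) (by rw [aeval_smul_hom hG, h2, mul_zero])
      rw [Polynomial.eval_zero, ← this]
      have e4 : ∀ r : MvPolynomial (Fin 3) k, Polynomial.eval t (Polynomial.map (aeval ![P 1, P 2, P 0] : MvPolynomial (Fin 3) k →ₐ[k] K).toRingHom (scl r))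
          = aeval ![(t • P) 1, (t • P) 2, (t • P) 0] r := by
        intro A
        induction A using MvPolynomial.induction_on with
        | C a => simp [scl, Polynomial.algebraMap_apply]
        | add p q hp hq => simp only [map_add, Polynomial.map_add, Polynomial.eval_add, hp, hq]
        | mul_X p i hp =>
          simp only [map_mul, Polynomial.map_mul, Polynomial.eval_mul, hp]
          congr 1
          fin_cases i <;> simp [scl] <;> ring
      exact e4 r
    have := congrArg (fun q => Polynomial.coeff q j) hz
    simp only [Polynomial.coeff_map, scl_coeff, Polynomial.coeff_zero] at this
    exact this
  intro hai
  rw [algebraicIndependent_iff] at hai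
  have hq : aeval ![X 0, X 1, 1] R = (0 : MvPolynomial (Fin 2) k) := by
    apply hai
    rw [← hRz, ← AlgHom.comp_apply]
    congr 1
    ext i
    fin_cases i <;> simp [hP0]
  have hinf : Infinite k := inferInstance
  have : X 2 * R = 0 := by
    apply MvPolynomial.funext
    intro x
    rw [map_mul, eval_X, map_zero]
    by_cases hx : x 2 = 0
    · rw [hx, zero_mul]
    have e5 : x = x 2 • ![x 0 / x 2, x 1 / x 2, 1] := by
      ext i; fin_cases i <;> simp <;> field_simp
    have e6 := congrArg (eval ![x 0 / x 2, x 1 / x 2]) hq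
    have e7 : eval ![x 0 / x 2, x 1 / x 2] (aeval ![X 0, X 1, (1 : MvPolynomial (Fin 2) k)] R) = eval ![x 0 / x 2, x 1 / x 2, 1] R := by
      rw [← aeval_eq_eval, ← aeval_eq_eval]
      change ((aeval ![x 0 / x 2, x 1 / x 2]).comp (aeval ![X 0, X 1, (1 : MvPolynomial (Fin 2) k)])) R = _
      congr 1
      ext i
      fin_cases i <;> simp
    rw [e5, eval_smul_hom hRh, ← e7, e6]; simp
  exact hj ((mul_eq_zero.1 this).resolve_left (X_ne_zero 2))
end Beta

section NB
variable {k K : Type*} [Field k] [Field K] [Algebra k K]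

noncomputable def ellP (c a b : K) (D : Derivation k K K) : MvPolynomial (Fin 3) K :=
  C (D c) * X 0 + C (D a) * X 1 + C (D b) * X 2

theorem ellP_hom (c a b : K) (D : Derivation k K K) : (ellP c a b D).IsHomogeneous 1 :=
  ((isHomogeneous_C_mul_X _ _).add (isHomogeneous_C_mul_X _ _)).add (isHomogeneous_C_mul_X _ _)

theorem theta_factor [CharZero K] (c a b : K) (D E : Derivation k K K) (F : MvPolynomial (Fin 4) k) {A B : MvPolynomial (Fin 3) K}
    (hAB : rst c a b F = A * B) (hA : Irreducible A) (h3 : A.IsHomogeneous 3) (h0 : A * B ≠ 0) :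
    ∃ m : MvPolynomial (Fin 3) K, m.IsHomogeneous 1 ∧ ellP c a b E * cD D A - ellP c a b D * cD E A = m * A ∧
     ellP c a b E * cD D B - ellP c a b D * cD E B = - (m * B) := by
  obtain ⟨m, h1, h2⟩ := darboux (R := MvPolynomial (Fin 3) K) (fun n => by
      have : ((n : MvPolynomial (Fin 3) K) + 1) = C ((n : K) + 1) := by simp
      rw [this]
      exact (IsUnit.mk0 _ (Nat.cast_add_one_ne_zero n)).map C)
    (fun x => ellP c a b E * cD D x - ellP c a b D * cD E x)
    (fun x y => by simp only [Derivation.leibniz, smul_eq_mul]; ring) hA h0 (by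
      rw [← hAB, rst_cD, rst_cD]; simp only [ellP]; ring)
  refine ⟨m, ?_, h1, h2⟩
  by_cases hm : m = 0
  · rw [hm]; exact isHomogeneous_zero _ _ _
  have h4 : (m * A).IsHomogeneous 4 := by
    rw [← h1]
    exact ((ellP_hom c a b E).mul (cD_hom D h3)).sub ((ellP_hom c a b D).mul (cD_hom E h3))
  obtain ⟨i, j, hi, hj, hij⟩ := hom_factor h4 (mul_ne_zero hm hA.ne_zero)
  have := h3.inj_right hj hA.ne_zero
  have : i = 1 := by omega
  exact this ▸ hi

theorem notboth [IsAlgClosed k] [CharZero k] [CharZero K] [IsAlgClosed K] {c a b : K} {F : MvPolynomial (Fin 4) k} {d n : ℕ} (hd : d ≠ 0) (hn : n ≠ 0)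
    (hF : F.IsHomogeneous d) (hirr : Irreducible F) {A B : MvPolynomial (Fin 3) K}
    (hA : A.IsHomogeneous 3) (hB : B.IsHomogeneous n) (hAB : rst c a b F = A * B) (hNL : NL A) (hB0 : B ≠ 0)
    (hnp : ∀ u0 u1 u2 : k, c ≠ algebraMap k K u0 + algebraMap k K u1 * a + algebraMap k K u2 * b)
    {D₁ D₂ : Derivation k K K} (d1a : D₁ a = 1) (d1b : D₁ b = 0) (d2a : D₂ a = 0) (d2b : D₂ b = 1)
    (hD : ∀ D : Derivation k K K, D = D a • D₁ + D b • D₂)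
    (gA : ∀ i, eval ![1, -D₁ c, -D₂ c] (pderiv i A) = 0)
    (gB : ∀ i, eval ![1, -D₁ c, -D₂ c] (pderiv i B) = 0) : False := by
  have h0 : A * B ≠ 0 := mul_ne_zero hNL.ne_zero hB0
  set p : Fin 3 → K := ![1, -D₁ c, -D₂ c] with hp
  have hDx : ∀ (D : Derivation k K K) x, D x = D a * D₁ x + D b * D₂ x := by
    intro D x
    conv_lhs => rw [hD D]
    simp
  -- beta
  have hAp : eval p A = 0 := by
    have := euler_eval hA p
    simp only [gA, mul_zero, Finset.sum_const_zero] at this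
    exact (mul_eq_zero.1 this.symm).resolve_left (by norm_num)
  have hBp : eval p B = 0 := by
    have := euler_eval hB p
    simp only [gB, mul_zero, Finset.sum_const_zero] at this
    exact (mul_eq_zero.1 this.symm).resolve_left (by exact_mod_cast hn)
  have hGp : eval p (rst c a b (pderiv 3 F)) = 0 := by
    have := congrArg (eval p) (congrArg (pderiv 1) (rst_cD c a b D₁ F))
    rw [hAB] at this
    simp only [Derivation.leibniz, smul_eq_mul, map_add, map_mul, gA, gB, hAp, hBp, d1a, d1b] at this
    simp [hp] at this
    exact this.symm
  have hFp : eval p (rst c a b F) = 0 := by rw [hAB, map_mul, hAp, zero_mul]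
  have hdvd : ¬ F ∣ pderiv 3 F := by
    rintro ⟨Q, hQ⟩
    have h1 := pd3_ne hd hn hF hirr hA hB hAB
    have h2 : (pderiv 3 F).IsHomogeneous (d - 1) := hF.pderiv
    rw [hQ] at h2 h1
    obtain ⟨i, j, hi, hj, hij⟩ := hom_factor h2 h1
    have := hF.inj_right hi hirr.ne_zero
    omega
  rw [rst_eval] at hGp hFp
  have hdep := elim_dep hF (hF.pderiv (i := 3)) hirr hdvd _ (by simp [hp]) hFp hGp
  have hdep : ¬ AlgebraicIndependent k ![-D₁ c, -D₂ c] := hdep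
  obtain ⟨q, hq0, hq1⟩ := exists_grad hdep
  set g0 := aeval ![-D₁ c, -D₂ c] (pderiv 0 q) with hg0
  set g1 := aeval ![-D₁ c, -D₂ c] (pderiv 1 q) with hg1
  have hg : g0 ≠ 0 ∨ g1 ≠ 0 := by
    obtain ⟨i, hi⟩ := hq1
    fin_cases i
    · exact Or.inl hi
    · exact Or.inr hi
  have hrho : ∀ D : Derivation k K K, ∃ ρ : K, D (D₁ c) = ρ * g1 ∧ D (D₂ c) = - (ρ * g0) := by
    intro D
    have h1 := der_aeval D ![-D₁ c, -D₂ c] q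
    rw [hq0, map_zero] at h1
    change 0 = _ at h1
    rw [Fin.sum_univ_two] at h1
    change 0 = D (-D₁ c) * g0 + D (- D₂ c) * g1 at h1
    rw [map_neg, map_neg] at h1
    rcases hg with h | h
    · refine ⟨- D (D₂ c) / g0, ?_, ?_⟩
      · field_simp; linear_combination h1
      · field_simp
    · refine ⟨D (D₁ c) / g1, ?_, ?_⟩
      · field_simp
      · field_simp; linear_combination h1
  obtain ⟨ρ1, r11, r12⟩ := hrho D₁
  obtain ⟨ρ2, r21, r22⟩ := hrho D₂
  have hne : ρ1 ≠ 0 ∨ ρ2 ≠ 0 := by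
    by_contra hc
    push Not at hc
    rw [hc.1] at r11 r12
    rw [hc.2] at r21 r22
    simp at r11 r12 r21 r22
    obtain ⟨u1, hu1⟩ := der_ker (k := k) (D₁ c) (fun D => by rw [hDx D, r11, r21]; ring)
    obtain ⟨u2, hu2⟩ := der_ker (k := k) (D₂ c) (fun D => by rw [hDx D, r12, r22]; ring)
    obtain ⟨u0, hu0⟩ := der_ker (k := k) (c - algebraMap k K u1 * a - algebraMap k K u2 * b) (fun D => by
      rw [hDx D]; simp only [map_sub, Derivation.leibniz, d1a, d1b, d2a, d2b, Derivation.map_algebraMap, smul_eq_mul]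
      rw [hu1, hu2]; ring)
    exact hnp u0 u1 u2 (by rw [hu0]; ring)
  set E1 : Derivation k K K := ρ2 • D₁ - ρ1 • D₂ with hE1
  have E11 : E1 (D₁ c) = 0 := by simp [hE1, r11, r21]; ring
  have E12 : E1 (D₂ c) = 0 := by simp [hE1, r12, r22]; ring
  obtain ⟨E2, ρ, hρ, e21, e22⟩ : ∃ (E2 : Derivation k K K) (ρ : K), ρ ≠ 0 ∧ E2 (D₁ c) = ρ * g1 ∧ E2 (D₂ c) = - (ρ * g0) := by
    rcases hne with h | h
    · exact ⟨_, _, h, r11, r12⟩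
    · exact ⟨_, _, h, r21, r22⟩
  have Eg : ∀ i, E1 (aeval ![-D₁ c, -D₂ c] (pderiv i q)) = 0 := by
    intro i
    rw [der_aeval, Fin.sum_univ_two]
    simp [E11, E12]
  have Eg0 : E1 g0 = 0 := Eg 0
  have Eg1 : E1 g1 = 0 := Eg 1
  have ell_lin : ∀ D : Derivation k K K, ∃ l : (Fin 3 → K) →ₗ[K] K, ∀ x, l x = D c * x 0 + D a * x 1 + D b * x 2 := by
    intro D
    exact ⟨D c • LinearMap.proj 0 + D a • LinearMap.proj 1 + D b • LinearMap.proj 2, fun x => by simp⟩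
  obtain ⟨l1, hl1⟩ := ell_lin E1
  obtain ⟨l2, hl2⟩ := ell_lin E2
  have ellp : ∀ D : Derivation k K K, D c - D a * D₁ c - D b * D₂ c = 0 := by
    intro D; rw [hDx D c]; ring
  obtain ⟨m, hm, dar, -⟩ := theta_factor c a b E1 E2 F hAB (hNL.irr hA) hA h0
  refine gamma E1 E2 hNL hA p ![0, -(ρ * g1), ρ * g0] (E1 ρ / ρ) (by simp [hp]) (by simp) ?_ ?_ ?_ ?_ l1 l2 ?_ ?_ ?_ ?_ hm ?_ gA
  · intro h
    have a1 := congrFun h 1; have a2 := congrFun h 2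
    simp [hρ] at a1 a2
    rcases hg with h | h
    · exact h a2
    · exact h a1
  · intro i; fin_cases i <;> simp [hp, E11, E12]
  · intro i; fin_cases i <;> simp [hp, e21, e22]
  · intro i; fin_cases i <;> simp [Eg0, Eg1] <;> field_simp
  · intro h
    have a1 := congrArg (fun l => l ![0, 1, 0]) h
    have a2 := congrArg (fun l => l ![0, 0, 1]) h
    simp [hl1, hE1, d1a, d2a, d1b, d2b] at a1 a2
    rcases hne with h | h
    · exact h a2
    · exact h a1
  · rw [hl1]; simp [hp]; linear_combination ellp E1
  · rw [hl2]; simp [hp]; linear_combination ellp E2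
  · rw [hl1]
    have h1 := congrArg E2 (ellp E1)
    have h2 := congrArg E1 (ellp E2)
    have h3 := ellp ⁅E2, E1⁆
    simp only [Derivation.commutator_apply] at h3
    simp only [map_sub, map_zero, Derivation.leibniz, smul_eq_mul, e21, e22, E11, E12] at h1 h2
    simp
    linear_combination -h3 + h1 - h2
  · intro x
    have := congrArg (eval x) dar
    simp only [ellP, map_sub, map_mul, map_add, eval_C, eval_X] at this
    rw [hl1, hl2]
    exact this
end NB

section PlaneCase
variable {k K : Type*} [Field k] [Field K] [Algebra k K]

noncomputable def PhiP (a b : K) : MvPolynomial (Fin 3) k →ₐ[k] MvPolynomial (Fin 2) K :=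
  aeval ![X 0, X 1, C a * X 0 + C b * X 1]

theorem PhiP_cD (a b : K) (D : Derivation k K K) (G : MvPolynomial (Fin 3) k) :
    cD D (PhiP a b G) = (C (D a) * X 0 + C (D b) * X 1) * PhiP a b (pderiv 2 G) := by
  rw [PhiP, der_aeval]
  simp [Fin.sum_univ_three, mul_comm]

theorem antider [CharZero k] {σ : Type*} (i : σ) (g : MvPolynomial σ k) : ∃ G, pderiv i G = g := by
  classical
  induction g using MvPolynomial.induction_on' with
  | monomial s r =>
    refine ⟨monomial (s + Finsupp.single i 1) (r / ((s i : k) + 1)), ?_⟩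
    rw [pderiv_monomial]
    have : ((s i : k) + 1) ≠ 0 := Nat.cast_add_one_ne_zero _
    simp
    field_simp
  | add p q hp hq =>
    obtain ⟨P, rfl⟩ := hp
    obtain ⟨Q, rfl⟩ := hq
    exact ⟨P + Q, map_add _ _ _⟩

theorem PhiP_eval (a b : K) (G : MvPolynomial (Fin 3) k) (x : Fin 2 → K) :
    eval x (PhiP a b G) = aeval ![x 0, x 1, a * x 0 + b * x 1] G := by
  induction G using MvPolynomial.induction_on with
  | C r => simp [PhiP, MvPolynomial.algebraMap_apply]
  | add p q hp hq => simp [hp, hq]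
  | mul_X p i hp => simp only [map_mul, hp]; congr 1; fin_cases i <;> simp [PhiP]

theorem PhiP_inj [IsAlgClosed k] {a b : K} {D₁ : Derivation k K K} (d1a : D₁ a = 1) (d1b : D₁ b = 0) :
    Function.Injective (PhiP (k := k) a b) := by
  have hinf : Infinite k := IsAlgClosed.instInfinite
  rw [injective_iff_map_eq_zero]
  intro G hG
  have key : X 0 * G = 0 := by
    apply MvPolynomial.funext
    intro x
    rw [map_mul, eval_X, map_zero]
    by_cases hs : x 0 = 0
    · rw [hs, zero_mul]
    set q : Polynomial k := aeval ![Polynomial.C (x 0), Polynomial.C (x 1), Polynomial.X] G with hq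
    have h1 : Polynomial.aeval (a * algebraMap k K (x 0) + b * algebraMap k K (x 1)) q = 0 := by
      have := PhiP_eval a b G ![algebraMap k K (x 0), algebraMap k K (x 1)]
      rw [hG, map_zero] at this
      rw [this, hq, ← AlgHom.comp_apply, comp_aeval]
      congr 2
      ext i; fin_cases i <;> simp
    have h2 : q = 0 := by
      by_contra h
      have halg : IsAlgebraic k (a * algebraMap k K (x 0) + b * algebraMap k K (x 1)) := ⟨q, h, h1⟩
      have hi := halg.isIntegral
      obtain ⟨y, hy⟩ := minpoly.mem_range_of_degree_eq_one k _ (IsAlgClosed.degree_eq_one_of_irreducible k (minpoly.irreducible hi))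
      have := congrArg D₁ hy
      rw [Derivation.map_algebraMap, map_add, Derivation.leibniz, Derivation.leibniz, d1a, d1b] at this
      simp at this
      exact hs ((map_eq_zero (algebraMap k K)).1 this.symm)
    have h3 : Polynomial.aeval (x 2) q = eval x G := by
      rw [hq, ← AlgHom.comp_apply, comp_aeval, ← coe_aeval_eq_eval]
      have : (fun i => (Polynomial.aeval (x 2)) (![Polynomial.C (x 0), Polynomial.C (x 1), Polynomial.X] i)) = x := by
        ext i; fin_cases i <;> simp
      rw [this]; rfl
    rw [← h3, h2, map_zero, mul_zero]
  exact (mul_eq_zero.1 key).resolve_left (X_ne_zero 0)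

theorem cD_comm {D E : Derivation k K K} (h : ∀ x, D (E x) = E (D x)) {σ : Type*} (p : MvPolynomial σ K) :
    cD D (cD E p) = cD E (cD D p) := by
  ext m; simp [coeff_cD, h]

theorem ker_theta [IsAlgClosed k] [CharZero k] [CharZero K] {a b : K} {D₁ D₂ : Derivation k K K}
    (d1a : D₁ a = 1) (d1b : D₁ b = 0) (d2a : D₂ a = 0) (d2b : D₂ b = 1)
    (hD : ∀ D : Derivation k K K, D = D a • D₁ + D b • D₂) (N : ℕ) :
    ∀ h : MvPolynomial (Fin 2) K, h.totalDegree < N → X 1 * cD D₁ h = X 0 * cD D₂ h → ∃ G, PhiP (k := k) a b G = h := by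
  have hcomm : ∀ x, D₁ (D₂ x) = D₂ (D₁ x) := by
    intro x
    have h1 := hD ⁅D₁, D₂⁆
    have h2 : (⁅D₁, D₂⁆ : Derivation k K K) = 0 := by
      rw [h1]; simp [Derivation.commutator_apply, d1a, d1b, d2a, d2b]
    have := congrArg (fun D => D x) h2
    simp only [Derivation.commutator_apply] at this
    exact sub_eq_zero.1 this
  induction N with
  | zero => intro h hh; omega
  | succ N ih =>
    intro h hdeg hth
    have hdvd : (X 0 : MvPolynomial (Fin 2) K) ∣ cD D₁ h := by
      have h1 : (X 0 : MvPolynomial (Fin 2) K) ∣ X 1 * cD D₁ h := ⟨_, hth⟩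
      rcases (MvPolynomial.X_prime (R := K) (i := (0 : Fin 2))).dvd_or_dvd h1 with h2 | h2
      · exfalso
        rw [MvPolynomial.X_dvd_X] at h2
        simp at h2
      · exact h2
    obtain ⟨h1, e1⟩ := hdvd
    have e2 : cD D₂ h = X 1 * h1 := by
      rw [e1] at hth
      apply mul_left_cancel₀ (X_ne_zero (0 : Fin 2)); rw [← hth]; ring
    obtain ⟨g1, hg1⟩ : ∃ g1, PhiP (k := k) a b g1 = h1 := by
      by_cases h10 : h1 = 0
      · exact ⟨0, by rw [h10, map_zero]⟩
      apply ih
      · have : (cD D₁ h).totalDegree ≤ h.totalDegree := by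
          apply totalDegree_le_of_support_subset
          intro m hm
          rw [mem_support_iff] at hm ⊢
          intro h0; apply hm; rw [coeff_cD, h0, map_zero]
        rw [e1, totalDegree_mul_of_isDomain (X_ne_zero _) h10, totalDegree_X] at this
        omega
      · have := cD_comm hcomm h
        rw [e1, e2] at this
        simp only [Derivation.leibniz, cD_X, smul_eq_mul, mul_zero, add_zero] at this
        exact this
    obtain ⟨g, hg⟩ := antider (2 : Fin 3) g1
    have hz : ∀ D : Derivation k K K, cD D (h - PhiP a b g) = 0 := by
      intro D
      have : cD D h = C (D a) * cD D₁ h + C (D b) * cD D₂ h := by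
        ext m
        rw [coeff_cD, coeff_add, coeff_C_mul, coeff_C_mul, coeff_cD, coeff_cD]
        conv_lhs => rw [hD D]
        simp
      rw [map_sub, PhiP_cD, hg, hg1, this, e1, e2]; ring
    have hk : ∀ m, ∃ u : k, algebraMap k K u = coeff m (h - PhiP a b g) := by
      intro m
      apply der_ker
      intro D
      rw [← coeff_cD, hz, coeff_zero]
    have : h - PhiP a b g ∈ Set.range (map (algebraMap k K) : MvPolynomial (Fin 2) k →+* _) := by
      rw [MvPolynomial.mem_range_map_iff_coeffs_subset]
      intro x hx
      rw [Finset.mem_coe, MvPolynomial.mem_coeffs_iff] at hx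
      obtain ⟨m, _, rfl⟩ := hx
      exact hk m
    obtain ⟨r, hr⟩ := this
    refine ⟨g + rename ![0, 1] r, ?_⟩
    have hr' : PhiP a b (rename ![0, 1] r) = map (algebraMap k K) r := by
      rw [PhiP, aeval_rename]
      have : ∀ r : MvPolynomial (Fin 2) k, aeval (![X 0, X 1, C a * X 0 + C b * X 1] ∘ ![0, 1]) r = map (algebraMap k K) r := by
        intro r
        induction r using MvPolynomial.induction_on with
        | C r => simp [MvPolynomial.algebraMap_apply]
        | add p q hp hq => rw [map_add, hp, hq, map_add]
        | mul_X p i hp => rw [map_mul, hp, map_mul]; congr 1; fin_cases i <;> simp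
      exact this r
    rw [map_add, hr', hr]; ring

theorem plane0 [IsAlgClosed k] [CharZero k] [CharZero K] [IsAlgClosed K] {a b : K} {F : MvPolynomial (Fin 4) k} {n : ℕ} (hn : n ≠ 0)
    (hirr : Irreducible F) {A B : MvPolynomial (Fin 3) K}
    (hA : A.IsHomogeneous 3) (hB : B.IsHomogeneous n) (hAB : rst 0 a b F = A * B) (hNL : NL (A * B))
    {D₁ D₂ : Derivation k K K} (d1a : D₁ a = 1) (d1b : D₁ b = 0) (d2a : D₂ a = 0) (d2b : D₂ b = 1)
    (hD : ∀ D : Derivation k K K, D = D a • D₁ + D b • D₂) : False := by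
  obtain ⟨m, hm, e1, e2⟩ := theta_factor 0 a b D₁ D₂ F hAB (hNL.left.irr hA) hA hNL.ne_zero
  set Q := finSuccEquiv K 2 with hQ
  have hl1 : Q (ellP 0 a b D₁) = Polynomial.C (X 0) := by
    simp only [ellP, d1a, d1b, map_zero, map_one]
    simp only [zero_mul, zero_add, one_mul, add_zero]
    exact finSuccEquiv_X_succ (j := 0)
  have hl2 : Q (ellP 0 a b D₂) = Polynomial.C (X 1) := by
    simp only [ellP, d2a, d2b, map_zero, map_one]
    simp only [zero_mul, zero_add, one_mul]
    exact finSuccEquiv_X_succ (j := 1)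
  have hQc : ∀ (D : Derivation k K K) P j, (Q (cD D P)).coeff j = cD D ((Q P).coeff j) := by
    intro D P j
    ext s
    rw [hQ, finSuccEquiv_coeff_coeff, coeff_cD, coeff_cD, finSuccEquiv_coeff_coeff]
  have hQd : ∀ (D : Derivation k K K) P, (Q (cD D P)).natDegree ≤ (Q P).natDegree := by
    intro D P
    rw [Polynomial.natDegree_le_iff_coeff_eq_zero]
    intro N hN
    rw [hQc, Polynomial.coeff_eq_zero_of_natDegree_lt hN, map_zero]
  have hA0 : Q A ≠ 0 := by simpa using hNL.left.ne_zero
  have hB0 : Q B ≠ 0 := by simpa using hNL.right.ne_zero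
  have f1 := congrArg Q e1
  have f2 := congrArg Q e2
  rw [map_sub, map_mul, map_mul, hl1, hl2, map_mul] at f1
  rw [map_sub, map_mul, map_mul, hl1, hl2, map_neg, map_mul] at f2
  obtain ⟨m', hm'⟩ : ∃ m', Q m = Polynomial.C m' := by
    by_cases hm0 : Q m = 0
    · exact ⟨0, by rw [hm0, map_zero]⟩
    have h1 : (Q m * Q A).natDegree ≤ (Q A).natDegree := by
      rw [← f1]
      refine (Polynomial.natDegree_sub_le _ _).trans (max_le ?_ ?_)
      · exact (Polynomial.natDegree_C_mul_le _ _).trans (hQd _ _)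
      · exact (Polynomial.natDegree_C_mul_le _ _).trans (hQd _ _)
    rw [Polynomial.natDegree_mul hm0 hA0] at h1
    obtain ⟨x, hx⟩ := Polynomial.natDegree_eq_zero.1 (show (Q m).natDegree = 0 by omega)
    exact ⟨x, hx.symm⟩
  rw [hm'] at f1 f2
  have g1 : ∀ j, X 1 * cD D₁ ((Q A).coeff j) - X 0 * cD D₂ ((Q A).coeff j) = m' * (Q A).coeff j := by
    intro j
    have := congrArg (fun p => Polynomial.coeff p j) f1
    simpa only [Polynomial.coeff_sub, Polynomial.coeff_C_mul, hQc] using this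
  have g2 : ∀ j, X 1 * cD D₁ ((Q B).coeff j) - X 0 * cD D₂ ((Q B).coeff j) = - (m' * (Q B).coeff j) := by
    intro j
    have := congrArg (fun p => Polynomial.coeff p j) f2
    simpa only [Polynomial.coeff_sub, Polynomial.coeff_neg, Polynomial.coeff_C_mul, hQc] using this
  have hker : ∀ h : MvPolynomial (Fin 2) K, X 1 * cD D₁ h - X 0 * cD D₂ h = 0 → ∃ G, PhiP (k := k) a b G = h :=
    fun h hh => ker_theta d1a d1b d2a d2b hD _ h (Nat.lt_succ_self _) (sub_eq_zero.1 hh)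
  set φ : MvPolynomial (Fin 3) k →+* MvPolynomial (Fin 2) K := (PhiP (k := k) a b).toRingHom with hφ
  have hinj : Function.Injective φ := PhiP_inj d1a d1b
  have hlift : ∀ i j, ∃ G, φ G = (Q A).coeff i * (Q B).coeff j := by
    intro i j
    apply hker
    simp only [Derivation.leibniz, smul_eq_mul]
    linear_combination (Q B).coeff j * g1 i + (Q A).coeff i * g2 j
  obtain ⟨A', hA'⟩ : ∃ A', Polynomial.map φ A' = Q A * Polynomial.C (Q B).leadingCoeff := by
    rw [← Polynomial.mem_lifts, Polynomial.lifts_iff_coeff_lifts]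
    intro i
    rw [Polynomial.coeff_mul_C]
    exact hlift i _
  obtain ⟨B', hB'⟩ : ∃ A', Polynomial.map φ A' = Q B * Polynomial.C (Q A).leadingCoeff := by
    rw [← Polynomial.mem_lifts, Polynomial.lifts_iff_coeff_lifts]
    intro i
    rw [Polynomial.coeff_mul_C, mul_comm]
    exact hlift _ i
  set P := finSuccEquiv k 3 F with hP
  have hPirr : Prime P := ((MulEquiv.irreducible_iff (finSuccEquiv k 3).toMulEquiv).2 hirr).prime
  have hPmap : Polynomial.map φ P = Q A * Q B := by
    rw [← map_mul, ← hAB, hP]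
    have : ∀ F : MvPolynomial (Fin 4) k, Polynomial.map φ (finSuccEquiv k 3 F) = Q (rst 0 a b F) := by
      intro F
      induction F using MvPolynomial.induction_on with
      | C r =>
        have h1 : rst (0 : K) a b (C r) = C (algebraMap k K r) := by simp [rst, MvPolynomial.algebraMap_apply]
        rw [h1, finSuccEquiv_apply, hQ, finSuccEquiv_apply]
        simp [hφ, PhiP, MvPolynomial.algebraMap_apply]
      | add p q hp hq => simp [hp, hq]
      | mul_X p i hp =>
        rw [map_mul, Polynomial.map_mul, hp, map_mul, map_mul]; congr 1
        refine Fin.cases ?_ (fun j => ?_) i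
        · rw [finSuccEquiv_X_zero, Polynomial.map_X, hQ]
          simp [rst, finSuccEquiv_X_zero]
        · rw [finSuccEquiv_X_succ, Polynomial.map_C, hQ]
          have s1 : finSuccEquiv K 2 (X 1) = Polynomial.C (X 0) := finSuccEquiv_X_succ (j := 0)
          have s2 : finSuccEquiv K 2 (X 2) = Polynomial.C (X 1) := finSuccEquiv_X_succ (j := 1)
          have s3 : ∀ r, finSuccEquiv K 2 (C r) = Polynomial.C (C r) := fun r => by rw [finSuccEquiv_apply]; simp
          fin_cases j
          · simp [rst, hφ, PhiP, s1]
          · simp [rst, hφ, PhiP, s2]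
          · simp [rst, hφ, PhiP, s1, s2, s3]
    exact this F
  have hprod : A' * B' = P * Polynomial.C P.leadingCoeff := by
    apply Polynomial.map_injective φ hinj
    rw [Polynomial.map_mul, Polynomial.map_mul, hA', hB', hPmap, Polynomial.map_C]
    have : φ P.leadingCoeff = (Q A).leadingCoeff * (Q B).leadingCoeff := by
      rw [← Polynomial.leadingCoeff_mul, ← hPmap, Polynomial.leadingCoeff_map_of_injective hinj]
    rw [this, Polynomial.C_mul]; ring
  have hdeg : P.natDegree = (Q A).natDegree + (Q B).natDegree := by
    rw [← Polynomial.natDegree_mul hA0 hB0, ← hPmap, Polynomial.natDegree_map_eq_of_injective hinj]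
  have hcyl : ∀ (e : ℕ) (G : MvPolynomial (Fin 3) K), e ≠ 0 → G.IsHomogeneous e → NL G → (Q G).natDegree = 0 → False := by
    intro e G he hG hNG h0
    obtain ⟨g, hg⟩ := Polynomial.natDegree_eq_zero.1 h0
    have hG' : G = rename Fin.succ g := by
      apply Q.injective
      rw [← hg, hQ]
      clear * -
      induction g using MvPolynomial.induction_on with
      | C r => rw [rename_C, finSuccEquiv_apply]; simp
      | add p q hp hq => simp only [map_add, hp, hq]
      | mul_X p i hp => simp only [map_mul, rename_X, ← hp, finSuccEquiv_X_succ]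
    refine hNG.not_cyl he hG ![1, 0, 0] (fun h => by have := congrFun h 0; simp at this) ?_
    intro x t
    rw [hG', eval_rename, eval_rename]
    have : (x + t • (![1, 0, 0] : Fin 3 → K)) ∘ Fin.succ = x ∘ Fin.succ := by
      ext i; fin_cases i
      · show x 1 + t * 0 = x 1
        ring
      · show x 2 + t * 0 = x 2
        ring
    rw [this]
  rcases hPirr.dvd_or_dvd (Dvd.intro _ hprod.symm) with h | h
  · have h1 : A' ≠ 0 := by
      rintro rfl
      rw [Polynomial.map_zero] at hA'
      exact mul_ne_zero hA0 (by simpa using hB0) hA'.symm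
    have h2 := Polynomial.natDegree_le_of_dvd h h1
    rw [← Polynomial.natDegree_map_eq_of_injective hinj A', hA', Polynomial.natDegree_mul_C (by simpa using hB0)] at h2
    exact hcyl n B hn hB hNL.right (by omega)
  · have h1 : B' ≠ 0 := by
      rintro rfl
      rw [Polynomial.map_zero] at hB'
      exact mul_ne_zero hB0 (by simpa using hA0) hB'.symm
    have h2 := Polynomial.natDegree_le_of_dvd h h1
    rw [← Polynomial.natDegree_map_eq_of_injective hinj B', hB', Polynomial.natDegree_mul_C (by simpa using hA0)] at h2
    exact hcyl 3 A (by norm_num) hA hNL.left (by omega)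

theorem plane_case [IsAlgClosed k] [CharZero k] [CharZero K] [IsAlgClosed K] {a b c : K} {F : MvPolynomial (Fin 4) k} {n : ℕ} (hn : n ≠ 0)
    (hirr : Irreducible F) {A B : MvPolynomial (Fin 3) K}
    (hA : A.IsHomogeneous 3) (hB : B.IsHomogeneous n) (hAB : rst c a b F = A * B) (hNL : NL (A * B))
    {D₁ D₂ : Derivation k K K} (d1a : D₁ a = 1) (d1b : D₁ b = 0) (d2a : D₂ a = 0) (d2b : D₂ b = 1)
    (hD : ∀ D : Derivation k K K, D = D a • D₁ + D b • D₂) (u0 u1 u2 : k)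
    (hc : c = algebraMap k K u0 + algebraMap k K u1 * a + algebraMap k K u2 * b) : False := by
  let τ : MvPolynomial (Fin 4) k →ₐ[k] MvPolynomial (Fin 4) k := aeval ![X 0, X 1 - C u1 * X 0, X 2 - C u2 * X 0, X 3 + C u0 * X 0]
  let τ' : MvPolynomial (Fin 4) k →ₐ[k] MvPolynomial (Fin 4) k := aeval ![X 0, X 1 + C u1 * X 0, X 2 + C u2 * X 0, X 3 - C u0 * X 0]
  let T : MvPolynomial (Fin 4) k ≃ₐ[k] MvPolynomial (Fin 4) k := AlgEquiv.ofAlgHom τ τ'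
    (by ext1 i; fin_cases i <;> simp [τ, τ']) (by ext1 i; fin_cases i <;> simp [τ, τ'])
  let w1 := algebraMap k K u1
  let w2 := algebraMap k K u2
  let σ : MvPolynomial (Fin 3) K →ₐ[K] MvPolynomial (Fin 3) K := aeval ![X 0, X 1 - C w1 * X 0, X 2 - C w2 * X 0]
  have hσ : ∀ x P, eval x (σ P) = eval ![x 0, x 1 - w1 * x 0, x 2 - w2 * x 0] P := by
    intro x P
    induction P using MvPolynomial.induction_on with
    | C r => simp [σ]
    | add p q hp hq => simp [hp, hq]
    | mul_X p i hp => simp only [map_mul, hp]; congr 1; fin_cases i <;> simp [σ]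
  have hσh : ∀ e P, P.IsHomogeneous e → (σ P).IsHomogeneous e := by
    intro e P hP
    have := MvPolynomial.IsHomogeneous.aeval (n := 1) (S := K) (τ := Fin 3) hP ![X 0, X 1 - C w1 * X 0, X 2 - C w2 * X 0] ?_
    · rwa [one_mul] at this
    · have hX : ∀ j : Fin 3, (X j : MvPolynomial (Fin 3) K).IsHomogeneous 1 := fun j => isHomogeneous_X _ _
      have hc : ∀ (r : K) j, (C r * X j : MvPolynomial (Fin 3) K).IsHomogeneous 1 := fun r j => isHomogeneous_C_mul_X r j
      intro i
      fin_cases i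
      · exact hX 0
      · exact (hX 1).sub (hc _ _)
      · exact (hX 2).sub (hc _ _)
  refine plane0 (F := T F) hn ((MulEquiv.irreducible_iff T.toMulEquiv).2 hirr) (hσh _ _ hA) (hσh _ _ hB) ?_ ?_ d1a d1b d2a d2b hD
  · have hinf : Infinite K := IsAlgClosed.instInfinite
    rw [← map_mul, ← hAB]
    apply MvPolynomial.funext
    intro x
    rw [hσ, rst_eval, rst_eval]
    change aeval _ (τ F) = _
    rw [← AlgHom.comp_apply, comp_aeval]
    congr 2
    ext i; fin_cases i <;> simp [hc, w1, w2] <;> ring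
  · rw [← map_mul]
    intro u v huv
    have hind : ∀ s t : K, s • ![u 0, u 1 - w1 * u 0, u 2 - w2 * u 0] + t • ![v 0, v 1 - w1 * v 0, v 2 - w2 * v 0] = 0 → s = 0 ∧ t = 0 := by
      intro s t h
      apply huv
      have h0 := congrFun h 0; have h1 := congrFun h 1; have h2 := congrFun h 2
      simp only [Pi.add_apply, Pi.smul_apply, smul_eq_mul] at h0 h1 h2
      simp at h0 h1 h2
      ext i; fin_cases i
      · simpa using h0
      · simp; linear_combination h1 + w1 * h0
      · simp; linear_combination h2 + w2 * h0
    obtain ⟨s, t, hst⟩ := hNL _ _ hind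
    refine ⟨s, t, ?_⟩
    rw [hσ]
    intro h0
    apply hst
    rw [← h0]
    apply congrArg (fun y => eval y (A * B))
    ext i; fin_cases i
    · simp
    · simp; ring
    · simp; ring
end PlaneCase

section LineP
variable {K : Type*} [Field K] {σ : Type*}

theorem lineP_top (u v : σ → K) {A : MvPolynomial σ K} {e : ℕ} (hA : A.IsHomogeneous e) :
    (lineP u v A).natDegree ≤ e ∧ (lineP u v A).coeff e = eval v A := by
  classical
  have hfac : ∀ i, ∀ n : ℕ, ((Polynomial.C (u i) + Polynomial.C (v i) * Polynomial.X) ^ n).natDegree ≤ n ∧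
      ((Polynomial.C (u i) + Polynomial.C (v i) * Polynomial.X) ^ n).coeff n = v i ^ n := by
    intro i n
    have h1 : (Polynomial.C (u i) + Polynomial.C (v i) * Polynomial.X).natDegree ≤ 1 := by
      rw [add_comm]; exact Polynomial.natDegree_linear_le
    refine ⟨by simpa using Polynomial.natDegree_pow_le_of_le n h1, ?_⟩
    have := Polynomial.coeff_pow_of_natDegree_le (m := n) h1
    rw [mul_one] at this
    rw [this]; simp
  have hpr : ∀ (m : σ → ℕ) (s : Finset σ), (∏ i ∈ s, (Polynomial.C (u i) + Polynomial.C (v i) * Polynomial.X) ^ m i).natDegree ≤ ∑ i ∈ s, m i ∧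
      (∏ i ∈ s, (Polynomial.C (u i) + Polynomial.C (v i) * Polynomial.X) ^ m i).coeff (∑ i ∈ s, m i) = ∏ i ∈ s, v i ^ m i := by
    intro m s
    induction s using Finset.induction_on with
    | empty => simp
    | insert i s hi ih =>
      rw [Finset.prod_insert hi, Finset.sum_insert hi, Finset.prod_insert hi]
      exact ⟨Polynomial.natDegree_mul_le_of_le (hfac i _).1 ih.1, by
        rw [Polynomial.coeff_mul_add_eq_of_natDegree_le (hfac i _).1 ih.1, (hfac i _).2, ih.2]⟩
  have hmon : ∀ m ∈ A.support, (lineP u v (monomial m (coeff m A))).natDegree ≤ e ∧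
      (lineP u v (monomial m (coeff m A))).coeff e = eval v (monomial m (coeff m A)) := by
    intro m hm
    have hdeg : ∑ i ∈ m.support, m i = e := by
      have := hA (mem_support_iff.1 hm)
      rw [← this, Finsupp.weight_apply]; simp [Finsupp.sum]
    have h1 : lineP u v (monomial m (coeff m A)) = Polynomial.C (coeff m A) *
        ∏ i ∈ m.support, (Polynomial.C (u i) + Polynomial.C (v i) * Polynomial.X) ^ m i := by
      rw [lineP, aeval_monomial]; rfl
    rw [h1]
    constructor
    · refine (Polynomial.natDegree_C_mul_le _ _).trans ?_
      rw [← hdeg]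
      exact (hpr m m.support).1
    · rw [Polynomial.coeff_C_mul, eval_monomial, ← hdeg, (hpr m m.support).2]; rfl
  have hs := A.support_sum_monomial_coeff
  constructor
  · conv_lhs => rw [← hs]
    rw [map_sum]
    exact Polynomial.natDegree_sum_le_of_forall_le _ _ fun m hm => (hmon m hm).1
  · conv_lhs => rw [← hs]
    conv_rhs => rw [← hs]
    rw [map_sum, Polynomial.finsetSum_coeff, map_sum]
    exact Finset.sum_congr rfl fun m hm => (hmon m hm).2

theorem NL.lineP_ne {A : MvPolynomial (Fin 3) K} {e : ℕ} (hA : A.IsHomogeneous e) (h : NL A) (u v : Fin 3 → K)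
    (huv : ∀ s t : K, s • u + t • v = 0 → s = 0 ∧ t = 0) : lineP u v A ≠ 0 := by
  intro h0
  have hv : eval v A = 0 := by rw [← (lineP_top u v hA).2, h0, Polynomial.coeff_zero]
  obtain ⟨s, t, hst⟩ := h u v huv
  apply hst
  by_cases hs : s = 0
  · rw [hs, zero_smul, zero_add, eval_smul_hom hA, hv, mul_zero]
  · have : s • u + t • v = s • (u + (t / s) • v) := by
      rw [smul_add, smul_smul, mul_div_cancel₀ _ hs]
    rw [this, eval_smul_hom hA, ← lineP_eval, h0]; simp
end LineP

section Exp
variable {k K : Type*} [Field k] [Field K] [Algebra k K] [CharZero K]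

noncomputable def expF (D : Derivation k K K) (x : K) : PowerSeries K :=
  PowerSeries.mk fun n => (D^[n] x) / (n.factorial : K)

theorem expF_add (D : Derivation k K K) (x y : K) : expF D (x + y) = expF D x + expF D y := by
  ext n
  simp only [expF, PowerSeries.coeff_mk, map_add]
  have : ∀ n, D^[n] (x + y) = D^[n] x + D^[n] y := by
    intro n
    induction n with
    | zero => rfl
    | succ n ih => rw [Function.iterate_succ_apply', ih, map_add, Function.iterate_succ_apply', Function.iterate_succ_apply']
  rw [this, add_div]

theorem expF_d (D : Derivation k K K) (x : K) : PowerSeries.derivative K (expF D x) = expF D (D x) := by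
  ext n
  rw [PowerSeries.coeff_derivative]
  simp only [expF, PowerSeries.coeff_mk]
  rw [Function.iterate_succ_apply, Nat.factorial_succ]
  have : (n.factorial : K) ≠ 0 := by exact_mod_cast n.factorial_ne_zero
  have : ((n : K) + 1) ≠ 0 := Nat.cast_add_one_ne_zero n
  push_cast
  field_simp

theorem expF_zero (D : Derivation k K K) (x : K) : PowerSeries.coeff 0 (expF D x) = x := by simp [expF]

theorem expF_mul (D : Derivation k K K) (x y : K) : expF D (x * y) = expF D x * expF D y := by
  ext n
  induction n generalizing x y with
  | zero => have := expF_zero D x; have := expF_zero D y; have := expF_zero D (x * y); simp_all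
  | succ n ih =>
    have h1 : PowerSeries.coeff n (PowerSeries.derivative K (expF D (x * y))) =
        PowerSeries.coeff n (PowerSeries.derivative K (expF D x * expF D y)) := by
      rw [Derivation.leibniz, expF_d, expF_d, expF_d, Derivation.leibniz, expF_add, map_add, map_add, smul_eq_mul, smul_eq_mul,
        smul_eq_mul, smul_eq_mul, ih, ih]
    rw [PowerSeries.coeff_derivative, PowerSeries.coeff_derivative] at h1
    exact mul_right_cancel₀ (Nat.cast_add_one_ne_zero n) h1

theorem expF_alg (D : Derivation k K K) (r : k) : expF D (algebraMap k K r) = PowerSeries.C (algebraMap k K r) := by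
  ext n
  cases n with
  | zero => rw [expF_zero]; simp
  | succ n =>
    simp only [expF, PowerSeries.coeff_mk, PowerSeries.coeff_C]
    rw [Function.iterate_succ_apply, Derivation.map_algebraMap]
    have : D^[n] 0 = 0 := Function.iterate_fixed (map_zero D) n
    simp [this]

noncomputable def expA (D : Derivation k K K) : K →ₐ[k] PowerSeries K where
  toFun := expF D
  map_one' := by simpa using expF_alg D (1 : k)
  map_mul' := expF_mul D
  map_zero' := by simpa using expF_alg D (0 : k)
  map_add' := expF_add D
  commutes' r := by rw [expF_alg, IsScalarTower.algebraMap_apply k K (PowerSeries K)]; rfl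

/-- exp x = x + ε η with η(0) = D x -/
theorem expA_delta (D : Derivation k K K) (x : K) : ∃ η : PowerSeries K, PowerSeries.constantCoeff η = D x ∧
    expA D x - PowerSeries.C x = PowerSeries.X * η := by
  have h : PowerSeries.X ∣ expA D x - PowerSeries.C x := by
    rw [PowerSeries.X_dvd_iff, map_sub]
    have := expF_zero D x
    simp at this ⊢
    rw [sub_eq_zero]; exact this
  obtain ⟨η, hη⟩ := h
  refine ⟨η, ?_, hη⟩
  have h1 := congrArg (PowerSeries.coeff 1) hη
  rw [show 1 = 0 + 1 from rfl, PowerSeries.coeff_succ_X_mul] at h1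
  simp [PowerSeries.coeff_C] at h1
  rw [← h1]
  show PowerSeries.coeff 1 (expF D x) = _
  simp [expF]
end Exp

section TensorDomain
variable {k K : Type*} [Field k] [Field K] [Algebra k K]
open TensorProduct

theorem tensor_domain [IsAlgClosed k] : IsDomain (K ⊗[k] K) := by
  classical
  let w := Module.Basis.ofVectorSpace k K
  let W := Algebra.TensorProduct.basis K w
  have hnz : ∀ x y : K ⊗[k] K, x * y = 0 → x = 0 ∨ y = 0 := by
    intro x y hxy
    by_contra hc
    push Not at hc
    obtain ⟨i0, hi0⟩ : ∃ i, W.repr x i ≠ 0 := by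
      by_contra h; push Not at h
      exact hc.1 (W.repr.map_eq_zero_iff.1 (Finsupp.ext h))
    obtain ⟨j0, hj0⟩ : ∃ i, W.repr y i ≠ 0 := by
      by_contra h; push Not at h
      exact hc.2 (W.repr.map_eq_zero_iff.1 (Finsupp.ext h))
    let s := (W.repr x).support
    let t := (W.repr y).support
    have hx : x = ∑ i ∈ s, (W.repr x i) ⊗ₜ[k] (w i) := by
      conv_lhs => rw [← W.linearCombination_repr x]
      rw [Finsupp.linearCombination_apply, Finsupp.sum]
      refine Finset.sum_congr rfl fun i _ => ?_
      rw [Algebra.TensorProduct.basis_apply, TensorProduct.smul_tmul', smul_eq_mul, mul_one]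
    have hy : y = ∑ i ∈ t, (W.repr y i) ⊗ₜ[k] (w i) := by
      conv_lhs => rw [← W.linearCombination_repr y]
      rw [Finsupp.linearCombination_apply, Finsupp.sum]
      refine Finset.sum_congr rfl fun i _ => ?_
      rw [Algebra.TensorProduct.basis_apply, TensorProduct.smul_tmul', smul_eq_mul, mul_one]
    let u : Option (s ⊕ t) → K := fun o => match o with
      | none => (W.repr x i0 * W.repr y j0)⁻¹
      | some (Sum.inl i) => W.repr x i
      | some (Sum.inr j) => W.repr y j
    obtain ⟨v, hv⟩ := nss {p : MvPolynomial (Option (s ⊕ t)) k | aeval u p = 0} u (fun p hp => hp)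
    have hi0' : i0 ∈ s := Finsupp.mem_support_iff.2 hi0
    have hj0' : j0 ∈ t := Finsupp.mem_support_iff.2 hj0
    have h1 := hv (X (some (Sum.inl ⟨i0, hi0'⟩)) * X (some (Sum.inr ⟨j0, hj0'⟩)) * X none - 1) (by
      simp only [Set.mem_ofPred_eq, map_sub, map_mul, aeval_X, map_one, u]
      rw [mul_inv_cancel₀ (mul_ne_zero hi0 hj0), sub_self])
    simp only [map_sub, map_mul, eval_X, map_one] at h1
    -- coordinates of product
    have hcoord : ∀ l, ∑ i : s, ∑ j : t, W.repr x i * W.repr y j * algebraMap k K (w.repr (w i * w j) l) = 0 := by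
      intro l
      have := congrArg (fun z => W.repr z l) hxy
      rw [hx, hy, Finset.sum_mul_sum] at this
      simp only [Algebra.TensorProduct.tmul_mul_tmul, map_sum, map_zero, Finsupp.coe_zero, Pi.zero_apply, Finsupp.coe_finsetSum, Finset.sum_apply] at this
      rw [← this, Finset.sum_coe_sort s (fun i => ∑ j : t, W.repr x i * W.repr y j * algebraMap k K (w.repr (w i * w j) l))]
      refine Finset.sum_congr rfl fun i _ => ?_
      rw [Finset.sum_coe_sort t (fun j => W.repr x i * W.repr y j * algebraMap k K (w.repr (w i * w j) l))]
      refine Finset.sum_congr rfl fun j _ => ?_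
      rw [Algebra.TensorProduct.basis_repr_tmul]
      simp [Algebra.smul_def, mul_comm]
    have hcoord' : ∀ l, ∑ i : s, ∑ j : t, v (some (Sum.inl i)) * v (some (Sum.inr j)) * w.repr (w i * w j) l = 0 := by
      intro l
      have := hv (∑ i : s, ∑ j : t, X (some (Sum.inl i)) * X (some (Sum.inr j)) * C (w.repr (w i * w j) l)) (by
        simp only [Set.mem_ofPred_eq, map_sum, map_mul, aeval_X, aeval_C, u]
        exact hcoord l)
      simpa only [map_sum, map_mul, eval_X, eval_C] using this
    have hprod : (∑ i : s, v (some (Sum.inl i)) • w i) * (∑ j : t, v (some (Sum.inr j)) • w j) = 0 := by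
      apply w.repr.map_eq_zero_iff.1
      ext l
      rw [Finset.sum_mul_sum]
      simp only [map_sum, Finsupp.coe_finsetSum, Finset.sum_apply, smul_mul_smul_comm, map_smul, Finsupp.smul_apply, smul_eq_mul]
      exact hcoord' l
    have hli := w.linearIndependent
    have hlis := hli.comp (Subtype.val : s → _) Subtype.val_injective
    have hlit := hli.comp (Subtype.val : t → _) Subtype.val_injective
    rcases mul_eq_zero.1 hprod with h | h
    · have := Fintype.linearIndependent_iff.1 hlis _ h ⟨i0, hi0'⟩
      rw [this] at h1; simp at h1
    · have := Fintype.linearIndependent_iff.1 hlit _ h ⟨j0, hj0'⟩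
      rw [this] at h1; simp at h1
  have : NoZeroDivisors (K ⊗[k] K) := ⟨fun {x y} h => hnz x y h⟩
  have : Nontrivial (K ⊗[k] K) := inferInstance
  exact NoZeroDivisors.to_isDomain _
end TensorDomain

section Mat
open Polynomial (C X natDegree coeff)
open scoped Polynomial

noncomputable def Mt {R : Type*} [CommRing R] (n : ℕ) (P Q : R[X]) : Matrix (Fin (n+2)) (Fin 2 ⊕ Fin (n-1)) R :=
  Matrix.of fun r c => (Sum.elim (fun i : Fin 2 => Polynomial.X ^ (i : ℕ) * Q) (fun j : Fin (n-1) => Polynomial.X ^ (j : ℕ) * P) c).coeff r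

theorem Mt_map {R R' : Type*} [CommRing R] [CommRing R'] (φ : R →+* R') (n : ℕ) (P Q : R[X]) :
    (Mt n P Q).map φ = Mt n (P.map φ) (Q.map φ) := by
  ext r c
  rcases c with i | j
  · simp only [Mt, Matrix.map_apply, Matrix.of_apply, Sum.elim_inl, ← Polynomial.coeff_map, Polynomial.map_mul, Polynomial.map_pow, Polynomial.map_X]
  · simp only [Mt, Matrix.map_apply, Matrix.of_apply, Sum.elim_inr, ← Polynomial.coeff_map, Polynomial.map_mul, Polynomial.map_pow, Polynomial.map_X]

theorem Mt_scale {R : Type*} [CommRing R] (n : ℕ) (P Q : R[X]) (x y : R) :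
    Mt n (Polynomial.C x * P) (Polynomial.C y * Q) = (Mt n P Q * (Matrix.diagonal (Sum.elim (fun _ => y) (fun _ => x)) : Matrix (Fin 2 ⊕ Fin (n-1)) (Fin 2 ⊕ Fin (n-1)) R) : Matrix (Fin (n+2)) (Fin 2 ⊕ Fin (n-1)) R) := by
  refine Matrix.ext fun r c => ?_
  rw [Matrix.mul_diagonal]
  rcases c with i | j
  · simp only [Mt, Matrix.of_apply, Sum.elim_inl]
    rw [mul_left_comm, Polynomial.coeff_C_mul, mul_comm]
  · simp only [Mt, Matrix.of_apply, Sum.elim_inr]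
    rw [mul_left_comm, Polynomial.coeff_C_mul, mul_comm]

theorem Mt_mulVec {R : Type*} [CommRing R] (n : ℕ) (P Q : R[X]) (x : Fin 2 ⊕ Fin (n-1) → R) (r : Fin (n+2)) :
    (Mt n P Q).mulVec x r = ((∑ i : Fin 2, Polynomial.C (x (Sum.inl i)) * Polynomial.X ^ (i : ℕ)) * Q
      + (∑ j : Fin (n-1), Polynomial.C (x (Sum.inr j)) * Polynomial.X ^ (j : ℕ)) * P).coeff r := by
  rw [Matrix.mulVec, dotProduct, Fintype.sum_sum_type, Polynomial.coeff_add, Finset.sum_mul, Finset.sum_mul,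
    Polynomial.finsetSum_coeff, Polynomial.finsetSum_coeff]
  congr 1
  · refine Finset.sum_congr rfl fun i _ => ?_
    rw [mul_assoc, Polynomial.coeff_C_mul, mul_comm]; rfl
  · refine Finset.sum_congr rfl fun i _ => ?_
    rw [mul_assoc, Polynomial.coeff_C_mul, mul_comm]; rfl

theorem sum_natDegree_lt {R : Type*} [CommRing R] {m : ℕ} (x : Fin m → R) :
    (∑ i : Fin m, Polynomial.C (x i) * Polynomial.X ^ (i : ℕ)).degree < (m : WithBot ℕ) := by
  refine (Polynomial.degree_sum_le _ _).trans_lt ?_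
  refine (Finset.sup_lt_iff (WithBot.bot_lt_coe m)).2 ?_
  intro i _
  refine (Polynomial.degree_C_mul_X_pow_le _ _).trans_lt ?_
  exact WithBot.coe_lt_coe.2 i.2

theorem sum_coeff {R : Type*} [CommRing R] {m : ℕ} (x : Fin m → R) (j : Fin m) :
    (∑ i : Fin m, Polynomial.C (x i) * Polynomial.X ^ (i : ℕ)).coeff j = x j := by
  rw [Polynomial.finsetSum_coeff, Finset.sum_eq_single j]
  · simp
  · intro i _ hi
    rw [Polynomial.coeff_C_mul_X_pow, if_neg]
    intro h; exact hi (Fin.ext h.symm)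
  · simp

theorem Mt_inj {K : Type*} [Field K] {n : ℕ} {P Q : K[X]} (hP : P.natDegree = 3) (hQ : Q.natDegree = n) (hn : 1 ≤ n)
    (hQ0 : Q ≠ 0)
    (h : ∀ g, g ∣ P → g ∣ Q → g.natDegree ≤ 1) (x : Fin 2 ⊕ Fin (n-1) → K) (hx : (Mt n P Q).mulVec x = 0) : x = 0 := by
  classical
  set w := ∑ i : Fin 2, Polynomial.C (x (Sum.inl i)) * Polynomial.X ^ (i : ℕ) with hw
  set u := ∑ j : Fin (n-1), Polynomial.C (x (Sum.inr j)) * Polynomial.X ^ (j : ℕ) with hu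
  have hP0 : P ≠ 0 := by rintro rfl; simp at hP
  have dw : w.degree < 2 := sum_natDegree_lt (fun i => x (Sum.inl i))
  have du : u.degree < ((n - 1 : ℕ) : WithBot ℕ) := sum_natDegree_lt (fun i => x (Sum.inr i))
  have hz : w * Q + u * P = 0 := by
    ext r
    rw [Polynomial.coeff_zero]
    by_cases hr : r < n + 2
    · have := congrFun hx ⟨r, hr⟩
      rw [Mt_mulVec] at this
      exact this
    · apply Polynomial.coeff_eq_zero_of_degree_lt
      refine (Polynomial.degree_add_le _ _).trans_lt ?_
      have h2 : ((n + 2 : ℕ) : WithBot ℕ) ≤ r := by exact_mod_cast (by omega)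
      refine lt_of_lt_of_le ?_ h2
      rw [max_lt_iff, Polynomial.degree_mul, Polynomial.degree_mul, Polynomial.degree_eq_natDegree hQ0, Polynomial.degree_eq_natDegree hP0, hP, hQ]
      constructor
      · by_cases hw0 : w = 0
        · rw [hw0]; simp; try exact WithBot.bot_lt_coe _
        · rw [Polynomial.degree_eq_natDegree hw0] at dw ⊢
          have : w.natDegree < 2 := by exact_mod_cast dw
          exact_mod_cast (by omega)
      · by_cases hw0 : u = 0
        · rw [hw0]; simp; try exact WithBot.bot_lt_coe _
        · rw [Polynomial.degree_eq_natDegree hw0] at du ⊢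
          have : u.natDegree < n - 1 := by exact_mod_cast du
          exact_mod_cast (by omega)
  have hg := h (EuclideanDomain.gcd P Q) (EuclideanDomain.gcd_dvd_left _ _) (EuclideanDomain.gcd_dvd_right _ _)
  obtain ⟨P', hP'⟩ := EuclideanDomain.gcd_dvd_left P Q
  obtain ⟨Q', hQ'⟩ := EuclideanDomain.gcd_dvd_right P Q
  set g := EuclideanDomain.gcd P Q with hgdef
  have hg0 : g ≠ 0 := by rintro h0; rw [h0, zero_mul] at hP'; exact hP0 hP'
  have hcop : IsCoprime P' Q' := by
    have h1 := EuclideanDomain.gcd_eq_gcd_ab P Q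
    rw [← hgdef] at h1
    refine ⟨EuclideanDomain.gcdA P Q, EuclideanDomain.gcdB P Q, ?_⟩
    apply mul_left_cancel₀ hg0
    linear_combination (-1 : K[X]) * h1 - EuclideanDomain.gcdA P Q * hP' - EuclideanDomain.gcdB P Q * hQ'
  have hP'0 : P' ≠ 0 := by rintro rfl; rw [mul_zero] at hP'; exact hP0 hP'
  have hdvd : P' ∣ w := by
    apply hcop.dvd_of_dvd_mul_right
    refine ⟨-u, ?_⟩
    apply mul_left_cancel₀ hg0
    linear_combination hz - w * hQ' - u * hP'
  have hw0 : w = 0 := by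
    by_contra hw0
    have := Polynomial.degree_le_of_dvd hdvd hw0
    have h3 : P.natDegree = g.natDegree + P'.natDegree := by rw [hP', Polynomial.natDegree_mul hg0 hP'0]
    have h4 := this.trans_lt dw
    rw [Polynomial.degree_eq_natDegree hP'0] at h4
    have : P'.natDegree < 2 := by exact_mod_cast h4
    omega
  have hu0 : u = 0 := by
    rw [hw0, zero_mul, zero_add] at hz
    exact (mul_eq_zero.1 hz).resolve_right hP0
  ext c
  rcases c with i | j
  · have := sum_coeff (fun i => x (Sum.inl i)) i
    rw [← hw, hw0] at this
    simpa using this.symm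
  · have := sum_coeff (fun i => x (Sum.inr i)) j
    rw [← hu, hu0] at this
    simpa using this.symm

theorem sum_eq_self {R : Type*} [CommRing R] {m : ℕ} {P : R[X]} (h : P.degree < m) :
    ∑ i : Fin m, Polynomial.C (P.coeff i) * Polynomial.X ^ (i : ℕ) = P := by
  ext r
  by_cases hr : r < m
  · exact sum_coeff (fun i : Fin m => P.coeff i) ⟨r, hr⟩
  · have hm : (m : WithBot ℕ) ≤ r := by exact_mod_cast (by omega)
    rw [Polynomial.coeff_eq_zero_of_degree_lt ((sum_natDegree_lt _).trans_le hm), Polynomial.coeff_eq_zero_of_degree_lt (h.trans_le hm)]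

theorem Mt_not_inj {K : Type*} [Field K] {n : ℕ} (hn : 2 ≤ n) {P Q : K[X]} (hP : P.natDegree ≤ 3) (hQ : Q.natDegree ≤ n)
    (hP0 : P ≠ 0) {x y : K} (hxy : x ≠ y) (h1 : P.IsRoot x) (h2 : P.IsRoot y) (h3 : Q.IsRoot x) (h4 : Q.IsRoot y) :
    ∃ v, v ≠ 0 ∧ (Mt n P Q).mulVec v = 0 := by
  have key : ∀ (R : K[X]) (e : ℕ), 2 ≤ e → R.natDegree ≤ e → R.IsRoot x → R.IsRoot y → ∃ R', R = (Polynomial.X - Polynomial.C x) * (Polynomial.X - Polynomial.C y) * R' ∧ R'.degree < ((e - 1 : ℕ) : WithBot ℕ) := by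
    intro R e he hR hx hy
    have hc : IsCoprime (Polynomial.X - Polynomial.C x) (Polynomial.X - Polynomial.C y) :=
      Polynomial.isCoprime_X_sub_C_of_isUnit_sub (IsUnit.mk0 _ (sub_ne_zero.2 hxy))
    obtain ⟨R', hR'⟩ := hc.mul_dvd (Polynomial.dvd_iff_isRoot.2 hx) (Polynomial.dvd_iff_isRoot.2 hy)
    refine ⟨R', hR', ?_⟩
    by_cases h0 : R' = 0
    · rw [h0, Polynomial.degree_zero]; exact WithBot.bot_lt_coe _
    · rw [hR', Polynomial.natDegree_mul (mul_ne_zero (Polynomial.X_sub_C_ne_zero _) (Polynomial.X_sub_C_ne_zero _)) h0,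
        Polynomial.natDegree_mul (Polynomial.X_sub_C_ne_zero _) (Polynomial.X_sub_C_ne_zero _)] at hR
      simp only [Polynomial.natDegree_X_sub_C] at hR
      rw [Polynomial.degree_eq_natDegree h0]
      exact_mod_cast (by omega)
  obtain ⟨P', hP', dP⟩ := key P 3 (by norm_num) hP h1 h2
  obtain ⟨Q', hQ', dQ⟩ := key Q n hn hQ h3 h4
  have hP'0 : P' ≠ 0 := by rintro rfl; rw [mul_zero] at hP'; exact hP0 hP'
  refine ⟨Sum.elim (fun i => P'.coeff i) (fun j => (-Q').coeff j), ?_, ?_⟩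
  · intro h
    apply hP'0
    rw [← sum_eq_self dP]
    refine Finset.sum_eq_zero fun i _ => ?_
    have := congrFun h (Sum.inl i)
    simp only [Sum.elim_inl, Pi.zero_apply] at this
    rw [this]; simp
  · ext r
    rw [Mt_mulVec]
    simp only [Sum.elim_inl, Sum.elim_inr]
    rw [sum_eq_self (m := 2) dP, sum_eq_self (by rwa [Polynomial.degree_neg])]
    conv_lhs => rw [hP', hQ']
    have : P' * ((Polynomial.X - Polynomial.C x) * (Polynomial.X - Polynomial.C y) * Q') + -Q' * ((Polynomial.X - Polynomial.C x) * (Polynomial.X - Polynomial.C y) * P') = 0 := by ring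
    rw [this]; simp

theorem semicont {K S Ω : Type*} [Field K] [CommRing S] [Field Ω] (Ψ : S →+* PowerSeries K) (ι : K →+* S)
    (hι : ∀ x, Ψ (ι x) = PowerSeries.C x) (Φ : S →+* Ω) (hΦ : Function.Injective Φ) {n p q : ℕ} {P Q : S[X]}
    {P' Q' : (PowerSeries K)[X]} (hP : P.map Ψ = Polynomial.C (PowerSeries.X ^ p) * P') (hQ : Q.map Ψ = Polynomial.C (PowerSeries.X ^ q) * Q')
    (hinj : ∀ x, (Mt n (P'.map PowerSeries.constantCoeff) (Q'.map PowerSeries.constantCoeff)).mulVec x = 0 → x = 0)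
    (v) (hv : (Mt n (P.map Φ) (Q.map Φ)).mulVec v = 0) : v = 0 := by
  classical
  set M0 := Mt n (P'.map PowerSeries.constantCoeff) (Q'.map PowerSeries.constantCoeff) with hM0
  obtain ⟨L, hL⟩ : ∃ L : Matrix (Fin 2 ⊕ Fin (n-1)) (Fin (n+2)) K, L * M0 = 1 := by
    have hk : LinearMap.ker (Matrix.toLin' M0) = ⊥ := by
      rw [LinearMap.ker_eq_bot']; intro x hx; exact hinj x hx
    obtain ⟨g, hg⟩ := LinearMap.exists_leftInverse_of_injective _ hk
    refine ⟨LinearMap.toMatrix' g, ?_⟩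
    have := congrArg LinearMap.toMatrix' hg
    rw [LinearMap.toMatrix'_comp, LinearMap.toMatrix'_toLin'] at this
    rw [this]; exact LinearMap.toMatrix'_id
  set N := L.map ι * Mt n P Q with hN
  have hdet : N.det ≠ 0 := by
    intro h0
    have h1 := congrArg Ψ h0
    rw [map_zero, RingHom.map_det, RingHom.mapMatrix_apply, hN, Matrix.map_mul, Mt_map, hP, hQ, Mt_scale, ← Matrix.mul_assoc, Matrix.det_mul,
      Matrix.det_diagonal] at h1
    rcases mul_eq_zero.1 h1 with h2 | h2
    · have h3 := congrArg PowerSeries.constantCoeff h2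
      rw [map_zero, RingHom.map_det, RingHom.mapMatrix_apply, Matrix.map_mul, Mt_map] at h3
      have h4 : ((L.map ι).map Ψ).map (PowerSeries.constantCoeff (R := K)) = L := by
        ext i j; simp [hι]
      rw [h4, hL, Matrix.det_one] at h3
      exact one_ne_zero h3
    · rw [Finset.prod_eq_zero_iff] at h2
      obtain ⟨c, _, hc⟩ := h2
      rcases c with i | j
      · exact pow_ne_zero _ PowerSeries.X_ne_zero hc
      · exact pow_ne_zero _ PowerSeries.X_ne_zero hc
  have hdet' : (N.map Φ).det ≠ 0 := by
    rw [← RingHom.mapMatrix_apply, ← RingHom.map_det]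
    exact fun h => hdet ((injective_iff_map_eq_zero Φ).1 hΦ _ h)
  apply Matrix.eq_zero_of_mulVec_eq_zero hdet'
  rw [hN, Matrix.map_mul, Mt_map, ← Matrix.mulVec_mulVec, hv, Matrix.mulVec_zero]
end Mat

variable {K : Type*} [Field K]

theorem lineP_der {σ : Type*} [Fintype σ] (u v : σ → K) (A : MvPolynomial σ K) :
    Polynomial.eval 0 (Polynomial.derivative (lineP u v A)) = ∑ i, v i * eval u (pderiv i A) := by
  classical
  have h := (lineP_eval u v · 0)
  induction A using MvPolynomial.induction_on with
  | C a => simp [lineP]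
  | add p q hp hq => simp [hp, hq, mul_add, Finset.sum_add_distrib]
  | mul_X p i hp =>
    simp only [map_mul, Polynomial.derivative_mul, Polynomial.eval_add, Polynomial.eval_mul, hp, h]
    simp only [zero_smul, add_zero, Derivation.leibniz, smul_eq_mul, map_add, map_mul, eval_X, mul_add, Finset.sum_add_distrib]
    rw [add_comm]
    congr 1
    · rw [Finset.sum_eq_single i]
      · simp [lineP]; ring
      · intro j _ hj; rw [pderiv_X_of_ne hj.symm]; simp
      · simp
    · rw [Finset.sum_mul]
      exact Finset.sum_congr rfl fun j _ => by ring

theorem sq_dvd_of_roots [IsAlgClosed K] {g : Polynomial K} (h2 : 2 ≤ g.natDegree) (h : ∀ t, g.IsRoot t → t = 0) :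
    Polynomial.X ^ 2 ∣ g := by
  have st : ∀ f : Polynomial K, 1 ≤ f.natDegree → (∀ t, f.IsRoot t → t = 0) → ∃ f', f = Polynomial.X * f' ∧ f.natDegree = f'.natDegree + 1 := by
    intro f hf hr
    have hd0 : f.degree ≠ 0 := fun h => by
      have : f.natDegree = 0 := Polynomial.natDegree_eq_of_degree_eq_some h
      omega
    obtain ⟨t, ht⟩ := IsAlgClosed.exists_root f hd0
    obtain rfl := hr t ht
    obtain ⟨f', hf'⟩ := Polynomial.dvd_iff_isRoot.2 ht
    rw [Polynomial.C_0, sub_zero] at hf'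
    refine ⟨f', hf', ?_⟩
    rw [hf', Polynomial.natDegree_X_mul]
    rintro rfl; simp [hf'] at hf
  obtain ⟨g1, e1, d1⟩ := st g (by omega) h
  obtain ⟨g2, e2, d2⟩ := st g1 (by omega) (fun t ht => h t (by rw [e1]; simp [Polynomial.IsRoot] at *; simp [ht]))
  exact ⟨g2, by rw [e1, e2]; ring⟩

theorem lin_cond {G : MvPolynomial (Fin 3) K} [CharZero K] {e : ℕ} (hG : G.IsHomogeneous e) {p : Fin 3 → K} (hp : p 0 = 1)
    (h : ∃ i, eval p (pderiv i G) ≠ 0) : ∃ α β : K, (α ≠ 0 ∨ β ≠ 0) ∧ ∀ s, Polynomial.X ^ 2 ∣ lineP p ![0,1,s] G → α + s * β = 0 := by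
  by_cases h0 : eval p G = 0
  · refine ⟨eval p (pderiv 1 G), eval p (pderiv 2 G), ?_, fun s hs => ?_⟩
    · by_contra hc
      push Not at hc
      obtain ⟨c1, c2⟩ := hc
      have hE := euler_eval hG p
      simp only [Fin.sum_univ_three, hp, c1, c2, h0] at hE
      obtain ⟨i, hi⟩ := h
      apply hi
      fin_cases i
      · simpa using hE
      · exact c1
      · exact c2
    · have h1 := lineP_der p ![0,1,s] G
      obtain ⟨q, hq⟩ := hs
      rw [hq] at h1
      simp [Fin.sum_univ_three, Polynomial.derivative_mul] at h1
      exact h1.symm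
  · refine ⟨1, 0, by simp, fun s hs => ?_⟩
    exfalso
    apply h0
    obtain ⟨q, hq⟩ := hs
    have := lineP_eval p ![0,1,s] G 0
    rw [hq] at this
    simpa using this.symm

theorem elim3 {A B : MvPolynomial (Fin 3) K} (hA : Irreducible A) (hAB : ¬ A ∣ B) (p : Fin 3 → K) (hp : p 0 = 1) :
    ∃ r : MvPolynomial (Fin 2) K, r ≠ 0 ∧ ∀ q x y : K, eval (q • p + ![0,x,y]) A = 0 → eval (q • p + ![0,x,y]) B = 0 → eval ![x,y] r = 0 := by
  let τ : MvPolynomial (Fin 3) K →ₐ[K] MvPolynomial (Fin 3) K := aeval ![X 0, X 1 + C (p 1) * X 0, X 2 + C (p 2) * X 0]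
  let τ' : MvPolynomial (Fin 3) K →ₐ[K] MvPolynomial (Fin 3) K := aeval ![X 0, X 1 - C (p 1) * X 0, X 2 - C (p 2) * X 0]
  let T : MvPolynomial (Fin 3) K ≃ₐ[K] MvPolynomial (Fin 3) K := AlgEquiv.ofAlgHom τ τ'
    (by ext1 i; fin_cases i <;> simp [τ, τ']) (by ext1 i; fin_cases i <;> simp [τ, τ'])
  let T' := T.trans (finSuccEquiv K 2)
  obtain ⟨U, V, r, hr, h⟩ := elim_lemma (A := T' A) (B := T' B) ((MulEquiv.irreducible_iff T'.toMulEquiv).2 hA) (by rwa [map_dvd_iff])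
  refine ⟨r, hr, fun q x y ha hb => ?_⟩
  have e1 : finSuccEquiv K 2 (X 1) = Polynomial.C (X 0) := finSuccEquiv_X_succ (j := 0)
  have e2 : finSuccEquiv K 2 (X 2) = Polynomial.C (X 1) := finSuccEquiv_X_succ (j := 1)
  have e3 : ∀ c : K, finSuccEquiv K 2 (C c) = Polynomial.C (C c) := fun c => by simp [finSuccEquiv_apply]
  have t0 : T' (X 0) = Polynomial.X := by simp [T', T, τ, finSuccEquiv_X_zero]
  have t1 : T' (X 1) = Polynomial.C (X 0) + Polynomial.C (C (p 1)) * Polynomial.X := by simp [T', T, τ, finSuccEquiv_X_zero, e1, e3]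
  have t2 : T' (X 2) = Polynomial.C (X 1) + Polynomial.C (C (p 2)) * Polynomial.X := by simp [T', T, τ, finSuccEquiv_X_zero, e2, e3]
  have tc : ∀ c : K, T' (C c) = Polynomial.C (C c) := fun c => by simp [T', T, τ, e3]
  clear_value T'
  have hev : ∀ G, Polynomial.eval q (Polynomial.map (eval ![x,y]) (T' G)) = eval (q • p + ![0,x,y]) G := by
    intro G
    induction G using MvPolynomial.induction_on with
    | C a => simp [tc]
    | add f g hf hg => simp only [map_add, Polynomial.map_add, Polynomial.eval_add, hf, hg]
    | mul_X f i hf =>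
      rw [map_mul, Polynomial.map_mul, Polynomial.eval_mul, hf, map_mul]
      refine congrArg (_ * ·) ?_
      fin_cases i
      · show Polynomial.eval q (Polynomial.map _ (T' (X 0))) = eval _ (X 0)
        rw [eval_X, Pi.add_apply, Pi.smul_apply, hp]; simp [t0]
      · show Polynomial.eval q (Polynomial.map _ (T' (X 1))) = eval _ (X 1)
        rw [eval_X, Pi.add_apply, Pi.smul_apply]; simp [t1]; ring
      · show Polynomial.eval q (Polynomial.map _ (T' (X 2))) = eval _ (X 2)
        rw [eval_X, Pi.add_apply, Pi.smul_apply]; simp [t2]; ring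
  have h2 := congrArg (fun z => Polynomial.eval q (Polynomial.map (eval ![x,y]) z)) h
  simp only [Polynomial.map_add, Polynomial.map_mul, Polynomial.eval_add, Polynomial.eval_mul, hev, ha, hb, Polynomial.map_C, Polynomial.eval_C, mul_zero, add_zero] at h2
  exact h2.symm

theorem choose_s [IsAlgClosed K] [CharZero K] {A B : MvPolynomial (Fin 3) K} {n : ℕ} (hA : A.IsHomogeneous 3) (hB : B.IsHomogeneous n)
    (hirr : Irreducible A) (hAB : ¬ A ∣ B) (nA : NL A) (nB : NL B) (p : Fin 3 → K) (hp : p 0 = 1)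
    (hns : (∃ i, eval p (pderiv i A) ≠ 0) ∨ (∃ i, eval p (pderiv i B) ≠ 0)) :
    ∃ s : K, (lineP p ![0,1,s] A).natDegree = 3 ∧ (lineP p ![0,1,s] B).natDegree = n ∧ lineP p ![0,1,s] B ≠ 0 ∧
      ∀ g, g ∣ lineP p ![0,1,s] A → g ∣ lineP p ![0,1,s] B → g.natDegree ≤ 1 := by
  have hinf : Infinite K := IsAlgClosed.instInfinite
  obtain ⟨α, β, hαβ, hlin⟩ : ∃ α β : K, (α ≠ 0 ∨ β ≠ 0) ∧ ∀ s, Polynomial.X ^ 2 ∣ lineP p ![0,1,s] A → Polynomial.X ^ 2 ∣ lineP p ![0,1,s] B → α + s * β = 0 := by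
    rcases hns with h | h
    · obtain ⟨α, β, h1, h2⟩ := lin_cond hA hp h
      exact ⟨α, β, h1, fun s h _ => h2 s h⟩
    · obtain ⟨α, β, h1, h2⟩ := lin_cond hB hp h
      exact ⟨α, β, h1, fun s _ h => h2 s h⟩
  obtain ⟨r, hr, hr2⟩ := elim3 hirr hAB p hp
  let rr : MvPolynomial (Fin 3) K → MvPolynomial (Fin 2) K := fun G => aeval ![0, X 0, X 1] G
  have rre : ∀ G (y : Fin 2 → K), eval y (rr G) = eval ![0, y 0, y 1] G := by
    intro G y
    induction G using MvPolynomial.induction_on with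
    | C a => simp [rr]
    | add f g hf hg => simp only [rr, map_add] at *; rw [hf, hg]
    | mul_X f i hf => simp only [rr, map_mul] at *; rw [hf]; congr 1; fin_cases i <;> simp
  have hne : ∀ G, NL G → rr G ≠ 0 := by
    intro G hG h0
    obtain ⟨s, t, hst⟩ := hG ![0,1,0] ![0,0,1] (fun s t h => ⟨by simpa using congrFun h 1, by simpa using congrFun h 2⟩)
    apply hst
    have := rre G ![s,t]
    rw [h0, map_zero] at this
    have e : s • ![0,1,0] + t • ![0,0,1] = ![0, (![s,t] : Fin 2 → K) 0, (![s,t] : Fin 2 → K) 1] := by ext i; fin_cases i <;> simp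
    rw [e, ← this]
  have hl0 : (C α * X 0 + C β * X 1 : MvPolynomial (Fin 2) K) ≠ 0 := by
    intro h0
    rcases hαβ with h | h
    · apply h; simpa using congrArg (eval ![1,0]) h0
    · apply h; simpa using congrArg (eval ![0,1]) h0
  have hprod : r * X 0 * rr A * rr B * (C α * X 0 + C β * X 1) ≠ 0 :=
    mul_ne_zero (mul_ne_zero (mul_ne_zero (mul_ne_zero hr (X_ne_zero _)) (hne A nA)) (hne B nB)) hl0
  obtain ⟨y, hy⟩ : ∃ y, eval y (r * X 0 * rr A * rr B * (C α * X 0 + C β * X 1)) ≠ 0 := by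
    by_contra hc
    push Not at hc
    exact hprod (MvPolynomial.funext fun y => by rw [hc, map_zero])
  simp only [map_mul, map_add, eval_X, eval_C, rre, mul_ne_zero_iff] at hy
  obtain ⟨⟨⟨⟨y1, y2⟩, y3⟩, y4⟩, y5⟩ := hy
  have hsm : ![0, y 0, y 1] = y 0 • ![0, 1, y 1 / y 0] := by
    ext i; fin_cases i <;> simp; field_simp
  have top : ∀ (G : MvPolynomial (Fin 3) K) e, G.IsHomogeneous e → eval ![0, y 0, y 1] G ≠ 0 → (lineP p ![0,1,y 1 / y 0] G).natDegree = e ∧ lineP p ![0,1,y 1 / y 0] G ≠ 0 := by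
    intro G e hG hne
    have ⟨h1, h2⟩ := lineP_top p ![0,1,y 1 / y 0] hG
    rw [hsm, eval_smul_hom hG, mul_ne_zero_iff] at hne
    have h3 : (lineP p ![0,1,y 1 / y 0] G).coeff e ≠ 0 := by rw [h2]; exact hne.2
    exact ⟨le_antisymm h1 (Polynomial.le_natDegree_of_ne_zero h3), fun h => h3 (by rw [h, Polynomial.coeff_zero])⟩
  refine ⟨y 1 / y 0, (top A 3 hA y3).1, (top B n hB y4).1, (top B n hB y4).2, fun g gA gB => ?_⟩
  by_contra hg
  have hX := sq_dvd_of_roots (g := g) (by omega) (fun t ht => by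
    by_contra t0
    apply y1
    have hv : ∀ (G : MvPolynomial (Fin 3) K) e, G.IsHomogeneous e → g ∣ lineP p ![0,1,y 1 / y 0] G → eval ((y 0 / t) • p + ![0, y 0, y 1]) G = 0 := by
      intro G e hG hd
      have h1 := Polynomial.IsRoot.dvd ht hd
      rw [Polynomial.IsRoot, lineP_eval] at h1
      have h2 := eval_smul_hom hG (y 0 / t) (p + t • ![0,1,y 1 / y 0])
      rw [h1, mul_zero, smul_add, smul_smul, div_mul_cancel₀ _ t0, ← hsm] at h2
      exact h2
    have := hr2 (y 0 / t) (y 0) (y 1) (hv A 3 hA gA) (hv B n hB gB)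
    have e : y = ![y 0, y 1] := by ext i; fin_cases i <;> rfl
    rw [e]; exact this)
  have := hlin (y 1 / y 0) (hX.trans gA) (hX.trans gB)
  apply y5
  field_simp at this
  linear_combination this

open scoped TensorProduct

theorem eval₂_mul_hom {σ R S : Type*} [CommRing R] [CommRing S] (f : R →+* S) (c : S) (w : σ → S) {A : MvPolynomial σ R} {e : ℕ}
    (hA : A.IsHomogeneous e) : eval₂ f (fun i => c * w i) A = c ^ e * eval₂ f w A := by
  rw [eval₂_eq, eval₂_eq, Finset.mul_sum]
  refine Finset.sum_congr rfl fun d hd => ?_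
  simp only [mul_pow, Finset.prod_mul_distrib]
  rw [Finset.prod_pow_eq_pow_sum]
  have : ∑ i ∈ d.support, d i = e := by
    have := hA (mem_support_iff.1 hd)
    rw [Finsupp.weight_apply] at this
    simpa [Finsupp.sum] using this
  rw [this]; ring

/-- coordinates of the generic line -/
noncomputable def vL {S : Type*} [CommRing S] (c a b : S) : Fin 3 → Polynomial S :=
  ![Polynomial.C b, Polynomial.C b * Polynomial.X, -(Polynomial.C a * Polynomial.X + Polynomial.C c)]

theorem vL_map {S S' : Type*} [CommRing S] [CommRing S'] (Ψ : S →+* S') (c a b : S) :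
    (fun i => (vL c a b i).map Ψ) = vL (Ψ c) (Ψ a) (Ψ b) := by
  ext1 i; fin_cases i <;> simp [vL]

theorem vL_mul {S : Type*} [CommRing S] (q c a b : S) :
    vL (q * c) (q * a) (q * b) = fun i => Polynomial.C q * vL c a b i := by
  ext1 i; fin_cases i <;> simp [vL] <;> ring

/-- restriction to the line -/
noncomputable def rL {K S : Type*} [CommRing K] [CommRing S] (φ : K →+* S) (w : Fin 3 → Polynomial S) (A : MvPolynomial (Fin 3) K) : Polynomial S :=
  eval₂ (Polynomial.C.comp φ) w A

theorem rL_map {K S S' : Type*} [CommRing K] [CommRing S] [CommRing S'] (φ : K →+* S) (w : Fin 3 → Polynomial S) (A : MvPolynomial (Fin 3) K)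
    (Ψ : S →+* S') : (rL φ w A).map Ψ = rL (Ψ.comp φ) (fun i => (w i).map Ψ) A := by
  have := eval₂_comp_left (Polynomial.mapRingHom Ψ) (Polynomial.C.comp φ) w A
  rw [rL, rL, ← Polynomial.coe_mapRingHom, this]
  congr 1
  ext1 x; simp

theorem rL_mul {K S : Type*} [CommRing K] [CommRing S] (φ : K →+* S) (q : S) (w : Fin 3 → Polynomial S) {A : MvPolynomial (Fin 3) K} {e : ℕ}
    (hA : A.IsHomogeneous e) : rL φ (fun i => Polynomial.C q * w i) A = Polynomial.C (q ^ e) * rL φ w A := by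
  rw [rL, eval₂_mul_hom _ _ _ hA, Polynomial.C_pow]; rfl

theorem rL_line {K : Type*} [Field K] (p v : Fin 3 → K) (c : K) {A : MvPolynomial (Fin 3) K} {e : ℕ} (hA : A.IsHomogeneous e)
    (w : Fin 3 → Polynomial K) (hw : ∀ i, w i = -(Polynomial.C (p i) + Polynomial.C (v i) * (Polynomial.X + Polynomial.C c))) :
    rL (RingHom.id K) w A = Polynomial.C ((-1) ^ e) * (lineP p v A).comp (Polynomial.X + Polynomial.C c) := by
  have h1 : w = fun i => Polynomial.C (-1) * (Polynomial.C (p i) + Polynomial.C (v i) * (Polynomial.X + Polynomial.C c)) := by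
    ext1 i; rw [hw]; simp
  rw [h1, rL_mul _ _ _ hA]
  congr 1
  have := eval₂_comp_left (Polynomial.compRingHom (Polynomial.X + Polynomial.C c)) (Polynomial.C : K →+* Polynomial K) (fun i => Polynomial.C (p i) + Polynomial.C (v i) * Polynomial.X) A
  rw [Polynomial.coe_compRingHom_apply] at this
  rw [lineP, aeval_def, Polynomial.algebraMap_eq, this, rL]
  congr 1
  · ext1 x; simp
  · ext1 i; simp

section
variable {k K : Type*} [Field k] [Field K] [Algebra k K]

theorem claim [IsAlgClosed k] [CharZero k] [CharZero K] [IsAlgClosed K] {c a b : K} {F : MvPolynomial (Fin 4) k} {d n : ℕ} (hd : d ≠ 0) (hn : 2 ≤ n)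
    (hF : F.IsHomogeneous d) (hirr : Irreducible F) {A B : MvPolynomial (Fin 3) K}
    (hA : A.IsHomogeneous 3) (hB : B.IsHomogeneous n) (hAB : rst c a b F = A * B) (hNL : NL (A * B)) (hndvd : ¬ A ∣ B)
    (hnp : ∀ u0 u1 u2 : k, c ≠ algebraMap k K u0 + algebraMap k K u1 * a + algebraMap k K u2 * b)
    {D₁ D₂ : Derivation k K K} (d1a : D₁ a = 1) (d1b : D₁ b = 0) (d2a : D₂ a = 0) (d2b : D₂ b = 1)
    (hD : ∀ D : Derivation k K K, D = D a • D₁ + D b • D₂)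
    {Ω : Type*} [Field Ω] [Algebra k Ω] (ψ ψ' : K →ₐ[k] Ω) (hinj : Function.Injective (Algebra.TensorProduct.productMap ψ ψ'))
    {x y : Ω} (hxy : x ≠ y)
    (hP0 : rL (ψ : K →+* Ω) (vL (ψ' c - ψ c) (ψ' a - ψ a) (ψ' b - ψ b)) A ≠ 0)
    (hPn : (rL (ψ : K →+* Ω) (vL (ψ' c - ψ c) (ψ' a - ψ a) (ψ' b - ψ b)) A).natDegree ≤ 3)
    (hQn : (rL (ψ' : K →+* Ω) (vL (ψ' c - ψ c) (ψ' a - ψ a) (ψ' b - ψ b)) B).natDegree ≤ n)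
    (h1 : (rL (ψ : K →+* Ω) (vL (ψ' c - ψ c) (ψ' a - ψ a) (ψ' b - ψ b)) A).IsRoot x)
    (h2 : (rL (ψ : K →+* Ω) (vL (ψ' c - ψ c) (ψ' a - ψ a) (ψ' b - ψ b)) A).IsRoot y)
    (h3 : (rL (ψ' : K →+* Ω) (vL (ψ' c - ψ c) (ψ' a - ψ a) (ψ' b - ψ b)) B).IsRoot x)
    (h4 : (rL (ψ' : K →+* Ω) (vL (ψ' c - ψ c) (ψ' a - ψ a) (ψ' b - ψ b)) B).IsRoot y) : False := by
  obtain ⟨v, v0, hv⟩ := Mt_not_inj hn hPn hQn hP0 hxy h1 h2 h3 h4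
  apply v0
  have nA := hNL.left
  have nB := hNL.right
  obtain ⟨s, sA, sB, sB0, sg⟩ := choose_s hA hB (nA.irr hA) hndvd nA nB ![1, -D₁ c, -D₂ c] (by simp) (by
    by_contra hc
    push Not at hc
    exact notboth hd (by omega) hF hirr hA hB hAB nA nB.ne_zero hnp d1a d1b d2a d2b hD hc.1 hc.2)
  let D := s • D₁ - D₂
  have Da : D a = s := by simp [D, d1a, d2a]
  have Db : D b = -1 := by simp [D, d1b, d2b]
  have Dc : D c = s * D₁ c - D₂ c := by simp [D]
  let Ck : K →ₐ[k] PowerSeries K := { (PowerSeries.C : K →+* PowerSeries K) with commutes' := fun r => by rw [IsScalarTower.algebraMap_apply k K (PowerSeries K)]; rfl }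
  let Ψ : K ⊗[k] K →ₐ[k] PowerSeries K := Algebra.TensorProduct.productMap Ck (expA D)
  let i1 : K →ₐ[k] K ⊗[k] K := Algebra.TensorProduct.includeLeft
  let i2 : K →ₐ[k] K ⊗[k] K := Algebra.TensorProduct.includeRight
  have Ψ1 : ∀ x, Ψ (i1 x) = PowerSeries.C x := fun x => by simp [Ψ, i1]; rfl
  have Ψ2 : ∀ x, Ψ (i2 x) = expA D x := fun x => by simp [Ψ, i2]
  let Φ := Algebra.TensorProduct.productMap ψ ψ'
  have Φ1 : ∀ x, Φ (i1 x) = ψ x := fun x => by simp [Φ, i1]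
  have Φ2 : ∀ x, Φ (i2 x) = ψ' x := fun x => by simp [Φ, i2]
  obtain ⟨ηa, ha, ha'⟩ := expA_delta D a
  obtain ⟨ηb, hb, hb'⟩ := expA_delta D b
  obtain ⟨ηc, hc, hc'⟩ := expA_delta D c
  let vS := vL (i2 c - i1 c) (i2 a - i1 a) (i2 b - i1 b)
  have hvΨ : (fun i => (vS i).map (Ψ : K ⊗[k] K →+* PowerSeries K)) = fun i => Polynomial.C PowerSeries.X * vL ηc ηa ηb i := by
    rw [vL_map, ← vL_mul]
    simp only [RingHom.coe_coe, map_sub, Ψ1, Ψ2, ha', hb', hc']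
  have hvΦ : (fun i => (vS i).map (Φ : K ⊗[k] K →+* Ω)) = vL (ψ' c - ψ c) (ψ' a - ψ a) (ψ' b - ψ b) := by
    rw [vL_map]
    simp only [RingHom.coe_coe, map_sub, Φ1, Φ2]
  have hP : (rL (i1 : K →+* K ⊗[k] K) vS A).map (Ψ : K ⊗[k] K →+* PowerSeries K) = Polynomial.C (PowerSeries.X ^ 3) * rL PowerSeries.C (vL ηc ηa ηb) A := by
    rw [rL_map, hvΨ, rL_mul _ _ _ hA]
    congr 2
    exact RingHom.ext Ψ1
  have hQ : (rL (i2 : K →+* K ⊗[k] K) vS B).map (Ψ : K ⊗[k] K →+* PowerSeries K) = Polynomial.C (PowerSeries.X ^ n) * rL (expA D : K →+* PowerSeries K) (vL ηc ηa ηb) B := by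
    rw [rL_map, hvΨ, rL_mul _ _ _ hB]
    congr 2
    exact RingHom.ext Ψ2
  have hw0 : ∀ i, vL (D c) (D a) (D b) i = -(Polynomial.C ((![1, -D₁ c, -D₂ c] : Fin 3 → K) i) + Polynomial.C ((![0,1,s] : Fin 3 → K) i) * (Polynomial.X + Polynomial.C (D₁ c))) := by
    intro i
    rw [Da, Db, Dc]
    fin_cases i <;> simp [vL] <;> ring
  have hP'0 : (rL PowerSeries.C (vL ηc ηa ηb) A).map PowerSeries.constantCoeff = Polynomial.C ((-1) ^ 3) * (lineP ![1, -D₁ c, -D₂ c] ![0,1,s] A).comp (Polynomial.X + Polynomial.C (D₁ c)) := by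
    rw [rL_map, vL_map, hc, ha, hb, ← rL_line _ _ _ hA _ hw0]
    congr 1
  have hQ'0 : (rL (expA D : K →+* PowerSeries K) (vL ηc ηa ηb) B).map PowerSeries.constantCoeff = Polynomial.C ((-1) ^ n) * (lineP ![1, -D₁ c, -D₂ c] ![0,1,s] B).comp (Polynomial.X + Polynomial.C (D₁ c)) := by
    rw [rL_map, vL_map, hc, ha, hb, ← rL_line _ _ _ hB _ hw0]
    congr 1
    ext x
    have := expF_zero D x
    rw [PowerSeries.coeff_zero_eq_constantCoeff] at this
    exact this
  have hu : ∀ e : ℕ, ((-1 : K) ^ e) ≠ 0 := fun e => pow_ne_zero _ (by simp)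
  refine semicont (Ψ : K ⊗[k] K →+* PowerSeries K) (i1 : K →+* K ⊗[k] K) Ψ1 (Φ : K ⊗[k] K →+* Ω) hinj hP hQ ?_ v ?_
  · rw [hP'0, hQ'0]
    have hnat : ∀ G : Polynomial K, (G.comp (Polynomial.X + Polynomial.C (D₁ c))).natDegree = G.natDegree := by
      intro G; rw [Polynomial.natDegree_comp, Polynomial.natDegree_X_add_C, mul_one]
    have hcc : ∀ G : Polynomial K, (G.comp (Polynomial.X + Polynomial.C (D₁ c))).comp (Polynomial.X - Polynomial.C (D₁ c)) = G := by
      intro G; rw [Polynomial.comp_assoc]; simp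
    refine Mt_inj ?_ ?_ (by omega) ?_ ?_
    · rw [Polynomial.natDegree_C_mul (hu 3), hnat, sA]
    · rw [Polynomial.natDegree_C_mul (hu n), hnat, sB]
    · refine mul_ne_zero (by simpa using hu n) fun h => sB0 ?_
      rw [← hcc (lineP _ _ B), h, Polynomial.zero_comp]
    · intro g gA gB
      have := sg (g.comp (Polynomial.X - Polynomial.C (D₁ c))) ?_ ?_
      · rwa [Polynomial.natDegree_comp, Polynomial.natDegree_X_sub_C, mul_one] at this
      · rw [Polynomial.dvd_C_mul (hu 3)] at gA
        have := map_dvd (Polynomial.compRingHom (Polynomial.X - Polynomial.C (D₁ c))) gA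
        rwa [Polynomial.coe_compRingHom_apply, Polynomial.coe_compRingHom_apply, hcc] at this
      · rw [Polynomial.dvd_C_mul (hu n)] at gB
        have := map_dvd (Polynomial.compRingHom (Polynomial.X - Polynomial.C (D₁ c))) gB
        rwa [Polynomial.coe_compRingHom_apply, Polynomial.coe_compRingHom_apply, hcc] at this
  · rw [rL_map, rL_map, hvΦ]
    have e1 : ((Φ : K ⊗[k] K →+* Ω).comp (i1 : K →+* K ⊗[k] K)) = (ψ : K →+* Ω) := RingHom.ext Φ1
    have e2 : ((Φ : K ⊗[k] K →+* Ω).comp (i2 : K →+* K ⊗[k] K)) = (ψ' : K →+* Ω) := RingHom.ext Φ2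
    rw [e1, e2, hv]
end

section
variable {k : Type*} [Field k]

theorem homog_exists (g : MvPolynomial (Fin 3) k) : ∃ (N : ℕ) (G : MvPolynomial (Fin 4) k), ∀ x0 x1 x2 x3 : k,
    x0 ≠ 0 → eval ![x0, x1, x2, x3] G = x0 ^ N * eval ![x1 / x0, x2 / x0, x3 / x0] g := by
  induction g using MvPolynomial.induction_on with
  | C a => exact ⟨0, C a, by simp⟩
  | add p q hp hq =>
    obtain ⟨N, P, hP⟩ := hp
    obtain ⟨M, Q, hQ⟩ := hq
    refine ⟨N + M, X 0 ^ M * P + X 0 ^ N * Q, fun x0 x1 x2 x3 h => ?_⟩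
    simp only [map_add, map_mul, map_pow, hP _ _ _ _ h, hQ _ _ _ _ h]
    simp; ring
  | mul_X p i hp =>
    obtain ⟨N, P, hP⟩ := hp
    refine ⟨N + 1, P * X i.succ, fun x0 x1 x2 x3 h => ?_⟩
    simp only [map_mul, hP _ _ _ _ h]
    fin_cases i <;> simp [eval_X] <;> field_simp <;> ring

/-- dehomogenization -/
noncomputable def dh : MvPolynomial (Fin 4) k →ₐ[k] MvPolynomial (Fin 3) k := aeval ![1, X 0, X 1, X 2]

theorem dh_eval (x : Fin 3 → k) (G : MvPolynomial (Fin 4) k) : eval x (dh G) = eval ![1, x 0, x 1, x 2] G := by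
  induction G using MvPolynomial.induction_on with
  | C a => simp [dh]
  | add p q hp hq => simp [hp, hq]
  | mul_X p i hp => simp only [map_mul, hp]; congr 1; fin_cases i <;> simp [dh]

theorem eq_of_eval [Infinite k] {P Q : MvPolynomial (Fin 4) k} (h : ∀ x0 x1 x2 x3 : k, x0 ≠ 0 → eval ![x0,x1,x2,x3] P = eval ![x0,x1,x2,x3] Q) : P = Q := by
  have : X 0 * P = X 0 * Q := by
    apply MvPolynomial.funext
    intro x
    have e : x = ![x 0, x 1, x 2, x 3] := by ext i; fin_cases i <;> rfl
    by_cases h0 : x 0 = 0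
    · simp [h0]
    · rw [map_mul, map_mul, e, h _ _ _ _ h0]
  exact mul_left_cancel₀ (X_ne_zero _) this

theorem dh_irr [Infinite k] {F : MvPolynomial (Fin 4) k} {d : ℕ} (hd : 2 ≤ d) (hF : F.IsHomogeneous d) (hirr : Irreducible F) :
    ¬ F ∣ X 0 ∧ Irreducible (dh F) := by
  have hX : ¬ F ∣ X 0 := by
    intro h
    have h1 := totalDegree_le_of_dvd_of_isDomain h (X_ne_zero _)
    rw [hF.totalDegree hirr.ne_zero, totalDegree_X] at h1
    omega
  have hXn : ∀ n, ¬ F ∣ X 0 ^ n := fun n h => hX (hirr.prime.dvd_of_dvd_pow h)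
  have hFe : ∀ x0 x1 x2 x3 : k, x0 ≠ 0 → eval ![x0, x1, x2, x3] F = x0 ^ d * eval ![x1 / x0, x2 / x0, x3 / x0] (dh F) := by
    intro x0 x1 x2 x3 h
    rw [dh_eval, ← eval_smul_hom hF]
    congr 2
    ext i; fin_cases i <;> simp <;> field_simp
  have hdh : ∀ {g N G}, (∀ x0 x1 x2 x3 : k, x0 ≠ 0 → eval ![x0, x1, x2, x3] G = x0 ^ N * eval ![x1 / x0, x2 / x0, x3 / x0] g) → dh G = g := by
    intro g N G h
    apply MvPolynomial.funext
    intro x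
    rw [dh_eval, h 1 _ _ _ one_ne_zero]
    simp only [one_pow, one_mul, div_one]
    congr 2
    ext i; fin_cases i <;> rfl
  refine ⟨hX, ⟨fun hu => ?_, fun g h hgh => ?_⟩⟩
  · obtain ⟨w, hw⟩ := hu.exists_right_inv
    obtain ⟨N, W, hW⟩ := homog_exists w
    apply hXn (d + N)
    refine ⟨W, (eq_of_eval fun x0 x1 x2 x3 h0 => ?_)⟩
    rw [map_mul, hFe _ _ _ _ h0, hW _ _ _ _ h0]
    have := congrArg (eval ![x1 / x0, x2 / x0, x3 / x0]) hw
    rw [map_mul, map_one] at this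
    simp only [pow_add, map_mul, map_pow, eval_X, Matrix.cons_val_zero]
    linear_combination (- x0 ^ d * x0 ^ N) * this
  · obtain ⟨N, G, hG⟩ := homog_exists g
    obtain ⟨M, H, hH⟩ := homog_exists h
    have key : X 0 ^ (N + M) * F = X 0 ^ d * (G * H) := by
      apply eq_of_eval
      intro x0 x1 x2 x3 h0
      have := congrArg (eval ![x1 / x0, x2 / x0, x3 / x0]) hgh
      rw [map_mul] at this
      simp only [map_mul, hG _ _ _ _ h0, hH _ _ _ _ h0, hFe _ _ _ _ h0, this]
      simp [pow_add]; ring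
    have hne : dh F ≠ 0 := by
      intro h0
      apply hirr.ne_zero
      apply eq_of_eval
      intro x0 x1 x2 x3 hx
      rw [hFe _ _ _ _ hx, h0]; simp
    have hdv : F ∣ X 0 ^ d * (G * H) := key ▸ Dvd.intro_left _ rfl
    rcases (hirr.prime.dvd_or_dvd hdv) with h1 | h1
    · exact absurd h1 (hXn d)
    · rcases hirr.prime.dvd_or_dvd h1 with ⟨u, hu⟩ | ⟨u, hu⟩
      · right
        have h2 : dh F * dh u = g := by rw [← map_mul, ← hu, hdh hG]
        have h3 : dh F * (h * dh u) = dh F * 1 := by linear_combination h * h2 - hgh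
        exact IsUnit.of_mul_eq_one _ (mul_left_cancel₀ hne h3)
      · left
        have h2 : dh F * dh u = h := by rw [← map_mul, ← hu, hdh hH]
        have h3 : dh F * (g * dh u) = dh F * 1 := by linear_combination g * h2 - hgh
        exact IsUnit.of_mul_eq_one _ (mul_left_cancel₀ hne h3)

theorem rename_irr {m n : ℕ} (f : Fin m → Fin n) (hf : Function.Injective f) {p : MvPolynomial (Fin m) k} (hp : Irreducible p) :
    Irreducible (rename f p) := by
  have e := (MulEquiv.irreducible_iff (renameEquiv k (Equiv.ofInjective f hf)).toMulEquiv).2 hp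
  have h2 := (prime_rename_iff (R := k) (Set.range f)).2 e.prime
  have : rename ((↑) : Set.range f → Fin n) ((renameEquiv k (Equiv.ofInjective f hf)).toMulEquiv p) = rename f p := by
    show rename _ (rename _ p) = _
    rw [rename_rename]; rfl
  rw [this] at h2
  exact h2.irreducible

/-- the restriction of `F` to the line with parameters `v` -/
noncomputable def qL {R : Type*} [CommRing R] [Algebra k R] (v : Fin 4 → R) : MvPolynomial (Fin 4) k →ₐ[k] Polynomial R :=
  aeval ![1, Polynomial.X, Polynomial.C (v 0) * Polynomial.X + Polynomial.C (v 1), Polynomial.C (v 2) * Polynomial.X + Polynomial.C (v 3)]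

theorem qL_map {R R' : Type*} [CommRing R] [CommRing R'] [Algebra k R] [Algebra k R'] (f : R →ₐ[k] R') (v : Fin 4 → R) (F : MvPolynomial (Fin 4) k) :
    (qL v F).map (f : R →+* R') = qL (fun i => f (v i)) F := by
  induction F using MvPolynomial.induction_on with
  | C a =>
    simp only [qL, algHom_C]
    rw [IsScalarTower.algebraMap_apply k R (Polynomial R), IsScalarTower.algebraMap_apply k R' (Polynomial R')]
    simp
  | add p q hp hq => simp [hp, hq]
  | mul_X p i hp => simp only [map_mul, Polynomial.map_mul, hp]; congr 1; fin_cases i <;> simp [qL]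

theorem qX_irr [Infinite k] {F : MvPolynomial (Fin 4) k} {d : ℕ} (hd : 2 ≤ d) (hF : F.IsHomogeneous d) (hirr : Irreducible F) :
    Irreducible (qL (X : Fin 4 → MvPolynomial (Fin 4) k) F) := by
  have h1 := rename_irr (![0, 2, 4] : Fin 3 → Fin 5) (by decide) (dh_irr hd hF hirr).2
  let τ : MvPolynomial (Fin 5) k →ₐ[k] MvPolynomial (Fin 5) k := aeval ![X 0, X 1, X 2 + X 1 * X 0, X 3, X 4 + X 3 * X 0]
  let τ' : MvPolynomial (Fin 5) k →ₐ[k] MvPolynomial (Fin 5) k := aeval ![X 0, X 1, X 2 - X 1 * X 0, X 3, X 4 - X 3 * X 0]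
  let T : MvPolynomial (Fin 5) k ≃ₐ[k] MvPolynomial (Fin 5) k := AlgEquiv.ofAlgHom τ τ'
    (by ext1 i; fin_cases i <;> simp [τ, τ']) (by ext1 i; fin_cases i <;> simp [τ, τ'])
  have h2 := (MulEquiv.irreducible_iff (T.trans (finSuccEquiv k 4)).toMulEquiv).2 h1
  have e : ((T.trans (finSuccEquiv k 4)).toAlgHom.comp ((rename (![0, 2, 4] : Fin 3 → Fin 5)).comp dh)) = qL (X : Fin 4 → MvPolynomial (Fin 4) k) := by
    have e1 : finSuccEquiv k 4 (X 1) = Polynomial.C (X 0) := finSuccEquiv_X_succ (j := 0)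
    have e2 : finSuccEquiv k 4 (X 2) = Polynomial.C (X 1) := finSuccEquiv_X_succ (j := 1)
    have e3 : finSuccEquiv k 4 (X 3) = Polynomial.C (X 2) := finSuccEquiv_X_succ (j := 2)
    have e4 : finSuccEquiv k 4 (X 4) = Polynomial.C (X 3) := finSuccEquiv_X_succ (j := 3)
    ext1 i
    fin_cases i
    · simp [T, τ, dh, qL]
    · simp [T, τ, dh, qL, finSuccEquiv_X_zero]
    · simp [T, τ, dh, qL, finSuccEquiv_X_zero, e1, e2]; ring
    · simp [T, τ, dh, qL, finSuccEquiv_X_zero, e3, e4]; ring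
  rw [← e]
  exact h2
end

section
variable {k : Type*} [Field k]

theorem X0_dvd_sub (F : MvPolynomial (Fin 4) k) : X 0 ∣ F - aeval ![0, X 1, X 2, X 3] F := by
  induction F using MvPolynomial.induction_on with
  | C a => simp [MvPolynomial.algebraMap_eq]
  | add p q hp hq => rw [map_add, add_sub_add_comm]; exact dvd_add hp hq
  | mul_X p i hp =>
    rw [map_mul, aeval_X]
    have h : p * X i - aeval ![0, X 1, X 2, X 3] p * (![0, X 1, X 2, X 3] : Fin 4 → MvPolynomial (Fin 4) k) i =
      (p - aeval ![0, X 1, X 2, X 3] p) * (![0, X 1, X 2, X 3] : Fin 4 → MvPolynomial (Fin 4) k) i + p * (X i - (![0, X 1, X 2, X 3] : Fin 4 → MvPolynomial (Fin 4) k) i) := by ring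
    rw [h]
    refine dvd_add (hp.mul_right _) (Dvd.dvd.mul_left ?_ _)
    fin_cases i <;> simp

theorem eval_aeval4 {σ : Type*} (x : σ → k) (g : Fin 4 → MvPolynomial σ k) (F : MvPolynomial (Fin 4) k) :
    eval x (aeval g F) = eval (fun i => eval x (g i)) F := by
  induction F using MvPolynomial.induction_on with
  | C a => simp [MvPolynomial.algebraMap_eq]
  | add p q hp hq => simp only [map_add, hp, hq]
  | mul_X p i hp => simp only [map_mul, aeval_X, eval_X, hp]

theorem top_ne [Infinite k] {F : MvPolynomial (Fin 4) k} {d : ℕ} (hd : 2 ≤ d) (hF : F.IsHomogeneous d) (hirr : Irreducible F) :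
    (aeval ![0, 1, X 0, X 2] F : MvPolynomial (Fin 4) k) ≠ 0 := by
  intro h0
  have e0 : ∀ y z : k, eval ![0,1,y,z] F = 0 := by
    intro y z
    have h1 := congrArg (eval ![y,0,z,0]) h0
    rw [map_zero, eval_aeval4] at h1
    refine Eq.trans (congrArg (fun w => eval w F) ?_) h1
    ext i; fin_cases i <;> simp
  have e1 : (aeval ![0, X 1, X 2, X 3] F : MvPolynomial (Fin 4) k) = 0 := by
    apply mul_left_cancel₀ (X_ne_zero (1 : Fin 4))
    rw [mul_zero]
    apply MvPolynomial.funext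
    intro x
    rw [map_mul, eval_X, map_zero]
    by_cases hx : x 1 = 0
    · rw [hx, zero_mul]
    · have h2 : eval x (aeval ![0, X 1, X 2, X 3] F : MvPolynomial (Fin 4) k) = eval (x 1 • ![0, 1, x 2 / x 1, x 3 / x 1]) F := by
        rw [eval_aeval4]
        refine congrArg (fun w => eval w F) ?_
        ext i; fin_cases i <;> simp <;> field_simp
      rw [h2, eval_smul_hom hF, e0]; ring
  have h3 := X0_dvd_sub F
  rw [e1, sub_zero] at h3
  exact (dh_irr hd hF hirr).1 ((X_prime (R := k) (i := (0 : Fin 4))).irreducible.associated_of_dvd hirr h3).symm.dvd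

theorem qL_lineP {Ω : Type*} [Field Ω] [Algebra k Ω] (v : Fin 4 → Ω) (F : MvPolynomial (Fin 4) k) :
    qL v F = lineP ![1, 0, v 1, v 3] ![0, 1, v 0, v 2] (map (algebraMap k Ω) F) := by
  induction F using MvPolynomial.induction_on with
  | C a =>
    simp only [qL, lineP, algHom_C, map_C]
    rw [IsScalarTower.algebraMap_apply k Ω (Polynomial Ω)]
  | add p q hp hq => simp [hp, hq]
  | mul_X p i hp => simp only [map_mul, hp, map_X]; congr 1; fin_cases i <;> simp [qL, lineP] <;> ring

theorem trans_roots [CharZero k] {Ω : Type*} [Field Ω] [Algebra k Ω] [IsAlgClosed Ω] (v : Fin 4 → Ω) (hv : IsTranscendenceBasis k v)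
    {F : MvPolynomial (Fin 4) k} {d : ℕ} (hd : 2 ≤ d) (hF : F.IsHomogeneous d) (hirr : Irreducible F) :
    (qL v F).natDegree = d ∧ (qL v F).Separable ∧
      ∀ x y, (qL v F).IsRoot x → (qL v F).IsRoot y → ∃ σ : Ω ≃ₐ[k] Ω, (∀ i, σ (v i) = v i) ∧ σ x = y := by
  have hinf : Infinite k := inferInstance
  have hdeg : (qL v F).natDegree = d := by
    have hm : (map (algebraMap k Ω) F).IsHomogeneous d := hF.map _
    have ⟨h1, h2⟩ := lineP_top ![1, 0, v 1, v 3] ![0, 1, v 0, v 2] hm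
    rw [← qL_lineP] at h1 h2
    refine le_antisymm h1 (Polynomial.le_natDegree_of_ne_zero ?_)
    rw [h2, eval_map, ← aeval_def]
    have h3 : aeval ![0, 1, v 0, v 2] F = aeval v (aeval ![0, 1, X 0, X 2] F : MvPolynomial (Fin 4) k) := by
      rw [comp_aeval_apply]
      refine congrArg (fun w => aeval w F) ?_
      ext i; fin_cases i <;> simp
    rw [h3]
    intro h
    exact top_ne hd hF hirr (hv.1 (by rw [h, map_zero]))
  let R := MvPolynomial (Fin 4) k
  let E := FractionRing R
  let fE : E →+* Ω := IsFractionRing.lift (g := (aeval v : R →ₐ[k] Ω).toRingHom) hv.1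
  letI : Algebra E Ω := fE.toAlgebra
  letI : Algebra R Ω := (aeval v : R →ₐ[k] Ω).toRingHom.toAlgebra
  have tow : IsScalarTower R E Ω := IsScalarTower.of_algebraMap_eq fun r => (IsFractionRing.lift_algebraMap (g := (aeval v : R →ₐ[k] Ω).toRingHom) hv.1 r).symm
  have halg : Algebra.IsAlgebraic R Ω := by
    have h1 := hv.isAlgebraic
    refine Algebra.IsAlgebraic.of_ringHom_of_comp_eq (S := Algebra.adjoin k (Set.range v)) (hv.1.aevalEquiv : R ≃ₐ[k] _) (RingHom.id Ω) hv.1.aevalEquiv.surjective Function.injective_id ?_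
    refine RingHom.ext fun r => ?_
    exact hv.1.algebraMap_aevalEquiv r
  have halgE : Algebra.IsAlgebraic E Ω := (IsFractionRing.comap_isAlgebraic_iff (A := R) (K := E) (C := Ω)).1 halg
  have hcl : IsAlgClosure E Ω := ⟨inferInstance, halgE⟩
  have hnor : Normal E Ω := IsAlgClosure.normal E Ω
  let q := qL (X : Fin 4 → R) F
  have hqm : q.map (algebraMap R Ω) = qL v F := by
    have := qL_map (aeval v : R →ₐ[k] Ω) X F
    simp only [aeval_X] at this
    exact this
  have hqd : q.natDegree ≠ 0 := by
    have := Polynomial.natDegree_map_le (f := algebraMap R Ω) (p := q)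
    rw [hqm, hdeg] at this
    omega
  have hqirr : Irreducible q := qX_irr hd hF hirr
  letI : NormalizedGCDMonoid R := Classical.choice (inferInstance : Nonempty (NormalizedGCDMonoid R))
  have hEirr : Irreducible (q.map (algebraMap R E)) :=
    ((hqirr.isPrimitive hqd).irreducible_iff_irreducible_map_fraction_map (K := E)).1 hqirr
  have hEm : (q.map (algebraMap R E)).map (algebraMap E Ω) = qL v F := by
    rw [Polynomial.map_map, ← IsScalarTower.algebraMap_eq, hqm]
  have hcE : CharZero E := charZero_of_injective_algebraMap (R := k) (A := E) (FaithfulSMul.algebraMap_injective k E)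
  refine ⟨hdeg, ?_, fun x y hx hy => ?_⟩
  · rw [← hEm]; exact hEirr.separable.map
  · have ev : ∀ z, (qL v F).IsRoot z → Polynomial.aeval z (q.map (algebraMap R E)) = 0 := by
      intro z hz
      rw [← hEm, Polynomial.IsRoot, Polynomial.eval_map_algebraMap] at hz
      exact hz
    obtain ⟨σ, hσ⟩ := minpoly.exists_algEquiv_of_root (K := E) (L := Ω) (x := x) (y := y) (halgE.isAlgebraic y) (by
      rw [← minpoly.eq_of_irreducible hEirr (ev y hy), map_mul, ev x hx, zero_mul])
    have hσR : ∀ r : R, σ (algebraMap R Ω r) = algebraMap R Ω r := fun r => by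
      rw [IsScalarTower.algebraMap_apply R E Ω, σ.commutes]
    refine ⟨{ σ with commutes' := fun r => ?_ }, fun i => ?_, hσ⟩
    · have := hσR (C r)
      have e : algebraMap R Ω (C r) = algebraMap k Ω r := (aeval v : R →ₐ[k] Ω).commutes r
      rw [e] at this
      exact this
    · have := hσR (X i)
      have e : algebraMap R Ω (X i) = v i := aeval_X v i
      rw [e] at this
      exact this
end

section
variable {k K Ω : Type*} [Field k] [Field K] [Algebra k K] [Field Ω] [Algebra k Ω]
open TensorProduct

theorem tensor_li {n : ℕ} {ξ h : Fin n → K} (hξ : LinearIndependent k ξ) (h0 : ∑ i, h i ⊗ₜ[k] ξ i = 0) : ∀ i, h i = 0 := by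
  have h1 : LinearIndependent K (fun i => (1 : K) ⊗ₜ[k] ξ i) := Module.Flat.linearIndependent_one_tmul hξ
  apply Fintype.linearIndependent_iff.1 h1
  rw [← h0]
  refine Finset.sum_congr rfl fun i _ => ?_
  rw [TensorProduct.smul_tmul', smul_eq_mul, mul_one]

noncomputable def cl (k : Type*) {Ω : Type*} [Field k] [Field Ω] [Algebra k Ω] (s : Set Ω) : IntermediateField k Ω :=
  (algebraicClosure (IntermediateField.adjoin k s) Ω).restrictScalars k

theorem cl_sub (s : Set Ω) : s ⊆ cl k s := by
  intro x hx
  show x ∈ algebraicClosure (IntermediateField.adjoin k s) Ω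
  rw [mem_algebraicClosure_iff]
  exact isAlgebraic_algebraMap (⟨x, IntermediateField.subset_adjoin k s hx⟩ : IntermediateField.adjoin k s)

theorem cl_closed (s : Set Ω) (x : Ω) (hx : IsAlgebraic (cl k s) x) : x ∈ cl k s := by
  show x ∈ algebraicClosure (IntermediateField.adjoin k s) Ω
  rw [mem_algebraicClosure_iff]
  have : IsAlgebraic (algebraicClosure (IntermediateField.adjoin k s) Ω) x := hx
  exact this.restrictScalars _

open IntermediateField.algebraAdjoinAdjoin in
theorem cl_alg (s : Set Ω) (h : cl k s = ⊤) : Algebra.IsAlgebraic (Algebra.adjoin k s) Ω := by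
  have h1 : ∀ x : Ω, IsAlgebraic (IntermediateField.adjoin k s) x := by
    intro x
    have : x ∈ cl k s := by rw [h]; trivial
    rw [← mem_algebraicClosure_iff]; exact this
  have h2 : Algebra.IsAlgebraic (IntermediateField.adjoin k s) Ω := ⟨h1⟩
  exact (IsFractionRing.comap_isAlgebraic_iff (A := Algebra.adjoin k s) (K := IntermediateField.adjoin k s) (C := Ω)).2 h2

theorem cl_map {N : IntermediateField k Ω} (hN : ∀ x : Ω, IsAlgebraic N x → x ∈ N) {ι : Type*} {v : ι → K} (hv : IsTranscendenceBasis k v)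
    (ψ : K →ₐ[k] Ω) (h : ∀ i, ψ (v i) ∈ N) (x : K) : ψ x ∈ N := by
  apply hN
  obtain ⟨p, p0, hp⟩ := hv.isAlgebraic.isAlgebraic x
  have hR : ∀ r : Algebra.adjoin k (Set.range v), ψ r ∈ N := by
    intro r
    have : Algebra.adjoin k (Set.range v) ≤ N.toSubalgebra.comap ψ := by
      rw [Algebra.adjoin_le_iff]
      rintro _ ⟨i, rfl⟩
      exact h i
    exact this r.2
  let f : Algebra.adjoin k (Set.range v) →+* N := ((ψ : K →+* Ω).comp (algebraMap _ K)).codRestrict N hR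
  have hf : Function.Injective f := by
    intro r r' hr
    have : ψ r = ψ r' := congrArg Subtype.val hr
    exact Subtype.ext (ψ.injective this)
  refine ⟨p.map f, (Polynomial.map_ne_zero_iff hf).2 p0, ?_⟩
  have h2 : (algebraMap N Ω).comp f = (ψ : K →+* Ω).comp (algebraMap _ K) := rfl
  rw [Polynomial.aeval_def, Polynomial.eval₂_map, h2]
  have := congrArg ψ hp
  rw [map_zero, Polynomial.aeval_def] at this
  rw [← this]
  exact (Polynomial.hom_eval₂ p (algebraMap _ K) (ψ : K →+* Ω) x).symm

theorem tb_of_cl {v : Fin 4 → Ω} (hv : IsTranscendenceBasis k v) {w : Fin 4 → Ω} (h : cl k (Set.range w) = ⊤) : IsTranscendenceBasis k w := by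
  have := cl_alg _ h
  apply Algebra.IsAlgebraic.isTranscendenceBasis_of_lift_le_trdeg_of_finite
  exact (hv.lift_cardinalMk_eq_trdeg).le

theorem prod_inj [IsAlgClosed k] {a b : K} {ψ1 ψ2 ψ ψ' : K →ₐ[k] Ω}
    (h12 : Function.Injective (Algebra.TensorProduct.productMap ψ1 ψ2)) (hv : IsTranscendenceBasis k ![ψ1 a, ψ1 b, ψ2 a, ψ2 b])
    (hw : AlgebraicIndependent k ![ψ a, ψ b, ψ' a, ψ' b]) : Function.Injective (Algebra.TensorProduct.productMap ψ ψ') := by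
  have := tensor_domain (k := k) (K := K)
  let R := MvPolynomial (Fin 4) k
  let g : R →ₐ[k] K ⊗[k] K := aeval ![a ⊗ₜ 1, b ⊗ₜ 1, 1 ⊗ₜ a, 1 ⊗ₜ b]
  have hg : ∀ (φ φ' : K →ₐ[k] Ω) (r : R), Algebra.TensorProduct.productMap φ φ' (g r) = aeval ![φ a, φ b, φ' a, φ' b] r := by
    intro φ φ' r
    rw [comp_aeval_apply]
    refine congrArg (fun w => aeval w r) ?_
    ext i; fin_cases i <;> simp
  letI : Algebra R (K ⊗[k] K) := g.toRingHom.toAlgebra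
  let v := ![ψ1 a, ψ1 b, ψ2 a, ψ2 b]
  letI : Algebra R Ω := (aeval v : R →ₐ[k] Ω).toRingHom.toAlgebra
  have halg : Algebra.IsAlgebraic R Ω := by
    have h1 := hv.isAlgebraic
    refine Algebra.IsAlgebraic.of_ringHom_of_comp_eq (S := Algebra.adjoin k (Set.range v)) (hv.1.aevalEquiv : R ≃ₐ[k] _) (RingHom.id Ω) hv.1.aevalEquiv.surjective Function.injective_id ?_
    refine RingHom.ext fun r => ?_
    exact hv.1.algebraMap_aevalEquiv r
  let P : K ⊗[k] K →ₐ[R] Ω := { (Algebra.TensorProduct.productMap ψ1 ψ2).toRingHom with commutes' := fun r => hg ψ1 ψ2 r }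
  rw [injective_iff_map_eq_zero]
  intro s hs
  by_contra s0
  have hsa : IsAlgebraic R s := (isAlgebraic_algHom_iff P h12).1 (halg.isAlgebraic _)
  obtain ⟨r, r0, t, ht⟩ := hsa.exists_nonzero_dvd (mem_nonZeroDivisors_of_ne_zero s0)
  apply r0
  apply hw
  rw [map_zero, ← hg ψ ψ']
  have : g r = s * t := ht
  rw [this, map_mul, hs, zero_mul]

theorem prod_ai {a b : K} (hab : AlgebraicIndependent k ![a, b]) {ψ1 ψ2 : K →ₐ[k] Ω} (hP : Function.Injective (Algebra.TensorProduct.productMap ψ1 ψ2)) :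
    AlgebraicIndependent k ![ψ1 a, ψ1 b, ψ2 a, ψ2 b] := by
  letI : Algebra K Ω := (ψ1 : K →+* Ω).toAlgebra
  haveI : IsScalarTower k K Ω := IsScalarTower.of_algebraMap_eq fun r => (ψ1.commutes r).symm
  have h2 : AlgebraicIndependent K ![ψ2 a, ψ2 b] := by
    rw [AlgebraicIndependent, injective_iff_map_eq_zero]
    intro p hp
    have hli : LinearIndependent k (fun m : Fin 2 →₀ ℕ => (aeval ![a, b] (monomial m (1:k)) : K)) := by
      have := (basisMonomials (Fin 2) k).linearIndependent.map' (aeval ![a,b] : MvPolynomial (Fin 2) k →ₐ[k] K).toLinearMap (LinearMap.ker_eq_bot.2 hab)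
      exact this
    have h3 : LinearIndependent K (fun m : Fin 2 →₀ ℕ => (1 : K) ⊗ₜ[k] (aeval ![a, b] (monomial m (1:k)) : K)) := Module.Flat.linearIndependent_one_tmul hli
    have h4 : ∑ m ∈ p.support, p.coeff m • ((1 : K) ⊗ₜ[k] (aeval ![a, b] (monomial m (1:k)) : K)) = 0 := by
      apply hP
      rw [map_zero, ← hp, aeval_def, eval₂_eq', map_sum]
      refine Finset.sum_congr rfl fun m _ => ?_
      rw [TensorProduct.smul_tmul', smul_eq_mul, mul_one, Algebra.TensorProduct.productMap_apply_tmul, aeval_monomial, map_one, one_mul, Finsupp.prod_fintype _ _ (by simp), map_prod]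
      congr 1
      refine Finset.prod_congr rfl fun i _ => ?_
      rw [map_pow]
      fin_cases i <;> rfl
    have h5 := linearIndependent_iff'.1 h3 _ _ h4
    ext m
    by_cases hm : m ∈ p.support
    · simpa using h5 m hm
    · simpa using hm
  have h6 := AlgebraicIndependent.sumElim_comp hab h2
  let e : Fin 4 → Fin 2 ⊕ Fin 2 := ![Sum.inr 0, Sum.inr 1, Sum.inl 0, Sum.inl 1]
  have he : Function.Injective e := by decide
  have h7 := h6.comp e he
  convert h7 using 1
  ext i; fin_cases i <;> rfl
end

theorem setup.{u, v} {k : Type u} {K : Type v} [Field k] [Field K] [Algebra k K] [IsAlgClosed k] {a b : K} (hab : IsTranscendenceBasis k ![a, b]) :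
    ∃ (Ω : Type v) (_ : Field Ω) (_ : Algebra k Ω) (_ : IsAlgClosed Ω) (ψ1 ψ2 : K →ₐ[k] Ω),
      Function.Injective (Algebra.TensorProduct.productMap ψ1 ψ2) ∧ IsTranscendenceBasis k ![ψ1 a, ψ1 b, ψ2 a, ψ2 b] := by
  have := tensor_domain (k := k) (K := K)
  let S := TensorProduct k K K
  let Q := FractionRing S
  let Ω := AlgebraicClosure Q
  let P : S →ₐ[k] Ω := IsScalarTower.toAlgHom k S Ω
  have hP : Function.Injective P := (algebraMap Q Ω).injective.comp (IsFractionRing.injective S Q)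
  let ψ1 : K →ₐ[k] Ω := P.comp Algebra.TensorProduct.includeLeft
  let ψ2 : K →ₐ[k] Ω := P.comp Algebra.TensorProduct.includeRight
  have hPe : Algebra.TensorProduct.productMap ψ1 ψ2 = P := by
    ext x <;> simp [ψ1, ψ2] <;> rfl
  have hinj : Function.Injective (Algebra.TensorProduct.productMap ψ1 ψ2) := by rw [hPe]; exact hP
  refine ⟨Ω, inferInstance, inferInstance, inferInstance, ψ1, ψ2, hinj, ?_⟩
  have hai : AlgebraicIndependent k ![ψ1 a, ψ1 b, ψ2 a, ψ2 b] := prod_ai hab.1 hinj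
  have htop : cl k (Set.range ![ψ1 a, ψ1 b, ψ2 a, ψ2 b]) = ⊤ := by
    set N := cl k (Set.range ![ψ1 a, ψ1 b, ψ2 a, ψ2 b]) with hNdef
    have hN : ∀ x : Ω, IsAlgebraic N x → x ∈ N := cl_closed _
    have hs := cl_sub (k := k) (Set.range ![ψ1 a, ψ1 b, ψ2 a, ψ2 b])
    have m1 : ∀ x, ψ1 x ∈ N := cl_map hN hab ψ1 (fun i => by
      fin_cases i
      · exact hs ⟨0, rfl⟩
      · exact hs ⟨1, rfl⟩)
    have m2 : ∀ x, ψ2 x ∈ N := cl_map hN hab ψ2 (fun i => by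
      fin_cases i
      · exact hs ⟨2, rfl⟩
      · exact hs ⟨3, rfl⟩)
    have m3 : ∀ s : S, P s ∈ N := by
      intro s
      induction s using TensorProduct.induction_on with
      | zero => rw [map_zero]; exact N.zero_mem
      | add x y hx hy => rw [map_add]; exact N.add_mem hx hy
      | tmul x y => rw [← hPe, Algebra.TensorProduct.productMap_apply_tmul]; exact N.mul_mem (m1 x) (m2 y)
    have m4 : ∀ q : Q, algebraMap Q Ω q ∈ N := by
      intro q
      obtain ⟨x, y, hy, rfl⟩ := IsFractionRing.div_surjective (A := S) q
      rw [map_div₀]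
      exact N.div_mem (m3 x) (m3 y)
    rw [eq_top_iff]
    rintro x -
    apply hN
    obtain ⟨p, p0, hp⟩ := (AlgebraicClosure.isAlgebraic Q).isAlgebraic x
    let f : Q →+* N := (algebraMap Q Ω).codRestrict N m4
    refine ⟨p.map f, (Polynomial.map_ne_zero_iff f.injective).2 p0, ?_⟩
    have h2 : (algebraMap N Ω).comp f = algebraMap Q Ω := rfl
    rw [Polynomial.aeval_def, Polynomial.eval₂_map, h2]
    exact hp
  have := cl_alg _ htop
  exact (hai.isTranscendenceBasis_iff_isAlgebraic).2 this

theorem comb {Ω : Type*} [DecidableEq Ω] (U : Finset Ω) (hU : 5 ≤ U.card) (S : Set (Finset Ω)) (hne : S.Nonempty)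
    (hS : ∀ X ∈ S, X ⊆ U ∧ X.card = 3)
    (htr : ∀ x ∈ U, ∀ y ∈ U, ∃ σ : Ω → Ω, Function.Injective σ ∧ σ x = y ∧ ∀ X ∈ S, X.image σ ∈ S)
    (hi : ∀ X ∈ S, ∀ Y ∈ S, 2 ≤ (X ∩ Y).card) : False := by
  obtain ⟨X, hX⟩ := hne
  have hin : ∀ u ∈ U, ∃ Y ∈ S, u ∈ Y := by
    intro u hu
    obtain ⟨x, hx⟩ : X.Nonempty := by rw [← Finset.card_pos, (hS X hX).2]; norm_num
    obtain ⟨σ, _, h1, h2⟩ := htr x ((hS X hX).1 hx) u hu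
    exact ⟨_, h2 X hX, Finset.mem_image.2 ⟨x, hx, h1⟩⟩
  have hex : ∀ V : Finset Ω, V.card < 5 → ∃ x ∈ U, x ∉ V := by
    intro V hV
    exact Finset.exists_mem_notMem_of_card_lt_card (by omega)
  have hout : ∀ u ∈ U, ∃ Y ∈ S, u ∉ Y := by
    intro u hu
    obtain ⟨x, hx, hxX⟩ := hex X (by rw [(hS X hX).2]; norm_num)
    obtain ⟨σ, hσ, h1, h2⟩ := htr x hx u hu
    refine ⟨_, h2 X hX, fun h => ?_⟩
    obtain ⟨y, hy, hyu⟩ := Finset.mem_image.1 h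
    rw [← h1] at hyu
    rw [hσ hyu] at hy
    exact hxX hy
  -- if `z ∉ T`, `z ∈ T'` then `T' \ z ⊆ T`
  have key : ∀ T ∈ S, ∀ T' ∈ S, ∀ z ∈ T', z ∉ T → ∀ w ∈ T', w ≠ z → w ∈ T := by
    intro T hT T' hT' z hz hzT w hw hwz
    by_contra hwT
    have h1 := hi T hT T' hT'
    have h2 : T ∩ T' ⊆ (T'.erase z).erase w := by
      intro t ht
      rw [Finset.mem_inter] at ht
      refine Finset.mem_erase.2 ⟨fun h => hwT (h ▸ ht.1), Finset.mem_erase.2 ⟨fun h => hzT (h ▸ ht.1), ht.2⟩⟩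
    have h3 := Finset.card_le_card h2
    rw [Finset.card_erase_of_mem (Finset.mem_erase.2 ⟨hwz, hw⟩), Finset.card_erase_of_mem hz, (hS T' hT').2] at h3
    omega
  obtain ⟨x4, hx4, hx4X⟩ := hex X (by rw [(hS X hX).2]; norm_num)
  obtain ⟨Y, hY, hx4Y⟩ := hin x4 hx4
  have hXY : (X ∪ Y).card < 5 := by
    have := Finset.card_union_add_card_inter X Y
    have := hi X hX Y hY
    rw [(hS X hX).2, (hS Y hY).2] at *
    omega
  obtain ⟨x5, hx5, hx5n⟩ := hex _ hXY
  rw [Finset.mem_union, not_or] at hx5n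
  obtain ⟨Z, hZ, hx5Z⟩ := hin x5 hx5
  obtain ⟨i, hiZ, hi5⟩ : ∃ i ∈ Z, i ≠ x5 := by
    obtain ⟨i, h⟩ : (Z.erase x5).Nonempty := by
      rw [← Finset.card_pos, Finset.card_erase_of_mem hx5Z, (hS Z hZ).2]; norm_num
    exact ⟨i, Finset.mem_of_mem_erase h, Finset.ne_of_mem_erase h⟩
  have hiX := key X hX Z hZ x5 hx5Z hx5n.1 i hiZ hi5
  have hiY := key Y hY Z hZ x5 hx5Z hx5n.2 i hiZ hi5
  obtain ⟨W, hW, hiW⟩ := hout i ((hS X hX).1 hiX)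
  have h4 : x4 ∈ W := key W hW Y hY i hiY hiW x4 hx4Y (fun h => hx4X (h ▸ hiX))
  have h5 : x5 ∈ W := key W hW Z hZ i hiZ hiW x5 hx5Z (fun h => hx5n.1 (h ▸ hiX))
  have h6 : insert x4 (insert x5 (X.erase i)) ⊆ W := by
    intro t ht
    rw [Finset.mem_insert, Finset.mem_insert, Finset.mem_erase] at ht
    rcases ht with rfl | rfl | ⟨h, h'⟩
    · exact h4
    · exact h5
    · exact key W hW X hX i hiX hiW t h' h
  have h7 := Finset.card_le_card h6
  rw [(hS W hW).2, Finset.card_insert_of_notMem, Finset.card_insert_of_notMem, Finset.card_erase_of_mem hiX, (hS X hX).2] at h7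
  · omega
  · exact fun h => hx5n.1 (Finset.mem_of_mem_erase h)
  · intro h
    rcases Finset.mem_insert.1 h with h | h
    · exact hx5n.2 (h ▸ hx4Y)
    · exact hx4X (Finset.mem_of_mem_erase h)

section
variable {k K Ω : Type*} [Field k] [Field K] [Algebra k K] [Field Ω] [Algebra k Ω]
open TensorProduct

theorem b_alg [Infinite Ω] {c a b : K} {ψ1 ψ2 : K →ₐ[k] Ω} (hP : Function.Injective (Algebra.TensorProduct.productMap ψ1 ψ2))
    (hli : LinearIndependent k ![1, c, a, b]) {H : MvPolynomial (Fin 3) k} (hH : aeval ![c, a, b] H = 0) (hH' : ∃ i, aeval ![c, a, b] (pderiv i H) ≠ 0)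
    {v : Fin 4 → Ω} (e1 : ψ1 a = v 2 - v 0 * ψ1 b) (e2 : ψ2 a = v 2 - v 0 * ψ2 b) (e3 : ψ1 c = v 3 - v 1 * ψ1 b) (e4 : ψ2 c = v 3 - v 1 * ψ2 b)
    {N : IntermediateField k Ω} (hN : ∀ x : Ω, IsAlgebraic N x → x ∈ N) (hv : ∀ i, v i ∈ N) : ψ1 b ∈ N ∧ ψ2 b ∈ N := by
  let v' : Fin 4 → N := fun i => ⟨v i, hv i⟩
  let h : Polynomial N := aeval ![Polynomial.C (v' 3) - Polynomial.C (v' 1) * Polynomial.X, Polynomial.C (v' 2) - Polynomial.C (v' 0) * Polynomial.X, Polynomial.X] H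
  have hev : ∀ β : Ω, Polynomial.aeval β h = aeval ![v 3 - v 1 * β, v 2 - v 0 * β, β] H := by
    intro β
    have := comp_aeval_apply (R := k) ((Polynomial.aeval β : Polynomial N →ₐ[N] Ω).restrictScalars k) (f := ![Polynomial.C (v' 3) - Polynomial.C (v' 1) * Polynomial.X, Polynomial.C (v' 2) - Polynomial.C (v' 0) * Polynomial.X, Polynomial.X]) H
    refine Eq.trans this (congrArg (fun w => aeval w H) ?_)
    ext i; fin_cases i <;> simp [v', IntermediateField.algebraMap_apply]
  have hpt : ∀ ψ : K →ₐ[k] Ω, aeval ![ψ c, ψ a, ψ b] H = ψ (aeval ![c, a, b] H) := by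
    intro ψ
    rw [comp_aeval_apply]
    refine congrArg (fun w => aeval w H) ?_
    ext i; fin_cases i <;> rfl
  have h0 : h ≠ 0 := by
    intro h0
    obtain ⟨i, hi⟩ := hH'
    apply hi
    have hl : lineP ![ψ1 c, ψ1 a, ψ1 b] ![-v 1, -v 0, 1] (map (algebraMap k Ω) H) = 0 := by
      apply Polynomial.funext
      intro t
      rw [lineP_eval, eval_map, ← aeval_def, Polynomial.eval_zero]
      have h1 := hev (ψ1 b + t)
      rw [h0, map_zero] at h1
      refine Eq.trans (congrArg (fun w => aeval w H) ?_) h1.symm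
      ext i; fin_cases i <;> simp [e1, e3] <;> ring
    have h2 := lineP_der ![ψ1 c, ψ1 a, ψ1 b] ![-v 1, -v 0, 1] (map (algebraMap k Ω) H)
    rw [hl, Polynomial.derivative_zero, Polynomial.eval_zero] at h2
    have h3 : ∀ i, eval ![ψ1 c, ψ1 a, ψ1 b] (pderiv i (map (algebraMap k Ω) H)) = ψ1 (aeval ![c, a, b] (pderiv i H)) := by
      intro i
      rw [pderiv_map, eval_map, ← aeval_def, comp_aeval_apply]
      refine congrArg (fun w => aeval w (pderiv i H)) ?_
      ext i; fin_cases i <;> rfl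
    simp only [h3, Fin.sum_univ_three] at h2
    set g : Fin 3 → K := fun i => aeval ![c, a, b] (pderiv i H) with hg
    have h4 : ∑ i, (![-(g 0 * c + g 1 * a + g 2 * b), g 0, g 1, g 2] : Fin 4 → K) i ⊗ₜ[k] (![1, c, a, b] : Fin 4 → K) i = 0 := by
      apply hP
      rw [map_zero, map_sum, Fin.sum_univ_four]
      simp only [Algebra.TensorProduct.productMap_apply_tmul]
      have h2' : 0 = -v 1 * ψ1 (g 0) + -v 0 * ψ1 (g 1) + 1 * ψ1 (g 2) := h2
      show ψ1 (-(g 0 * c + g 1 * a + g 2 * b)) * ψ2 1 + ψ1 (g 0) * ψ2 c + ψ1 (g 1) * ψ2 a + ψ1 (g 2) * ψ2 b = 0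
      simp only [map_neg, map_add, map_mul, map_one, e1, e2, e3, e4]
      linear_combination (ψ1 b - ψ2 b) * h2'
    have h5 := tensor_li hli h4
    show g i = 0
    fin_cases i
    · exact h5 1
    · exact h5 2
    · exact h5 3
  constructor
  · apply hN
    refine ⟨h, h0, ?_⟩
    rw [hev, ← e1, ← e3, hpt, hH, map_zero]
  · apply hN
    refine ⟨h, h0, ?_⟩
    rw [hev, ← e2, ← e4, hpt, hH, map_zero]
end

section
variable {k K Ω : Type*} [Field k] [Field K] [Algebra k K] [Field Ω] [Algebra k Ω]

noncomputable def pL (v : Fin 4 → Ω) (ψ : K →ₐ[k] Ω) (A : MvPolynomial (Fin 3) K) : Polynomial Ω :=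
  lineP ![1, 0, v 1] ![0, 1, v 0] (map (ψ : K →+* Ω) A)

theorem pL_rL (v : Fin 4 → Ω) (ψ : K →ₐ[k] Ω) (A : MvPolynomial (Fin 3) K) :
    pL v ψ A = rL (ψ : K →+* Ω) ![1, Polynomial.X, Polynomial.C (v 0) * Polynomial.X + Polynomial.C (v 1)] A := by
  rw [pL, lineP, aeval_def, eval₂_map, rL]
  congr 1
  ext1 i; fin_cases i <;> simp [add_comm]

theorem pL_mul (v : Fin 4 → Ω) (ψ : K →ₐ[k] Ω) (A B : MvPolynomial (Fin 3) K) : pL v ψ (A * B) = pL v ψ A * pL v ψ B := by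
  simp only [pL, map_mul]

theorem pL_deg (v : Fin 4 → Ω) (ψ : K →ₐ[k] Ω) {A : MvPolynomial (Fin 3) K} {e : ℕ} (hA : A.IsHomogeneous e) : (pL v ψ A).natDegree ≤ e :=
  (lineP_top _ _ (hA.map _)).1

theorem pL_map (v : Fin 4 → Ω) (ψ : K →ₐ[k] Ω) (A : MvPolynomial (Fin 3) K) (σ : Ω ≃ₐ[k] Ω) (hσ : ∀ i, σ (v i) = v i) :
    pL v ((σ : Ω →ₐ[k] Ω).comp ψ) A = (pL v ψ A).map (σ : Ω →+* Ω) := by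
  rw [pL_rL, pL_rL, rL_map]
  congr 1
  ext1 i; fin_cases i <;> simp [hσ]

def fam (c a b : K) (v : Fin 4 → Ω) (ψ : K →ₐ[k] Ω) : Prop := ψ a = v 2 - v 0 * ψ b ∧ ψ c = v 3 - v 1 * ψ b

theorem qL_pL {c a b : K} {v : Fin 4 → Ω} {ψ : K →ₐ[k] Ω} (h : fam c a b v ψ) (F : MvPolynomial (Fin 4) k) :
    qL v F = pL v ψ (rst c a b F) := by
  induction F using MvPolynomial.induction_on with
  | C r =>
    rw [qL, rst, pL, algHom_C, algHom_C, MvPolynomial.algebraMap_apply, map_C, algHom_C]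
    rw [IsScalarTower.algebraMap_apply k Ω (Polynomial Ω)]
    congr 1
    exact (ψ.commutes r).symm
  | add p q hp hq => rw [map_add, hp, hq, map_add, pL, pL, pL, map_add, map_add]
  | mul_X p i hp =>
    rw [map_mul, map_mul, pL_mul, hp]
    congr 1
    rw [pL_rL]
    fin_cases i
    · simp [qL, rst, rL]
    · simp [qL, rst, rL]
    · simp [qL, rst, rL]
    · simp only [qL, rst, rL, aeval_X]
      show Polynomial.C (v 2) * Polynomial.X + Polynomial.C (v 3) = eval₂ _ _ (C c * X 0 + C a * X 1 + C b * X 2)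
      simp only [eval₂_add, eval₂_mul, eval₂_C, eval₂_X]
      have h2 : v 2 = ψ a + v 0 * ψ b := by rw [h.1]; ring
      have h3 : v 3 = ψ c + v 1 * ψ b := by rw [h.2]; ring
      simp [h2, h3]
      ring
theorem rst_map (c a b : K) (F : MvPolynomial (Fin 4) k) (φ : K →ₐ[k] Ω) : map (φ : K →+* Ω) (rst c a b F) = rst (φ c) (φ a) (φ b) F := by
  induction F using MvPolynomial.induction_on with
  | C r =>
    rw [rst, rst, algHom_C, algHom_C, MvPolynomial.algebraMap_apply, map_C, MvPolynomial.algebraMap_apply]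
    congr 1
    exact φ.commutes r
  | add p q hp hq => rw [map_add, map_add, hp, hq, map_add]
  | mul_X p i hp =>
    rw [map_mul, map_mul, hp, map_mul]
    congr 1
    simp only [rst, aeval_X]
    fin_cases i <;> simp
end

theorem nonplane.{u, w} {k : Type u} {K : Type w} [Field k] [Field K] [Algebra k K] [IsAlgClosed k] [CharZero k] [CharZero K] [IsAlgClosed K] {c a b : K} {F : MvPolynomial (Fin 4) k} {d n : ℕ} (hdn : d = n + 3) (hn : 2 ≤ n)
    (hF : F.IsHomogeneous d) (hirr : Irreducible F) {A B : MvPolynomial (Fin 3) K}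
    (hA : A.IsHomogeneous 3) (hB : B.IsHomogeneous n) (hAB : rst c a b F = A * B) (hNL : NL (A * B))
    (hab : IsTranscendenceBasis k ![a, b])
    (hnp : ∀ u0 u1 u2 : k, c ≠ algebraMap k K u0 + algebraMap k K u1 * a + algebraMap k K u2 * b)
    {D₁ D₂ : Derivation k K K} (d1a : D₁ a = 1) (d1b : D₁ b = 0) (d2a : D₂ a = 0) (d2b : D₂ b = 1)
    (hD : ∀ D : Derivation k K K, D = D a • D₁ + D b • D₂) : False := by
  classical
  have hli : LinearIndependent k ![1, c, a, b] := by
    have hab1 : LinearIndependent k ![1, a, b] := by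
      rw [Fintype.linearIndependent_iff]
      intro g hg
      rw [Fin.sum_univ_three] at hg
      have h1 : aeval ![a, b] (C (g 0) + C (g 1) * X 0 + C (g 2) * X 1 : MvPolynomial (Fin 2) k) = aeval ![a, b] (0 : MvPolynomial (Fin 2) k) := by
        rw [map_zero, ← hg]
        simp [Algebra.smul_def]
      have h2 := hab.1 h1
      have e0 := congrArg (eval ![0, 0]) h2
      have e1 := congrArg (eval ![1, 0]) h2
      have e2 := congrArg (eval ![0, 1]) h2
      simp at e0 e1 e2
      rw [e0] at e1 e2
      rw [zero_add] at e1 e2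
      intro i; fin_cases i
      · exact e0
      · exact e1
      · exact e2
    rw [Fintype.linearIndependent_iff]
    intro g hg
    rw [Fin.sum_univ_four] at hg
    have hg' : g 0 • (1 : K) + g 1 • c + g 2 • a + g 3 • b = 0 := hg
    have g1 : g 1 = 0 := by
      by_contra h
      apply hnp (-(g 0 / g 1)) (-(g 2 / g 1)) (-(g 3 / g 1))
      have h' : algebraMap k K (g 1) ≠ 0 := by simpa using h
      simp only [Algebra.smul_def] at hg'
      simp only [map_neg, map_div₀]
      field_simp
      linear_combination hg'
    rw [g1, zero_smul, add_zero] at hg'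
    have h3 := Fintype.linearIndependent_iff.1 hab1 ![g 0, g 2, g 3] (by rw [Fin.sum_univ_three]; exact hg')
    intro i; fin_cases i
    · exact h3 0
    · exact g1
    · exact h3 1
    · exact h3 2
  obtain ⟨H, hH, hH'⟩ := exists_grad (k := k) (x := ![c, a, b]) (by
    intro h
    have h2 := hab.lift_cardinalMk_eq_trdeg
    have h3 := h.lift_cardinalMk_le_trdeg
    rw [← h2] at h3
    simp at h3
    norm_cast at h3)
  obtain ⟨Ω, _, _, _, ψ1, ψ2, hinj, htb⟩ := setup hab
  have hcz : CharZero Ω := charZero_of_injective_algebraMap (algebraMap k Ω).injective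
  have hinfΩ : Infinite Ω := inferInstance
  have hb12 : ψ1 b - ψ2 b ≠ 0 := by
    intro h
    have := htb.1.injective (a₁ := 1) (a₂ := 3) (sub_eq_zero.1 h)
    exact absurd this (by decide)
  let l := -(ψ1 a - ψ2 a) / (ψ1 b - ψ2 b)
  let m := -(ψ1 c - ψ2 c) / (ψ1 b - ψ2 b)
  let v : Fin 4 → Ω := ![l, m, ψ1 a + l * ψ1 b, ψ1 c + m * ψ1 b]
  have f1 : fam c a b v ψ1 := ⟨by simp [v], by simp [v]⟩
  have f2 : fam c a b v ψ2 := by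
    constructor
    · show ψ2 a = (ψ1 a + l * ψ1 b) - l * ψ2 b
      simp only [l]; field_simp; ring
    · show ψ2 c = (ψ1 c + m * ψ1 b) - m * ψ2 b
      simp only [m]; field_simp; ring
  clear_value v
  have hvtb : IsTranscendenceBasis k v := by
    apply tb_of_cl htb
    set N := cl k (Set.range v)
    have hN : ∀ x : Ω, IsAlgebraic N x → x ∈ N := cl_closed _
    have hvN : ∀ i, v i ∈ N := fun i => cl_sub _ ⟨i, rfl⟩
    obtain ⟨b1, b2⟩ := b_alg hinj hli hH hH' f1.1 f2.1 f1.2 f2.2 hN hvN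
    have a1 : ψ1 a ∈ N := by rw [f1.1]; exact N.sub_mem (hvN _) (N.mul_mem (hvN _) b1)
    have a2 : ψ2 a ∈ N := by rw [f2.1]; exact N.sub_mem (hvN _) (N.mul_mem (hvN _) b2)
    rw [eq_top_iff]
    rintro x -
    refine cl_map hN htb (AlgHom.id k Ω) (fun i => ?_) x
    fin_cases i
    · exact a1
    · exact b1
    · exact a2
    · exact b2
  obtain ⟨hdeg, hsep, htr⟩ := trans_roots v hvtb (by omega : 2 ≤ d) hF hirr
  have hq0 : qL v F ≠ 0 := by
    intro h; rw [h, Polynomial.natDegree_zero] at hdeg; omega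
  have hfac : ∀ ψ : K →ₐ[k] Ω, fam c a b v ψ → qL v F = pL v ψ A * pL v ψ B := by
    intro ψ hψ
    rw [qL_pL hψ, hAB, pL_mul]
  have hA0 : ∀ ψ : K →ₐ[k] Ω, fam c a b v ψ → pL v ψ A ≠ 0 := fun ψ hψ h => hq0 (by rw [hfac ψ hψ, h, zero_mul])
  have hB0 : ∀ ψ : K →ₐ[k] Ω, fam c a b v ψ → pL v ψ B ≠ 0 := fun ψ hψ h => hq0 (by rw [hfac ψ hψ, h, mul_zero])
  have hAd : ∀ ψ : K →ₐ[k] Ω, fam c a b v ψ → (pL v ψ A).natDegree = 3 := by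
    intro ψ hψ
    have h1 := pL_deg v ψ hA
    have h2 := pL_deg v ψ hB
    rw [hfac ψ hψ, Polynomial.natDegree_mul (hA0 ψ hψ) (hB0 ψ hψ)] at hdeg
    omega
  have hAs : ∀ ψ : K →ₐ[k] Ω, fam c a b v ψ → (pL v ψ A).Separable := fun ψ hψ => by
    rw [hfac ψ hψ] at hsep; exact hsep.of_mul_left
  have hcop : ∀ ψ : K →ₐ[k] Ω, fam c a b v ψ → IsCoprime (pL v ψ A) (pL v ψ B) := fun ψ hψ => by
    rw [hfac ψ hψ] at hsep; exact hsep.isCoprime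
  have hndvd : ¬ A ∣ B := by
    rintro ⟨Q, hQ⟩
    have h1 : pL v ψ1 A ∣ pL v ψ1 B := ⟨pL v ψ1 Q, by rw [← pL_mul, ← hQ]⟩
    have h2 := (hcop ψ1 f1).isUnit_of_dvd' dvd_rfl h1
    have h3 := Polynomial.natDegree_eq_zero_of_isUnit h2
    rw [hAd ψ1 f1] at h3
    omega
  let S : (K →ₐ[k] Ω) → Finset Ω := fun ψ => (pL v ψ A).roots.toFinset
  have hSm : ∀ ψ, fam c a b v ψ → ∀ x, x ∈ S ψ ↔ (pL v ψ A).IsRoot x := by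
    intro ψ hψ x
    rw [Multiset.mem_toFinset, Polynomial.mem_roots (hA0 ψ hψ)]
  have hSc : ∀ ψ, fam c a b v ψ → (S ψ).card = 3 := by
    intro ψ hψ
    rw [Multiset.toFinset_card_of_nodup (Polynomial.nodup_roots (hAs ψ hψ)), ← hAd ψ hψ]
    exact (IsAlgClosed.splits _).natDegree_eq_card_roots.symm
  let U : Finset Ω := (qL v F).roots.toFinset
  have hUm : ∀ x, x ∈ U ↔ (qL v F).IsRoot x := by
    intro x
    rw [Multiset.mem_toFinset, Polynomial.mem_roots hq0]
  have hUc : U.card = d := by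
    rw [Multiset.toFinset_card_of_nodup (Polynomial.nodup_roots hsep), ← hdeg]
    exact (IsAlgClosed.splits _).natDegree_eq_card_roots.symm
  have hSU : ∀ ψ, fam c a b v ψ → S ψ ⊆ U := by
    intro ψ hψ x hx
    rw [hSm ψ hψ] at hx
    rw [hUm, hfac ψ hψ]
    simpa [Polynomial.IsRoot] using Or.inl hx
  have hP1 : ∀ ψ ψ', fam c a b v ψ → fam c a b v ψ' → ψ b ≠ ψ' b → 2 ≤ (S ψ ∩ S ψ').card := by
    intro ψ ψ' hψ hψ' hne
    by_contra hlt
    have hq : ψ' b - ψ b ≠ 0 := sub_ne_zero.2 (Ne.symm hne)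
    have h1 : 1 < (S ψ \ S ψ').card := by
      have := Finset.card_sdiff_add_card_inter (S ψ) (S ψ')
      rw [hSc ψ hψ] at this
      omega
    obtain ⟨x, hx, y, hy, hxy⟩ := Finset.one_lt_card.1 h1
    rw [Finset.mem_sdiff, hSm ψ hψ, hSm ψ' hψ'] at hx hy
    have hBr : ∀ z, (pL v ψ A).IsRoot z → ¬ (pL v ψ' A).IsRoot z → (pL v ψ' B).IsRoot z := by
      intro z hz hz'
      have h3 : (qL v F).IsRoot z := by rw [hfac ψ hψ]; simpa [Polynomial.IsRoot] using Or.inl hz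
      rw [hfac ψ' hψ', Polynomial.IsRoot, Polynomial.eval_mul] at h3
      exact (mul_eq_zero.1 h3).resolve_left hz'
    have hw : AlgebraicIndependent k ![ψ a, ψ b, ψ' a, ψ' b] := by
      refine And.left (b := _) (tb_of_cl htb ?_ : IsTranscendenceBasis k _)
      set N := cl k (Set.range ![ψ a, ψ b, ψ' a, ψ' b])
      have hN : ∀ x : Ω, IsAlgebraic N x → x ∈ N := cl_closed _
      have hs := cl_sub (k := k) (Set.range ![ψ a, ψ b, ψ' a, ψ' b])
      have m1 : ∀ x, ψ x ∈ N := cl_map hN hab ψ (fun i => by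
        fin_cases i
        · exact hs ⟨0, rfl⟩
        · exact hs ⟨1, rfl⟩)
      have m2 : ∀ x, ψ' x ∈ N := cl_map hN hab ψ' (fun i => by
        fin_cases i
        · exact hs ⟨2, rfl⟩
        · exact hs ⟨3, rfl⟩)
      have v0 : v 0 ∈ N := by
        have : v 0 = (ψ a - ψ' a) / (ψ' b - ψ b) := by rw [hψ.1, hψ'.1]; field_simp; ring
        rw [this]; exact N.div_mem (N.sub_mem (m1 _) (m2 _)) (N.sub_mem (m2 _) (m1 _))
      have v1 : v 1 ∈ N := by
        have : v 1 = (ψ c - ψ' c) / (ψ' b - ψ b) := by rw [hψ.2, hψ'.2]; field_simp; ring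
        rw [this]; exact N.div_mem (N.sub_mem (m1 _) (m2 _)) (N.sub_mem (m2 _) (m1 _))
      have v2 : v 2 ∈ N := by
        have : v 2 = ψ a + v 0 * ψ b := by rw [hψ.1]; ring
        rw [this]; exact N.add_mem (m1 _) (N.mul_mem v0 (m1 _))
      have v3 : v 3 ∈ N := by
        have : v 3 = ψ c + v 1 * ψ b := by rw [hψ.2]; ring
        rw [this]; exact N.add_mem (m1 _) (N.mul_mem v1 (m1 _))
      rw [eq_top_iff]
      rintro x -
      refine cl_map hN hvtb (AlgHom.id k Ω) (fun i => ?_) x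
      fin_cases i
      · exact v0
      · exact v1
      · exact v2
      · exact v3
    have hpi := prod_inj hinj htb hw
    have hvL : vL (ψ' c - ψ c) (ψ' a - ψ a) (ψ' b - ψ b) = fun i => Polynomial.C (ψ' b - ψ b) * (![1, Polynomial.X, Polynomial.C (v 0) * Polynomial.X + Polynomial.C (v 1)] : Fin 3 → Polynomial Ω) i := by
      have ha : ψ' a - ψ a = -((ψ' b - ψ b) * v 0) := by rw [hψ.1, hψ'.1]; ring
      have hc : ψ' c - ψ c = -((ψ' b - ψ b) * v 1) := by rw [hψ.2, hψ'.2]; ring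
      rw [ha, hc]
      generalize ψ' b - ψ b = q
      ext1 i; fin_cases i
      · simp [vL]
      · simp [vL]
      · simp [vL]; ring
    have hrA : rL (ψ : K →+* Ω) (vL (ψ' c - ψ c) (ψ' a - ψ a) (ψ' b - ψ b)) A = Polynomial.C ((ψ' b - ψ b) ^ 3) * pL v ψ A := by
      rw [hvL, rL_mul _ _ _ hA, pL_rL]
    have hrB : rL (ψ' : K →+* Ω) (vL (ψ' c - ψ c) (ψ' a - ψ a) (ψ' b - ψ b)) B = Polynomial.C ((ψ' b - ψ b) ^ n) * pL v ψ' B := by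
      rw [hvL, rL_mul _ _ _ hB, pL_rL]
    have hrt : ∀ (q : Ω) (p : Polynomial Ω) (z : Ω), p.IsRoot z → (Polynomial.C q * p).IsRoot z := by
      intro q p z hz
      rw [Polynomial.IsRoot, Polynomial.eval_mul, hz.eq_zero, mul_zero]
    refine claim (by omega : d ≠ 0) hn hF hirr hA hB hAB hNL hndvd hnp d1a d1b d2a d2b hD ψ ψ' hpi hxy ?_ ?_ ?_ ?_ ?_ ?_ ?_
    · rw [hrA]; exact mul_ne_zero (Polynomial.C_ne_zero.2 (pow_ne_zero _ hq)) (hA0 ψ hψ)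
    · rw [hrA]; exact (Polynomial.natDegree_C_mul_le _ _).trans (pL_deg v ψ hA)
    · rw [hrB]; exact (Polynomial.natDegree_C_mul_le _ _).trans (pL_deg v ψ' hB)
    · rw [hrA]; exact hrt _ _ _ hx.1
    · rw [hrA]; exact hrt _ _ _ hy.1
    · rw [hrB]; exact hrt _ _ _ (hBr x hx.1 hx.2)
    · rw [hrB]; exact hrt _ _ _ (hBr y hy.1 hy.2)
  have hP2 : ∀ ψ ψ', fam c a b v ψ → fam c a b v ψ' → ψ b = ψ' b → S ψ = S ψ' ∨ Disjoint (S ψ) (S ψ') := by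
    intro ψ ψ' hψ hψ' hb
    have ha : ψ a = ψ' a := by rw [hψ.1, hψ'.1, hb]
    have hc : ψ c = ψ' c := by rw [hψ.2, hψ'.2, hb]
    have h1 : map (ψ : K →+* Ω) A * map (ψ : K →+* Ω) B = map (ψ' : K →+* Ω) A * map (ψ' : K →+* Ω) B := by
      rw [← map_mul, ← map_mul, ← hAB, rst_map, rst_map, ha, hb, hc]
    have hAirr : Irreducible (map (ψ' : K →+* Ω) A) := by
      letI : Algebra K Ω := (ψ' : K →+* Ω).toAlgebra
      exact irr_base (k := K) (K := Ω) (by norm_num) hA (hNL.left.irr hA)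
    have hpr := hAirr.prime
    rcases hpr.2.2 _ _ (⟨_, h1⟩ : map (ψ' : K →+* Ω) A ∣ map (ψ : K →+* Ω) A * map (ψ : K →+* Ω) B) with h | h
    · left
      have h2 : pL v ψ' A ∣ pL v ψ A := map_dvd (lineP ![1, 0, v 1] ![0, 1, v 0]) h
      symm
      apply Finset.eq_of_subset_of_card_le
      · intro x hx
        rw [hSm ψ' hψ'] at hx
        rw [hSm ψ hψ]
        exact hx.dvd h2
      · rw [hSc ψ hψ, hSc ψ' hψ']
    · right
      have h2 : pL v ψ' A ∣ pL v ψ B := map_dvd (lineP ![1, 0, v 1] ![0, 1, v 0]) h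
      rw [Finset.disjoint_left]
      intro x hx hx'
      rw [hSm ψ hψ] at hx
      rw [hSm ψ' hψ'] at hx'
      have hx2 := hx'.dvd h2
      obtain ⟨s, t, hst⟩ := hcop ψ hψ
      have h3 := congrArg (Polynomial.eval x) hst
      rw [Polynomial.eval_add, Polynomial.eval_mul, Polynomial.eval_mul, hx.eq_zero, hx2.eq_zero] at h3
      simp at h3
  have hpair : ∀ ψ ψ', fam c a b v ψ → fam c a b v ψ' → 2 ≤ (S ψ ∩ S ψ').card := by
    intro ψ ψ' hψ hψ'
    by_cases hb : ψ b = ψ' b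
    · rcases hP2 ψ ψ' hψ hψ' hb with h | h
      · rw [h, Finset.inter_self, hSc ψ' hψ']; norm_num
      · exfalso
        obtain ⟨φ, hφ, hφb⟩ : ∃ φ, fam c a b v φ ∧ φ b ≠ ψ b := by
          by_cases h1 : ψ1 b = ψ b
          · exact ⟨ψ2, f2, fun h2 => hb12 (by rw [h1, h2, sub_self])⟩
          · exact ⟨ψ1, f1, h1⟩
        have h1 := hP1 φ ψ hφ hψ hφb
        have h2 := hP1 φ ψ' hφ hψ' (hb ▸ hφb)
        have h3 : Disjoint (S φ ∩ S ψ) (S φ ∩ S ψ') := h.mono Finset.inter_subset_right Finset.inter_subset_right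
        have h4 := Finset.card_union_of_disjoint h3
        have h5 : (S φ ∩ S ψ) ∪ (S φ ∩ S ψ') ⊆ S φ := Finset.union_subset Finset.inter_subset_left Finset.inter_subset_left
        have h6 := Finset.card_le_card h5
        rw [hSc φ hφ] at h6
        omega
    · exact hP1 ψ ψ' hψ hψ' hb
  refine comb U (by omega) {X | ∃ ψ, fam c a b v ψ ∧ S ψ = X} ⟨_, ψ1, f1, rfl⟩ ?_ ?_ ?_
  · rintro _ ⟨ψ, hψ, rfl⟩
    exact ⟨hSU ψ hψ, hSc ψ hψ⟩
  · intro x hx y hy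
    rw [hUm] at hx hy
    obtain ⟨σ, hσ, hxy⟩ := htr x y hx hy
    refine ⟨σ, σ.injective, hxy, ?_⟩
    rintro _ ⟨ψ, hψ, rfl⟩
    have hσψ : fam c a b v ((σ : Ω →ₐ[k] Ω).comp ψ) := by
      constructor
      · show σ (ψ a) = v 2 - v 0 * σ (ψ b)
        rw [hψ.1]; simp only [map_sub, map_mul, hσ]
      · show σ (ψ c) = v 3 - v 1 * σ (ψ b)
        rw [hψ.2]; simp only [map_sub, map_mul, hσ]
    refine ⟨_, hσψ, ?_⟩
    symm
    apply Finset.eq_of_subset_of_card_le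
    · intro z hz
      obtain ⟨z', hz', rfl⟩ := Finset.mem_image.1 hz
      rw [hSm ψ hψ] at hz'
      rw [hSm _ hσψ, pL_map v ψ A σ hσ]
      exact hz'.map
    · rw [hSc _ hσψ, Finset.card_image_of_injective _ σ.injective, hSc ψ hψ]
  · rintro _ ⟨ψ, hψ, rfl⟩ _ ⟨ψ', hψ', rfl⟩
    exact hpair ψ ψ' hψ hψ'

theorem core.{u, w} {k : Type u} {K : Type w} [Field k] [Field K] [Algebra k K] [IsAlgClosed k] [CharZero k] [IsAlgClosed K] {c a b : K} {F : MvPolynomial (Fin 4) k} {d n : ℕ} (hdn : d = n + 3) (hn : 1 ≤ n)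
    (hF : F.IsHomogeneous d) (hirr : Irreducible F) {A B : MvPolynomial (Fin 3) K}
    (hA : A.IsHomogeneous 3) (hB : B.IsHomogeneous n) (hAB : rst c a b F = A * B) (hNL : NL (A * B))
    (hab : IsTranscendenceBasis k ![a, b]) : False := by
  have hcz : CharZero K := charZero_of_injective_algebraMap (algebraMap k K).injective
  rcases (by omega : n = 1 ∨ 2 ≤ n) with rfl | hn
  · exact hNL.lin B hB ⟨A, by ring⟩
  obtain ⟨D₁, D₂, d1a, d1b, d2a, d2b, hD⟩ := der_two hab
  by_cases hp : ∃ u0 u1 u2 : k, c = algebraMap k K u0 + algebraMap k K u1 * a + algebraMap k K u2 * b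
  · obtain ⟨u0, u1, u2, hc⟩ := hp
    exact plane_case (by omega : n ≠ 0) hirr hA hB hAB hNL d1a d1b d2a d2b hD u0 u1 u2 hc
  · push Not at hp
    exact nonplane hdn hn hF hirr hA hB hAB hNL hab hp d1a d1b d2a d2b hD

section
variable {k K : Type*} [Field k] [Field K] [Algebra k K]

theorem nss_rab [IsAlgClosed k] {ι : Type*} [Finite ι] (S : Set (MvPolynomial ι k)) (u : ι → K) (h : ∀ s ∈ S, aeval u s = 0)
    (g : MvPolynomial ι k) (hg : ∀ v : ι → k, (∀ s ∈ S, eval v s = 0) → eval v g = 0) : aeval u g = 0 := by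
  by_contra hne
  let S' : Set (MvPolynomial (Option ι) k) := insert (X none * rename some g - 1) (rename some '' S)
  obtain ⟨v, hv⟩ := nss S' (fun o => o.elim (aeval u g)⁻¹ u) (by
    rintro s (rfl | ⟨s, hs, rfl⟩)
    · rw [map_sub, map_mul, aeval_X, aeval_rename, map_one]
      have : (fun o : Option ι => o.elim (aeval u g)⁻¹ u) ∘ some = u := rfl
      rw [this]
      simp [hne]
    · rw [aeval_rename]
      exact h s hs)
  have h1 := hv _ (Set.mem_insert _ _)
  rw [map_sub, map_mul, eval_rename, hg (v ∘ some), mul_zero, zero_sub, map_one] at h1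
  · simp at h1
  · intro s hs
    have := hv _ (Set.mem_insert_of_mem _ ⟨s, hs, rfl⟩)
    rwa [eval_rename] at this

theorem lines_k [IsAlgClosed k] {F : MvPolynomial (Fin 4) k}
    (hlines : {L : Submodule k (Fin 4 → k) | Module.finrank k L = 2 ∧ ∀ x ∈ L, eval x F = 0}.Finite)
    {i j : Fin 4} {P Q : Fin 4 → K} (pi : P i = 1) (pj : P j = 0) (qi : Q i = 0) (qj : Q j = 1)
    (h : ∀ s t : K, aeval (s • P + t • Q) F = 0) : (∀ l, ∃ r : k, P l = algebraMap k K r) ∧ ∀ l, ∃ r : k, Q l = algebraMap k K r := by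
  classical
  let ι := Fin 4 ⊕ Fin 4
  let S : Set (MvPolynomial ι k) := {X (Sum.inl i) - 1, X (Sum.inl j), X (Sum.inr i), X (Sum.inr j) - 1} ∪
    Set.range (fun st : k × k => (aeval (fun l => C st.1 * X (Sum.inl l) + C st.2 * X (Sum.inr l)) F : MvPolynomial ι k))
  let Z : Set (ι → k) := {v | ∀ s ∈ S, eval v s = 0}
  have hZ : ∀ v ∈ Z, v (Sum.inl i) = 1 ∧ v (Sum.inl j) = 0 ∧ v (Sum.inr i) = 0 ∧ v (Sum.inr j) = 1 ∧
      ∀ s t : k, eval (fun l => s * v (Sum.inl l) + t * v (Sum.inr l)) F = 0 := by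
    intro v hv
    refine ⟨?_, ?_, ?_, ?_, fun s t => ?_⟩
    · have := hv _ (Or.inl (Or.inl rfl)); simpa [sub_eq_zero] using this
    · have := hv _ (Or.inl (Or.inr (Or.inl rfl))); simpa using this
    · have := hv _ (Or.inl (Or.inr (Or.inr (Or.inl rfl)))); simpa using this
    · have := hv _ (Or.inl (Or.inr (Or.inr (Or.inr rfl)))); simpa [sub_eq_zero] using this
    · have := hv _ (Or.inr ⟨(s, t), rfl⟩)
      rw [eval_aeval4] at this
      simpa using this
  let f : (ι → k) → Submodule k (Fin 4 → k) := fun v => Submodule.span k {fun l => v (Sum.inl l), fun l => v (Sum.inr l)}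
  have hmem : ∀ v x, x ∈ f v ↔ ∃ s t : k, s • (fun l => v (Sum.inl l)) + t • (fun l => v (Sum.inr l)) = x := fun v x => Submodule.mem_span_pair
  have hfin : Z.Finite := by
    apply Set.Finite.of_finite_image (f := f)
    · refine hlines.subset ?_
      rintro _ ⟨v, hv, rfl⟩
      obtain ⟨h1, h2, h3, h4, h5⟩ := hZ v hv
      refine ⟨?_, fun x hx => ?_⟩
      · have hli : LinearIndependent k ![fun l => v (Sum.inl l), fun l => v (Sum.inr l)] := by
          rw [LinearIndependent.pair_iff]
          intro s t hst
          have e1 := congrFun hst i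
          have e2 := congrFun hst j
          simp [h1, h2, h3, h4] at e1 e2
          exact ⟨e1, e2⟩
        have := finrank_span_eq_card hli
        rw [Matrix.range_cons_cons_empty] at this
        exact this
      · obtain ⟨s, t, rfl⟩ := (hmem v x).1 hx
        exact h5 s t
    · intro v hv v' hv' hvv
      obtain ⟨h1, h2, h3, h4, h5⟩ := hZ v hv
      obtain ⟨h1', h2', h3', h4', h5'⟩ := hZ v' hv'
      have hvv : f v = f v' := hvv
      have e1 : (fun l => v (Sum.inl l)) ∈ f v' := by rw [← hvv, hmem]; exact ⟨1, 0, by simp⟩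
      have e2 : (fun l => v (Sum.inr l)) ∈ f v' := by rw [← hvv, hmem]; exact ⟨0, 1, by simp⟩
      obtain ⟨s, t, hst⟩ := (hmem _ _).1 e1
      obtain ⟨s', t', hst'⟩ := (hmem _ _).1 e2
      have a1 := congrFun hst i
      have a2 := congrFun hst j
      have a3 := congrFun hst' i
      have a4 := congrFun hst' j
      simp [h1, h2, h3, h4, h1', h2', h3', h4'] at a1 a2 a3 a4
      subst a1 a2 a3 a4
      ext l
      rcases l with l | l
      · have := congrFun hst l; simp at this; exact this.symm
      · have := congrFun hst' l; simp at this; exact this.symm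
  have hu : ∀ s ∈ S, aeval (Sum.elim P Q) s = 0 := by
    rintro s ((rfl | rfl | rfl | rfl) | ⟨⟨s, t⟩, rfl⟩)
    · simp [pi]
    · simp [pj]
    · simp [qi]
    · simp [qj]
    · rw [comp_aeval_apply]
      refine Eq.trans (congrArg (fun w => aeval w F) ?_) (h (algebraMap k K s) (algebraMap k K t))
      ext l; simp only [map_add, map_mul, algHom_C, aeval_X, Sum.elim_inl, Sum.elim_inr, Pi.add_apply, Pi.smul_apply, smul_eq_mul]
  have key : ∀ o : ι, ∃ r : k, Sum.elim P Q o = algebraMap k K r := by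
    intro o
    have h0 := nss_rab S (Sum.elim P Q) hu (∏ v ∈ hfin.toFinset, (X o - C (v o))) (by
      intro v hv
      rw [map_prod]
      refine Finset.prod_eq_zero (i := v) (hfin.mem_toFinset.2 hv) (by simp))
    rw [map_prod, Finset.prod_eq_zero_iff] at h0
    obtain ⟨v, _, hv⟩ := h0
    refine ⟨v o, ?_⟩
    rw [map_sub, aeval_X, algHom_C, sub_eq_zero] at hv
    exact hv
  exact ⟨fun l => key (Sum.inl l), fun l => key (Sum.inr l)⟩

theorem minor_exists {U V : Fin 4 → K} (h : ∀ s t : K, s • U + t • V = 0 → s = 0 ∧ t = 0) : ∃ i j, U i * V j - U j * V i ≠ 0 := by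
  by_contra hc
  push Not at hc
  by_cases hU : U = 0
  · have := h 1 0 (by simp [hU])
    simp at this
  · obtain ⟨i, hi⟩ := Function.ne_iff.1 hU
    have := h (V i) (-U i) (by
      ext j
      simp only [Pi.add_apply, Pi.smul_apply, smul_eq_mul, Pi.zero_apply]
      linear_combination hc j i)
    exact hi (by simpa using this.2)

theorem NL_gen [IsAlgClosed k] {F : MvPolynomial (Fin 4) k}
    (hlines : {L : Submodule k (Fin 4 → k) | Module.finrank k L = 2 ∧ ∀ x ∈ L, eval x F = 0}.Finite)
    {c a b : K} (hab : ∀ u0 u1 u2 : k, algebraMap k K u0 + algebraMap k K u1 * a + algebraMap k K u2 * b = 0 → u0 = 0 ∧ u1 = 0 ∧ u2 = 0) : NL (rst c a b F) := by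
  intro u v huv
  by_contra hc
  push Not at hc
  let E : (Fin 3 → K) → (Fin 4 → K) := fun x => ![x 0, x 1, x 2, c * x 0 + a * x 1 + b * x 2]
  have hE : ∀ x, E x 3 = c * E x 0 + a * E x 1 + b * E x 2 := fun x => rfl
  have hEl : ∀ (s t : K), E (s • u + t • v) = s • E u + t • E v := by
    intro s t
    ext i; fin_cases i <;> simp [E]; ring
  obtain ⟨i, j, hij⟩ := minor_exists (U := E u) (V := E v) (by
    intro s t hst
    rw [← hEl] at hst
    apply huv
    ext i; fin_cases i
    · exact congrFun hst 0
    · exact congrFun hst 1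
    · exact congrFun hst 2)
  set m := E u i * E v j - E u j * E v i with hm
  let P : Fin 4 → K := (E v j / m) • E u + (-(E u j) / m) • E v
  let Q : Fin 4 → K := (-(E v i) / m) • E u + (E u i / m) • E v
  have hP3 : P 3 = c * P 0 + a * P 1 + b * P 2 := by
    simp only [P, Pi.add_apply, Pi.smul_apply, smul_eq_mul, hE]; ring
  have hQ3 : Q 3 = c * Q 0 + a * Q 1 + b * Q 2 := by
    simp only [Q, Pi.add_apply, Pi.smul_apply, smul_eq_mul, hE]; ring
  have pi : P i = 1 := by simp only [P, Pi.add_apply, Pi.smul_apply, smul_eq_mul]; field_simp; rw [hm]; ring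
  have pj : P j = 0 := by simp only [P, Pi.add_apply, Pi.smul_apply, smul_eq_mul]; field_simp; ring
  have qi : Q i = 0 := by simp only [Q, Pi.add_apply, Pi.smul_apply, smul_eq_mul]; field_simp; ring
  have qj : Q j = 1 := by simp only [Q, Pi.add_apply, Pi.smul_apply, smul_eq_mul]; field_simp; rw [hm]; ring
  obtain ⟨h1, h2⟩ := lines_k hlines pi pj qi qj (by
    intro s t
    have h3 : s • P + t • Q = E ((s * (E v j / m) + t * (-(E v i) / m)) • u + (s * (-(E u j) / m) + t * (E u i / m)) • v) := by
      rw [hEl]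
      ext l
      simp only [P, Q, Pi.add_apply, Pi.smul_apply, smul_eq_mul]
      ring
    rw [h3, ← rst_eval, hc])
  choose p hp using h1
  choose q hq using h2
  have key : ∀ s t : k, algebraMap k K s * P 0 + algebraMap k K t * Q 0 = 0 → s = 0 ∧ t = 0 := by
    intro s t h0
    have hr : ∀ l, algebraMap k K s * P l + algebraMap k K t * Q l = algebraMap k K (s * p l + t * q l) := by
      intro l; rw [hp, hq]; simp
    have h4 := hab (-(s * p 3 + t * q 3)) (s * p 1 + t * q 1) (s * p 2 + t * q 2) (by
      rw [map_neg, ← hr, ← hr, ← hr, hP3, hQ3]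
      linear_combination -c * h0)
    have hz : ∀ l, s * p l + t * q l = 0 := by
      intro l
      fin_cases l
      · have := hr 0
        rw [h0] at this
        exact (map_eq_zero_iff _ (algebraMap k K).injective).1 this.symm
      · exact h4.2.1
      · exact h4.2.2
      · exact neg_eq_zero.1 h4.1
    have zi := hr i
    have zj := hr j
    rw [hz, pi, qi] at zi
    rw [hz, pj, qj] at zj
    simp at zi zj
    exact ⟨zi, zj⟩
  by_cases hp0 : p 0 = 0
  · have := key 1 0 (by rw [hp 0, hp0]; simp)
    simp at this
  · have := key (q 0) (-p 0) (by rw [hp 0, hq 0]; simp; ring)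
    exact hp0 (by simpa using this.2)
end

theorem tb_adjoin {k K ι : Type*} [Field k] [Field K] [Algebra k K] {x : ι → K} (hab : AlgebraicIndependent k x) :
    IsTranscendenceBasis k (fun i => (⟨x i, Algebra.subset_adjoin ⟨i, rfl⟩⟩ : Algebra.adjoin k (Set.range x))) := by
  have hai : AlgebraicIndependent k (fun i => (⟨x i, Algebra.subset_adjoin ⟨i, rfl⟩⟩ : Algebra.adjoin k (Set.range x))) :=
    AlgebraicIndependent.of_comp (Subalgebra.val _) hab
  rw [hai.isTranscendenceBasis_iff_isAlgebraic]
  have e : Set.range (fun i => (⟨x i, Algebra.subset_adjoin ⟨i, rfl⟩⟩ : Algebra.adjoin k (Set.range x))) = (↑) ⁻¹' (Set.range x) := by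
    ext x
    constructor
    · rintro ⟨i, rfl⟩; exact ⟨i, rfl⟩
    · rintro ⟨i, hi⟩; exact ⟨i, Subtype.ext hi⟩
  rw [e, Algebra.adjoin_adjoin_coe_preimage]
  exact ⟨fun x => isAlgebraic_algebraMap (⟨x, trivial⟩ : (⊤ : Subalgebra k (Algebra.adjoin k (Set.range _))))⟩

theorem ext_base.{u, w} {k : Type u} {K : Type w} [Field k] [Field K] [Algebra k K] [IsAlgClosed K] {a b : K}
    (hab : AlgebraicIndependent k ![a, b]) : ∃ (E : IntermediateField k K), IsAlgClosed E ∧ IsTranscendenceBasis E ![a, b] := by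
  have : FaithfulSMul (Algebra.adjoin k (Set.range ![a, b])) K := inferInstance
  obtain ⟨Z, hZ⟩ := exists_isTranscendenceBasis (Algebra.adjoin k (Set.range ![a, b])) K
  have hx : IsTranscendenceBasis k (fun i => (⟨![a, b] i, Algebra.subset_adjoin ⟨i, rfl⟩⟩ : Algebra.adjoin k (Set.range ![a, b]))) := by
    exact tb_adjoin hab
  have hT := hx.sumElim_comp hZ
  have hx' : (algebraMap (Algebra.adjoin k (Set.range ![a, b])) K ∘ (fun i => (⟨![a, b] i, Algebra.subset_adjoin ⟨i, rfl⟩⟩ : Algebra.adjoin k (Set.range ![a, b])))) = ![a, b] := rfl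
  rw [hx'] at hT
  have hT1 : AlgebraicIndependent k (Sum.elim ![a, b] ((↑) : Z → K)) := by
    have := hT.1.comp (Equiv.sumComm (Fin 2) Z) (Equiv.injective _)
    have e : (Sum.elim ((↑) : Z → K) ![a, b]) ∘ (Equiv.sumComm (Fin 2) Z) = Sum.elim ![a, b] ((↑) : Z → K) := by
      ext i; rcases i with i | i <;> rfl
    rwa [e] at this
  have h2 := (AlgebraicIndependent.sumElim_iff.1 hT1).2
  rw [Subtype.range_coe] at h2
  have h3 := IntermediateField.algebraicIndependent_adjoin_iff.2 h2
  have h4 := h3.algebraicClosure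
  let L := algebraicClosure (IntermediateField.adjoin k Z) K
  have hZL : ∀ z ∈ Z, z ∈ cl k Z := fun z hz => cl_sub Z hz
  refine ⟨cl k Z, IsAlgClosure.isAlgClosed (IntermediateField.adjoin k Z) (K := L), ?_⟩
  have h5 : AlgebraicIndependent (cl k Z) ![a, b] := h4
  rw [h5.isTranscendenceBasis_iff_isAlgebraic]
  have : IsScalarTower k (Algebra.adjoin (cl k Z) (Set.range ![a, b])) K := inferInstance
  rw [hT.isAlgebraic_iff]
  rintro (z | i)
  · exact isAlgebraic_algebraMap (A := K) (algebraMap (cl k Z) (Algebra.adjoin (cl k Z) (Set.range ![a, b])) ⟨z, hZL z z.2⟩)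
  · exact isAlgebraic_algebraMap (A := K) (⟨![a, b] i, Algebra.subset_adjoin ⟨i, rfl⟩⟩ : Algebra.adjoin (cl k Z) (Set.range ![a, b]))

theorem core2.{u, w} {k : Type u} {K : Type w} [Field k] [Field K] [Algebra k K] [IsAlgClosed k] [CharZero k] [IsAlgClosed K] {c a b : K} {F : MvPolynomial (Fin 4) k} {d n : ℕ} (hdn : d = n + 3) (hn : 1 ≤ n)
    (hF : F.IsHomogeneous d) (hirr : Irreducible F)
    (hlines : {L : Submodule k (Fin 4 → k) |
      Module.finrank k L = 2 ∧ ∀ x ∈ L, eval x F = 0}.Finite) {A B : MvPolynomial (Fin 3) K}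
    (hA : A.IsHomogeneous 3) (hB : B.IsHomogeneous n) (hAB : rst c a b F = A * B)
    (hab : AlgebraicIndependent k ![a, b]) : False := by
  have hNL : NL (rst c a b F) := by
    apply NL_gen hlines
    intro u0 u1 u2 hg
    have h1 : aeval ![a, b] (C u0 + C u1 * X 0 + C u2 * X 1 : MvPolynomial (Fin 2) k) = aeval ![a, b] (0 : MvPolynomial (Fin 2) k) := by
      rw [map_zero, ← hg]
      simp
    have h2 := hab h1
    have e0 := congrArg (eval ![0, 0]) h2
    have e1 := congrArg (eval ![1, 0]) h2
    have e2 := congrArg (eval ![0, 1]) h2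
    simp at e0 e1 e2
    rw [e0] at e1 e2
    rw [zero_add] at e1 e2
    exact ⟨e0, e1, e2⟩
  obtain ⟨E, hE, hT⟩ := ext_base hab
  have hcz : CharZero E := charZero_of_injective_algebraMap (algebraMap k E).injective
  have hF' : (map (algebraMap k E) F).IsHomogeneous d := hF.map _
  have hr : rst c a b (map (algebraMap k E) F) = rst c a b F := by
    simp only [rst]
    exact aeval_map_algebraMap E _ F
  rw [hAB] at hr hNL
  exact core hdn hn hF' (irr_base (by omega) hF hirr) hA hB hr hNL hT

section
variable {k K : Type*} [Field k] [Field K] [Algebra k K]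

noncomputable def sysP (S S' : Finset (Fin 3 →₀ ℕ)) (F : MvPolynomial (Fin 4) k) :
    MvPolynomial (Fin 3) (MvPolynomial (Fin 3 ⊕ (S ⊕ S')) k) :=
  aeval ![X 0, X 1, X 2, C (X (Sum.inl 0)) * X 0 + C (X (Sum.inl 1)) * X 1 + C (X (Sum.inl 2)) * X 2] F
    - genP S (fun m => X (Sum.inr (Sum.inl m))) * genP S' (fun m => X (Sum.inr (Sum.inr m)))

theorem sysP_map (S S' : Finset (Fin 3 →₀ ℕ)) (F : MvPolynomial (Fin 4) k) (ψ : MvPolynomial (Fin 3 ⊕ (S ⊕ S')) k →ₐ[k] K) :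
    map (ψ : MvPolynomial (Fin 3 ⊕ (S ⊕ S')) k →+* K) (sysP S S' F) =
      rst (ψ (X (Sum.inl 0))) (ψ (X (Sum.inl 1))) (ψ (X (Sum.inl 2))) F
        - genP S (fun m => ψ (X (Sum.inr (Sum.inl m)))) * genP S' (fun m => ψ (X (Sum.inr (Sum.inr m)))) := by
  rw [sysP, map_sub, map_mul, genP_map, genP_map]
  congr 1
  have h := comp_aeval_apply (R := k) ![X 0, X 1, X 2, C (X (Sum.inl 0)) * X 0 + C (X (Sum.inl 1)) * X 1 + C (X (Sum.inl 2)) * X 2] (mapAlgHom ψ : MvPolynomial (Fin 3) (MvPolynomial (Fin 3 ⊕ (S ⊕ S')) k) →ₐ[k] _) F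
  refine h.trans ?_
  rw [rst]
  refine congrArg (fun w => aeval w F) ?_
  funext i
  fin_cases i <;> simp

theorem deg_fin (e : ℕ) : ∃ S : Finset (Fin 3 →₀ ℕ), ∀ m, m ∈ S ↔ m.degree = e := by
  refine ⟨Finset.finsuppAntidiag Finset.univ e, fun m => ?_⟩
  rw [Finset.mem_finsuppAntidiag, Finsupp.degree_eq_sum]
  simp

theorem dep [IsAlgClosed k] [CharZero k] {F : MvPolynomial (Fin 4) k} {d n : ℕ} (hdn : d = n + 3) (hn : 1 ≤ n)
    (hF : F.IsHomogeneous d) (hirr : Irreducible F)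
    (hlines : {L : Submodule k (Fin 4 → k) |
      Module.finrank k L = 2 ∧ ∀ x ∈ L, eval x F = 0}.Finite) :
    ∃ g : MvPolynomial (Fin 2) k, g ≠ 0 ∧ ∀ c a b : k, (∃ A B : MvPolynomial (Fin 3) k, A.IsHomogeneous 3 ∧ B.IsHomogeneous n ∧
      rst c a b F = A * B) → eval ![a, b] g = 0 := by
  obtain ⟨S, hS⟩ := deg_fin 3
  obtain ⟨S', hS'⟩ := deg_fin n
  let I : Ideal (MvPolynomial (Fin 3 ⊕ (S ⊕ S')) k) := Ideal.span (Set.range fun M => coeff M (sysP S S' F))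
  let f : MvPolynomial (Fin 2) k →ₐ[k] MvPolynomial (Fin 3 ⊕ (S ⊕ S')) k := aeval ![X (Sum.inl 1), X (Sum.inl 2)]
  by_cases h0 : ∃ g : MvPolynomial (Fin 2) k, g ≠ 0 ∧ f g ∈ I
  · obtain ⟨g, g0, hg⟩ := h0
    refine ⟨g, g0, fun c a b ⟨A, B, hA, hB, hAB⟩ => ?_⟩
    let ψ : MvPolynomial (Fin 3 ⊕ (S ⊕ S')) k →ₐ[k] k :=
      aeval (Sum.elim ![c, a, b] (Sum.elim (fun m => coeff m.1 A) (fun m => coeff m.1 B)))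
    have h1 : I ≤ RingHom.ker (ψ : MvPolynomial (Fin 3 ⊕ (S ⊕ S')) k →+* k) := by
      rw [Ideal.span_le]
      rintro _ ⟨M, rfl⟩
      have := congrArg (coeff M) (sysP_map S S' F ψ)
      rw [coeff_map] at this
      refine this.trans ?_
      simp only [ψ, aeval_X, Sum.elim_inl, Sum.elim_inr]
      rw [genP_self A _ (fun m hm => (hS m).2 (hom_deg hA m hm)), genP_self B _ (fun m hm => (hS' m).2 (hom_deg hB m hm))]
      have : rst (k := k) (![c, a, b] 0) (![c, a, b] 1) (![c, a, b] 2) F = A * B := hAB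
      rw [this, sub_self, coeff_zero]
    have h2 : ψ (f g) = 0 := h1 hg
    have h3 := comp_aeval_apply (R := k) ![X (Sum.inl 1), X (Sum.inl 2)] ψ g
    rw [← aeval_eq_eval]
    refine Eq.trans ?_ h2
    refine Eq.trans ?_ h3.symm
    refine congrArg (fun w => aeval w g) ?_
    funext i
    fin_cases i <;> simp [ψ]
  · exfalso
    push Not at h0
    obtain ⟨Q, hIQ, hQ, hQ0⟩ := Ideal.exists_ideal_comap_le_prime (f := f) ⊥ I (by
      intro g hg
      by_contra hg0
      exact h0 g hg0 hg)
    let D := MvPolynomial (Fin 3 ⊕ (S ⊕ S')) k ⧸ Q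
    let Ω := AlgebraicClosure (FractionRing D)
    let ψ : MvPolynomial (Fin 3 ⊕ (S ⊕ S')) k →ₐ[k] Ω := (IsScalarTower.toAlgHom k D Ω).comp (Ideal.Quotient.mkₐ k Q)
    have hinj : Function.Injective (algebraMap D Ω) := by
      rw [IsScalarTower.algebraMap_eq D (FractionRing D) Ω]
      exact (algebraMap (FractionRing D) Ω).injective.comp (IsFractionRing.injective D (FractionRing D))
    have hψ : ∀ p, ψ p = 0 → p ∈ Q := by
      intro p hp
      rw [← Ideal.Quotient.eq_zero_iff_mem]
      apply hinj
      rw [map_zero]; exact hp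
    have hψ' : ∀ p ∈ Q, ψ p = 0 := by
      intro p hp
      have : Ideal.Quotient.mkₐ k Q p = 0 := Ideal.Quotient.eq_zero_iff_mem.2 hp
      rw [AlgHom.comp_apply, this, map_zero]
    clear_value ψ
    have hab : AlgebraicIndependent k ![ψ (X (Sum.inl 1)), ψ (X (Sum.inl 2))] := by
      rw [algebraicIndependent_iff]
      intro g hg
      have h3 := comp_aeval_apply (R := k) ![X (Sum.inl 1), X (Sum.inl 2)] ψ g
      have h4 : ψ (f g) = 0 := by
        refine h3.trans (Eq.trans (congrArg (fun w => aeval w g) ?_) hg)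
        funext i
        fin_cases i <;> rfl
      exact hQ0 (hψ _ h4)
    have h5 := sysP_map S S' F ψ
    have h6 : map (ψ : MvPolynomial (Fin 3 ⊕ (S ⊕ S')) k →+* Ω) (sysP S S' F) = 0 := by
      ext M
      rw [coeff_map, coeff_zero]
      exact hψ' _ (hIQ (Ideal.subset_span ⟨M, rfl⟩))
    rw [h6] at h5
    exact core2 hdn hn hF hirr hlines (genP_hom S _ 3 (fun m hm => (hS m).1 hm)) (genP_hom S' _ n (fun m hm => (hS' m).1 hm))
      (sub_eq_zero.1 h5.symm) hab

end

section
variable {k : Type*} [Field k]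

theorem one_var [IsAlgClosed k] {h : MvPolynomial (Fin 4) k} (hh : Irreducible h) (i : Fin 4) (hd : ∀ r, r ≠ i → degreeOf r h = 0) :
    ∃ l : k, ∀ x : Fin 4 → k, x i = l → eval x h = 0 := by
  let hp : Polynomial k := aeval (fun j => if j = i then Polynomial.X else 0) h
  have he : ∀ x : Fin 4 → k, eval x h = hp.eval (x i) := by
    intro x
    have : (Polynomial.evalRingHom (x i)) hp = eval x h := by
      apply hom_congr_vars (f₁ := (Polynomial.evalRingHom (x i)).comp ((aeval (fun j => if j = i then Polynomial.X else 0) : MvPolynomial (Fin 4) k →ₐ[k] Polynomial k) : MvPolynomial (Fin 4) k →+* Polynomial k)) (f₂ := eval x) _ _ rfl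
      · ext r; simp
      · intro j hj _
        have : j = i := by
          by_contra hji
          have h1 := hd j hji
          rw [mem_vars] at hj
          obtain ⟨m, hm, hmj⟩ := hj
          have h2 := monomial_le_degreeOf j hm
          rw [h1] at h2
          rw [Finsupp.mem_support_iff] at hmj
          omega
        subst this
        simp
    exact this.symm
  by_cases h0 : hp.degree = 0
  · exfalso
    have h1 : h = C (hp.coeff 0) := by
      apply MvPolynomial.funext
      intro x
      rw [he x, Polynomial.eq_C_of_degree_eq_zero h0]
      simp
    apply hh.not_isUnit
    rw [h1]
    refine (IsUnit.mk0 _ ?_).map C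
    intro h2
    rw [h2, C_0] at h1
    exact hh.ne_zero h1
  · obtain ⟨l, hl⟩ := IsAlgClosed.exists_root hp h0
    exact ⟨l, fun x hx => by rw [he, hx]; exact hl⟩

theorem two_height [IsAlgClosed k] (Q : Ideal (MvPolynomial (Fin 4) k)) [Q.IsPrime]
    (h : ∃ i, ∀ r, r ≠ i → ∃ G ∈ Q, degreeOf r G = 0 ∧ ∀ l : k, ∃ x : Fin 4 → k, x i = l ∧ eval x G ≠ 0) :
    ∃ h : MvPolynomial (Fin 4) k, Irreducible h ∧ h ∈ Q ∧ Q ≠ Ideal.span {h} := by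
  obtain ⟨i, hi⟩ := h
  have key : ∀ r, r ≠ i → ∃ G ∈ Q, G ≠ 0 ∧ degreeOf r G = 0 ∧ ∀ l : k, ∃ x : Fin 4 → k, x i = l ∧ eval x G ≠ 0 := by
    intro r hr
    obtain ⟨G, hG, hG0, hGl⟩ := hi r hr
    refine ⟨G, hG, ?_, hG0, hGl⟩
    rintro rfl
    obtain ⟨x, _, hx⟩ := hGl 0
    simp at hx
  obtain ⟨r, hr⟩ : ∃ r : Fin 4, r ≠ i := exists_ne i
  obtain ⟨G, hG, hG0, hGd, hGl⟩ := key r hr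
  obtain ⟨h, hhQ, hhG⟩ : ∃ h ∈ UniqueFactorizationMonoid.factors G, h ∈ Q := by
    have h1 := UniqueFactorizationMonoid.factors_prod hG0
    have h2 : (UniqueFactorizationMonoid.factors G).prod ∈ Q := by
      obtain ⟨u, hu⟩ := h1
      rw [← hu] at hG
      exact (Ideal.IsPrime.mem_or_mem ‹Q.IsPrime› hG).resolve_right (fun h => (‹Q.IsPrime›).ne_top (Ideal.eq_top_of_isUnit_mem _ h u.isUnit))
    exact (Ideal.IsPrime.multiset_prod_mem_iff_exists_mem ‹Q.IsPrime› _).1 h2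
  have hirr := UniqueFactorizationMonoid.irreducible_of_factor h hhQ
  refine ⟨h, hirr, hhG, fun hQ => ?_⟩
  have hd : ∀ r, r ≠ i → degreeOf r h = 0 := by
    intro r hr
    obtain ⟨G, hG, hG0, hGd, hGl⟩ := key r hr
    rw [hQ, Ideal.mem_span_singleton] at hG
    obtain ⟨B, rfl⟩ := hG
    rw [degreeOf_mul_eq (left_ne_zero_of_mul hG0) (right_ne_zero_of_mul hG0)] at hGd
    omega
  obtain ⟨l, hl⟩ := one_var hirr i hd
  obtain ⟨x, hx, hx'⟩ := hGl l
  rw [hQ, Ideal.mem_span_singleton] at hG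
  obtain ⟨B, rfl⟩ := hG
  rw [map_mul, hl x hx, zero_mul] at hx'
  exact hx' rfl

theorem dimJ [IsAlgClosed k] (J : Ideal (MvPolynomial (Fin 4) k))
    (h : ∀ Q : Ideal (MvPolynomial (Fin 4) k), Q.IsPrime → J ≤ Q → 
      ∃ i, ∀ r, r ≠ i → ∃ G ∈ Q, degreeOf r G = 0 ∧ ∀ l : k, ∃ x : Fin 4 → k, x i = l ∧ eval x G ≠ 0) :
    ringKrullDim (MvPolynomial (Fin 4) k ⧸ J) ≤ (2 : WithBot ℕ∞) := by
  rw [ringKrullDim_quotient, Order.krullDim]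
  apply iSup_le
  intro p
  let p' : LTSeries (PrimeSpectrum (MvPolynomial (Fin 4) k)) := p.map (fun q => q.1) (fun _ _ h => h)
  let Q := p'.head
  have hQJ : J ≤ Q.asIdeal := p.head.2
  obtain ⟨f, hf, hfQ, hne⟩ := two_height Q.asIdeal (h Q.asIdeal Q.2 hQJ)
  let P1 : PrimeSpectrum (MvPolynomial (Fin 4) k) := ⟨Ideal.span {f}, (Ideal.span_singleton_prime hf.ne_zero).2 hf.prime⟩
  have h1 : P1 < p'.head := by
    refine lt_of_le_of_ne ?_ ?_
    · show Ideal.span {f} ≤ _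
      rw [Ideal.span_singleton_le_iff_mem]; exact hfQ
    · intro h2
      exact hne (congrArg PrimeSpectrum.asIdeal h2).symm
  have h2 : (⊥ : PrimeSpectrum (MvPolynomial (Fin 4) k)) < P1 := by
    rw [bot_lt_iff_ne_bot]
    intro h3
    have : Ideal.span {f} = ⊥ := congrArg PrimeSpectrum.asIdeal h3
    rw [Ideal.span_singleton_eq_bot] at this
    exact hf.ne_zero this
  let p1 : LTSeries (PrimeSpectrum (MvPolynomial (Fin 4) k)) := RelSeries.cons p' P1 h1
  have h2' : (⊥ : PrimeSpectrum (MvPolynomial (Fin 4) k)) < RelSeries.head p1 := by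
    rw [RelSeries.head_cons]; exact h2
  let p2 : LTSeries (PrimeSpectrum (MvPolynomial (Fin 4) k)) := RelSeries.cons p1 ⊥ h2'
  have h4 : (p2.length : WithBot ℕ∞) ≤ ringKrullDim (MvPolynomial (Fin 4) k) := Order.LTSeries.length_le_krullDim p2
  have h5 : p2.length = p.length + 2 := by
    show (RelSeries.cons _ _ _).length = _
    rw [RelSeries.cons_length]
    show (RelSeries.cons _ _ _).length + 1 = _
    rw [RelSeries.cons_length]
    rfl
  rw [h5, MvPolynomial.ringKrullDim_of_isNoetherianRing] at h4
  simp at h4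
  have h6 : p.length + 2 ≤ 4 := by
    exact_mod_cast h4
  have : p.length ≤ 2 := by omega
  exact_mod_cast this

end

section
variable {k : Type*} [Field k]

theorem top_comp {σ : Type*} {g : MvPolynomial σ k} (g0 : g ≠ 0) : homogeneousComponent g.totalDegree g ≠ 0 := by
  have hs : g.support.Nonempty := by
    rw [Finset.nonempty_iff_ne_empty, Ne, support_eq_empty]; exact g0
  obtain ⟨m, hm, he⟩ := Finset.exists_mem_eq_sup g.support hs (fun s => s.sum fun _ e => e)
  intro h
  have h1 := congrArg (coeff m) h
  rw [coeff_homogeneousComponent, if_pos, coeff_zero] at h1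
  · exact mem_support_iff.1 hm h1
  · exact he.symm

theorem exists_eval_ne [Infinite k] {g : MvPolynomial (Fin 2) k} (g0 : g ≠ 0) : ∃ x y : k, eval ![x, y] g ≠ 0 := by
  by_contra h
  push Not at h
  apply g0
  apply MvPolynomial.funext
  intro x
  rw [map_zero, ← h (x 0) (x 1)]
  refine congrArg (fun w => eval w g) ?_
  funext i; fin_cases i <;> rfl

theorem homogenize [Infinite k] {g : MvPolynomial (Fin 2) k} (g0 : g ≠ 0) {i p q r : Fin 4} (hip : i ≠ p) (hiq : i ≠ q) (hpq : p ≠ q)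
    (hri : r ≠ i) (hrp : r ≠ p) (hrq : r ≠ q) :
    ∃ G : MvPolynomial (Fin 4) k, degreeOf r G = 0 ∧ (∀ l : k, ∃ x : Fin 4 → k, x i = l ∧ eval x G ≠ 0) ∧
      ∀ a : Fin 4 → k, a i ≠ 0 → eval ![-(a p) / a i, -(a q) / a i] g = 0 → eval a G = 0 := by
  let N := g.totalDegree
  let G : MvPolynomial (Fin 4) k := ∑ m ∈ Finset.range (N + 1), X i ^ (N - m) * aeval ![-X p, -X q] (homogeneousComponent m g)
  have hev : ∀ a : Fin 4 → k, eval a G = ∑ m ∈ Finset.range (N + 1), a i ^ (N - m) * eval ![-a p, -a q] (homogeneousComponent m g) := by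
    intro a
    simp only [G, map_sum, map_mul, map_pow, eval_X]
    refine Finset.sum_congr rfl fun m _ => ?_
    congr 1
    have h := comp_aeval_apply (R := k) ![-X p, -X q] (aeval a : MvPolynomial (Fin 4) k →ₐ[k] k) (homogeneousComponent m g)
    rw [← aeval_eq_eval, ← aeval_eq_eval]
    refine h.trans ?_
    refine congrArg (fun w => aeval w (homogeneousComponent m g)) ?_
    funext j; fin_cases j <;> simp
  have hnz : ∀ a : Fin 4 → k, a i ≠ 0 → eval a G = a i ^ N * eval ![-(a p) / a i, -(a q) / a i] g := by
    intro a ha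
    rw [hev]
    conv_rhs => rw [← sum_homogeneousComponent g, map_sum, Finset.mul_sum]
    refine Finset.sum_congr rfl fun m hm => ?_
    have e : ![-a p, -a q] = a i • ![-(a p) / a i, -(a q) / a i] := by
      funext j
      fin_cases j
      · show -a p = a i * (-(a p) / a i)
        field_simp
      · show -a q = a i * (-(a q) / a i)
        field_simp
    rw [e, eval_smul_hom (homogeneousComponent_isHomogeneous m g), ← mul_assoc, ← pow_add]
    have : N - m + m = N := by
      rw [Finset.mem_range] at hm; omega
    rw [this]
  refine ⟨G, ?_, ?_, ?_⟩
  · have hG : G ∈ supported k ({r}ᶜ : Set (Fin 4)) := by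
      have hX : ∀ j, r ≠ j → (X j : MvPolynomial (Fin 4) k) ∈ supported k ({r}ᶜ : Set (Fin 4)) := by
        intro j hj
        rw [X_mem_supported]
        exact fun h => hj h.symm
      refine Subalgebra.sum_mem _ fun m _ => Subalgebra.mul_mem _ (Subalgebra.pow_mem _ (hX i hri) _) ?_
      have := Subalgebra.mvPolynomial_aeval_coe (supported k ({r}ᶜ : Set (Fin 4))) ![⟨-X p, neg_mem (hX p hrp)⟩, ⟨-X q, neg_mem (hX q hrq)⟩] (homogeneousComponent m g)
      have e : (aeval ![-X p, -X q] (homogeneousComponent m g) : MvPolynomial (Fin 4) k) = aeval (fun i => ((![⟨-X p, neg_mem (hX p hrp)⟩, ⟨-X q, neg_mem (hX q hrq)⟩] : Fin 2 → supported k ({r}ᶜ : Set (Fin 4))) i : MvPolynomial (Fin 4) k)) (homogeneousComponent m g) := by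
        refine congrArg (fun w => aeval w (homogeneousComponent m g)) ?_
        funext j; fin_cases j <;> rfl
      rw [e, this]
      exact Subtype.property _
    rw [mem_supported] at hG
    by_contra h
    exact hG (mem_vars_iff_degreeOf_ne_zero.2 h) rfl
  · intro l
    by_cases hl : l = 0
    · obtain ⟨x, y, hxy⟩ := exists_eval_ne (top_comp g0)
      refine ⟨fun j => if j = p then -x else if j = q then -y else l, ?_, ?_⟩
      · simp [hip, hiq]
      · rw [hev, Finset.sum_eq_single N]
        · simpa [hip, hiq, hpq.symm] using hxy
        · intro m hm hmN
          have : N - m ≠ 0 := by rw [Finset.mem_range] at hm; omega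
          simp [hip, hiq, hl, this]
        · simp
    · obtain ⟨x, y, hxy⟩ := exists_eval_ne g0
      refine ⟨fun j => if j = p then -(l * x) else if j = q then -(l * y) else l, ?_, ?_⟩
      · simp [hip, hiq]
      · rw [hnz]
        · have e1 : l * x / l = x := by field_simp
          have e2 : l * y / l = y := by field_simp
          simp [hip, hiq, hpq.symm, hl, e1, e2, hxy]
        · simp [hip, hiq, hl]
  · intro a ha h
    rw [hnz a ha, h, mul_zero]

end

section
variable {k : Type*} [Field k]

theorem restrict_eval {m n : ℕ} (G : MvPolynomial (Fin m) k) (ψ : (Fin n → k) →ₗ[k] (Fin m → k)) (y : Fin n → k) :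
    eval y (restrictPoly G ψ) = eval (ψ y) G := by
  have h := comp_aeval_apply (R := k) (fun i => ∑ j, C (ψ (Pi.single j 1) i) * X j) (aeval y : MvPolynomial (Fin n) k →ₐ[k] k) G
  rw [← aeval_eq_eval, ← aeval_eq_eval]
  refine h.trans ?_
  refine congrArg (fun w => aeval w G) ?_
  funext i
  simp only [map_sum, map_mul, algHom_C, aeval_X, Algebra.algebraMap_self, RingHom.id_apply]
  have h1 : ψ y = ∑ j, y j • ψ (Pi.single j 1) := by
    conv_lhs => rw [← Finset.univ_sum_single y]
    rw [map_sum]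
    refine Finset.sum_congr rfl fun j _ => ?_
    rw [← map_smul]
    congr 1
    rw [← Pi.single_smul, smul_eq_mul, mul_one]
  rw [h1, Finset.sum_apply]
  refine Finset.sum_congr rfl fun j _ => ?_
  rw [Pi.smul_apply, smul_eq_mul, mul_comm]

theorem restrict_hom {m n : ℕ} {G : MvPolynomial (Fin m) k} {e : ℕ} (hG : G.IsHomogeneous e) (ψ : (Fin n → k) →ₗ[k] (Fin m → k)) :
    (restrictPoly G ψ).IsHomogeneous e := by
  have := MvPolynomial.IsHomogeneous.aeval (n := 1) (S := k) (τ := Fin n) hG (fun i => ∑ j, C (ψ (Pi.single j 1) i) * X j) ?_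
  · rwa [one_mul] at this
  · intro i
    refine IsHomogeneous.sum _ _ _ fun j _ => ?_
    have := (isHomogeneous_C (Fin n) (ψ (Pi.single j 1) i)).mul (isHomogeneous_X k j)
    rwa [zero_add] at this

theorem W_fac [Infinite k] {F : MvPolynomial (Fin 4) k} {d n : ℕ} (hdn : d = n + 3) (hF : F.IsHomogeneous d) (a : Fin 4 → k)
    (φ : (Fin 3 → k) ≃ₗ[k] (LinearMap.ker (∑ i, a i • LinearMap.proj i : (Fin 4 → k) →ₗ[k] k)))
    {c g : MvPolynomial (Fin 3) k} (hc : c.IsHomogeneous 3)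
    (h : restrictPoly F ((LinearMap.ker (∑ i, a i • LinearMap.proj i : (Fin 4 → k) →ₗ[k] k)).subtype.comp φ.toLinearMap) = c * g)
    (e : Equiv.Perm (Fin 4)) (he : a (e 3) ≠ 0) :
    ∃ A B : MvPolynomial (Fin 3) k, A.IsHomogeneous 3 ∧ B.IsHomogeneous n ∧
      rst (-(a (e 0)) / a (e 3)) (-(a (e 1)) / a (e 3)) (-(a (e 2)) / a (e 3)) (rename e.symm F) = A * B := by
  let L : Fin 4 → ((Fin 3 → k) →ₗ[k] k) := ![LinearMap.proj 0, LinearMap.proj 1, LinearMap.proj 2,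
    (-(a (e 0)) / a (e 3)) • LinearMap.proj 0 + (-(a (e 1)) / a (e 3)) • LinearMap.proj 1 + (-(a (e 2)) / a (e 3)) • LinearMap.proj 2]
  let T : (Fin 3 → k) →ₗ[k] (Fin 4 → k) := LinearMap.pi (fun j => L (e.symm j))
  have hT : ∀ y, T y ∈ LinearMap.ker (∑ i, a i • LinearMap.proj i : (Fin 4 → k) →ₗ[k] k) := by
    intro y
    rw [LinearMap.mem_ker]
    simp only [LinearMap.sum_apply, LinearMap.smul_apply, LinearMap.proj_apply, smul_eq_mul]
    have : ∑ j, a j * T y j = ∑ j, a (e j) * L j y := by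
      rw [← Equiv.sum_comp e]
      refine Finset.sum_congr rfl fun j _ => ?_
      show a (e j) * L (e.symm (e j)) y = _
      rw [e.symm_apply_apply]
    rw [this, Fin.sum_univ_four]
    show a (e 0) * y 0 + a (e 1) * y 1 + a (e 2) * y 2 + a (e 3) * ((-(a (e 0)) / a (e 3)) * y 0 + (-(a (e 1)) / a (e 3)) * y 1 + (-(a (e 2)) / a (e 3)) * y 2) = 0
    field_simp
    ring
  let τ : (Fin 3 → k) →ₗ[k] (Fin 3 → k) := φ.symm.toLinearMap.comp (T.codRestrict _ hT)
  have hτ : ∀ y, (φ (τ y) : Fin 4 → k) = T y := by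
    intro y
    show (φ (φ.symm (T.codRestrict _ hT y)) : Fin 4 → k) = T y
    rw [φ.apply_symm_apply]
    rfl
  have key : rst (-(a (e 0)) / a (e 3)) (-(a (e 1)) / a (e 3)) (-(a (e 2)) / a (e 3)) (rename e.symm F) = restrictPoly c τ * restrictPoly g τ := by
    apply MvPolynomial.funext
    intro y
    rw [rst_eval, map_mul, restrict_eval, restrict_eval, ← map_mul, ← h, restrict_eval, aeval_eq_eval]
    show eval _ (rename e.symm F) = _
    rw [eval_rename]
    refine congrArg (fun w => eval w F) ?_
    show _ = (φ (τ y) : Fin 4 → k)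
    rw [hτ]
    funext j
    show _ = L (e.symm j) y
    rw [Function.comp_apply]
    generalize e.symm j = i
    fin_cases i <;> rfl
  have hA := restrict_hom hc τ
  by_cases h0 : restrictPoly c τ * restrictPoly g τ = 0
  · exact ⟨restrictPoly c τ, 0, hA, isHomogeneous_zero _ _ _, by rw [key, h0, mul_zero]⟩
  · have hFr : (rename e.symm F).IsHomogeneous d := hF.rename_isHomogeneous
    have h1 := rst_hom (-(a (e 0)) / a (e 3)) (-(a (e 1)) / a (e 3)) (-(a (e 2)) / a (e 3)) hFr
    rw [key] at h1
    obtain ⟨i, j, hi, hj, hij⟩ := hom_factor h1 h0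
    have : i = 3 := hi.inj_right hA (left_ne_zero_of_mul h0)
    have hjn : j = n := by omega
    subst hjn
    exact ⟨_, _, hA, hj, key⟩

theorem perm_lines {F : MvPolynomial (Fin 4) k} (hlines : {L : Submodule k (Fin 4 → k) |
      Module.finrank k L = 2 ∧ ∀ x ∈ L, eval x F = 0}.Finite) (e : Equiv.Perm (Fin 4)) :
    {L : Submodule k (Fin 4 → k) | Module.finrank k L = 2 ∧ ∀ x ∈ L, eval x (rename e.symm F) = 0}.Finite := by
  let T : (Fin 4 → k) ≃ₗ[k] (Fin 4 → k) := LinearEquiv.funCongrLeft k k e.symm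
  refine Set.Finite.of_injOn (f := fun L => L.map T.toLinearMap) ?_ (Submodule.map_injective_of_injective T.injective).injOn hlines
  rintro L ⟨h1, h2⟩
  refine ⟨?_, ?_⟩
  · rw [← h1]; exact LinearEquiv.finrank_map_eq T L
  · rintro _ ⟨x, hx, rfl⟩
    have := h2 x hx
    rw [eval_rename] at this
    exact this

end

theorem perm_ex : ∀ i r : Fin 4, r ≠ i → ∃ e : Equiv.Perm (Fin 4), e 3 = i ∧ e 0 = r := by
  intro i r h
  refine ⟨(Equiv.swap 0 (Equiv.swap 3 i r)).trans (Equiv.swap 3 i), ?_, ?_⟩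
  · revert i r; decide
  · revert i r; decide

section
variable {k : Type*} [Field k]

/-- planes with a cubic factor, in all coordinate charts -/
def Wset (F : MvPolynomial (Fin 4) k) (n : ℕ) : Set (Fin 4 → k) :=
  {a | a ≠ 0 ∧ ∀ e : Equiv.Perm (Fin 4), a (e 3) ≠ 0 → ∃ A B : MvPolynomial (Fin 3) k, A.IsHomogeneous 3 ∧ B.IsHomogeneous n ∧
      rst (-(a (e 0)) / a (e 3)) (-(a (e 1)) / a (e 3)) (-(a (e 2)) / a (e 3)) (rename e.symm F) = A * B}

theorem Wset_smul {F : MvPolynomial (Fin 4) k} {n : ℕ} {a : Fin 4 → k} (ha : a ∈ Wset F n) {t : k} (ht : t ≠ 0) :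
    t • a ∈ Wset F n := by
  refine ⟨smul_ne_zero ht ha.1, fun e he => ?_⟩
  have h1 : a (e 3) ≠ 0 := by
    intro h; apply he; rw [Pi.smul_apply, h, smul_zero]
  obtain ⟨A, B, hA, hB, h⟩ := ha.2 e h1
  refine ⟨A, B, hA, hB, ?_⟩
  rw [← h]
  have : ∀ j, -((t • a) (e j)) / (t • a) (e 3) = -(a (e j)) / a (e 3) := by
    intro j
    simp only [Pi.smul_apply, smul_eq_mul]
    field_simp
  rw [this, this, this]

def Jid (W : Set (Fin 4 → k)) : Ideal (MvPolynomial (Fin 4) k) where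
  carrier := {f | ∀ a ∈ W, eval a f = 0}
  add_mem' := by
    intro f g hf hg a ha
    rw [map_add, hf a ha, hg a ha, add_zero]
  zero_mem' := by
    intro a _; rw [map_zero]
  smul_mem' := by
    intro c f hf a ha
    rw [smul_eq_mul, map_mul, hf a ha, mul_zero]

theorem Jid_hom [Infinite k] {W : Set (Fin 4 → k)} (hW : ∀ a ∈ W, ∀ t : k, t ≠ 0 → t • a ∈ W) (f) (hf : f ∈ Jid W) (j : ℕ) :
    homogeneousComponent j f ∈ Jid W := by
  intro a ha
  let P : Polynomial k := ∑ m ∈ Finset.range (f.totalDegree + 1), Polynomial.C (eval a (homogeneousComponent m f)) * Polynomial.X ^ m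
  have hP : P = 0 := by
    apply Polynomial.eq_zero_of_infinite_isRoot
    refine Set.Infinite.mono (s := ({0} : Set k)ᶜ) ?_ (Set.finite_singleton (0 : k)).infinite_compl
    intro t ht
    have h1 := hf (t • a) (hW a ha t ht)
    show P.eval t = 0
    rw [← h1]
    conv_rhs => rw [← sum_homogeneousComponent f, map_sum]
    simp only [P, Polynomial.eval_finsetSum, Polynomial.eval_mul, Polynomial.eval_C, Polynomial.eval_pow, Polynomial.eval_X]
    refine Finset.sum_congr rfl fun m _ => ?_
    rw [eval_smul_hom (homogeneousComponent_isHomogeneous m f), mul_comm]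
  by_cases hj : j ≤ f.totalDegree
  · have h2 := congrArg (fun p => Polynomial.coeff p j) hP
    simp only [P, Polynomial.finsetSum_coeff, Polynomial.coeff_C_mul_X_pow, Polynomial.coeff_zero] at h2
    rw [Finset.sum_ite_eq, if_pos (by rw [Finset.mem_range]; omega)] at h2
    exact h2
  · rw [homogeneousComponent_eq_zero _ _ (by omega), map_zero]

theorem Jid_dim [IsAlgClosed k] [CharZero k] {F : MvPolynomial (Fin 4) k} {d n : ℕ} (hdn : d = n + 3) (hn : 1 ≤ n)
    (hF : F.IsHomogeneous d) (hirr : Irreducible F)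
    (hlines : {L : Submodule k (Fin 4 → k) |
      Module.finrank k L = 2 ∧ ∀ x ∈ L, eval x F = 0}.Finite) :
    ringKrullDim (MvPolynomial (Fin 4) k ⧸ Jid (Wset F n)) ≤ (2 : WithBot ℕ∞) := by
  have hinf : Infinite k := IsAlgClosed.instInfinite
  apply dimJ
  intro Q hQ hJQ
  have h1 : ∃ i, ∀ f : MvPolynomial (Fin 4) k, (∀ a ∈ Wset F n, a i ≠ 0 → eval a f = 0) → f ∈ Q := by
    by_contra h
    push Not at h
    choose f hf hfQ using h
    have h2 : ∏ i, f i ∈ Q := by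
      apply hJQ
      intro a ha
      obtain ⟨i, hi⟩ := Function.ne_iff.1 ha.1
      rw [map_prod]
      exact Finset.prod_eq_zero (Finset.mem_univ i) (hf i a ha hi)
    obtain ⟨i, _, hi⟩ := (Ideal.IsPrime.prod_mem_iff (s := Finset.univ) (x := f)).1 h2
    exact hfQ i hi
  obtain ⟨i, hi⟩ := h1
  refine ⟨i, fun r hr => ?_⟩
  obtain ⟨e, rfl, rfl⟩ := perm_ex i r hr
  obtain ⟨g, g0, hg⟩ := dep hdn hn (F := rename e.symm F) hF.rename_isHomogeneous (rename_irr _ e.symm.injective hirr) (perm_lines hlines e)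
  obtain ⟨G, hGd, hGl, hGa⟩ := homogenize g0 (i := e 3) (p := e 1) (q := e 2) (r := e 0)
    (e.injective.ne (by decide)) (e.injective.ne (by decide)) (e.injective.ne (by decide)) (e.injective.ne (by decide))
    (e.injective.ne (by decide)) (e.injective.ne (by decide))
  refine ⟨G, hi G fun a ha ha3 => ?_, hGd, hGl⟩
  exact hGa a ha3 (hg _ _ _ (ha.2 e ha3))

end

end Helpers

/-- Lemma 5.4 of Salberger: for an integral surface `X = {F = 0} ⊂ P^3` of degree
`d ≥ 4` over an algebraically closed field of characteristic `0` with only finitely many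
lines, the set `W ⊆ P^{3∨}` of planes `Π` such that `Π ∩ X` contains a cubic curve is
contained in a closed subset of dimension at most `1` (expressed below by a homogeneous
ideal `J` in the coordinates `a` of `P^{3∨}` whose quotient ring has Krull dimension at
most `2`, all of whose elements vanish at the coefficient vector of every plane in `W`). -/
theorem stmt_19 (k : Type*) [Field k] [IsAlgClosed k] [CharZero k] (d : ℕ) (hd : 4 ≤ d)
    (F : MvPolynomial (Fin 4) k) (hhom : F.IsHomogeneous d) (hirr : Irreducible F)
    (hlines : {L : Submodule k (Fin 4 → k) |
      Module.finrank k L = 2 ∧ ∀ x ∈ L, eval x F = 0}.Finite) :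
    ∃ J : Ideal (MvPolynomial (Fin 4) k),
      (∀ f ∈ J, ∀ j : ℕ, homogeneousComponent j f ∈ J) ∧
      ringKrullDim (MvPolynomial (Fin 4) k ⧸ J) ≤ (2 : WithBot ℕ∞) ∧
      ∀ a : Fin 4 → k, a ≠ 0 →
        (∃ φ : (Fin 3 → k) ≃ₗ[k]
            (LinearMap.ker (∑ i, a i • LinearMap.proj i : (Fin 4 → k) →ₗ[k] k)),
          ∃ c g : MvPolynomial (Fin 3) k, c.IsHomogeneous 3 ∧ c ≠ 0 ∧
            restrictPoly F
              ((LinearMap.ker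
                  (∑ i, a i • LinearMap.proj i : (Fin 4 → k) →ₗ[k] k)).subtype.comp
                φ.toLinearMap) = c * g) →
        ∀ f ∈ J, eval a f = 0 := by
  have hinf : Infinite k := IsAlgClosed.instInfinite
  obtain ⟨n, rfl⟩ : ∃ n, d = n + 3 := ⟨d - 3, by omega⟩
  refine ⟨Jid (Wset F n), fun f hf j => Jid_hom (fun a ha t ht => Wset_smul ha ht) f hf j,
    Jid_dim rfl (by omega) hhom hirr hlines, ?_⟩
  rintro a ha ⟨φ, c, g, hc, _, h⟩ f hf
  exact hf a ⟨ha, fun e he => W_fac rfl hhom a φ hc h e he⟩
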